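/- Under hypotheses (H1)–(H4), let μ be the Borel measure on ℝ⁴ given by μ(E) = ∫_{V₁^{c,d}} χ_E(x, φ(x)) dx, let E_μ ⊆ [0,1]² be the set of pairs (1/p, 1/q) for which there is a constant C_{p,q} > 0 with ‖μ ∗ f‖_{L^q(ℝ⁴)} ≤ C_{p,q} ‖f‖_{L^p(ℝ⁴)} for all Schwartz functions f on ℝ⁴, and set p₀ = (α₁+α₂+2m)/(α₁+α₂+m) with 1/p₀ + 1/p₀' = 1. Then the closed triangle with vertices (0,0), (1,1) and (1/p₀, 1/p₀') is contained in E_μ, and the point (1/p₀, 1/p₀') lies on the topological boundary of E_μ. -/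

import Mathlib

open MeasureTheory Real Set
open scoped ENNReal

noncomputable section

/-- Nonisotropic dilation `t ∙ x = (t^{α₁} x₁, t^{α₂} x₂)` (for `t > 0`). -/
def dil (α₁ α₂ t : ℝ) (x : Fin 2 → ℝ) : Fin 2 → ℝ :=
  ![t ^ α₁ * x 0, t ^ α₂ * x 1]

/-- The region `V^{a,b} = { t ∙ (1,s) : s ∈ (a,b), t > 0 }`. -/
def Vab (α₁ α₂ a b : ℝ) : Set (Fin 2 → ℝ) :=
  {x | ∃ s t : ℝ, a < s ∧ s < b ∧ 0 < t ∧ x = dil α₁ α₂ t ![1, s]}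

/-- The region `V₁^{c,d} = { t ∙ (1,s) : s ∈ (c,d), 0 < t < 1 }`. -/
def V1 (α₁ α₂ c d : ℝ) : Set (Fin 2 → ℝ) :=
  {x | ∃ s t : ℝ, c < s ∧ s < d ∧ 0 < t ∧ t < 1 ∧ x = dil α₁ α₂ t ![1, s]}

/-- Membership in the unit circle `S¹ ⊂ ℝ²`. -/
def onS1 (ζ : Fin 2 → ℝ) : Prop := ζ 0 ^ 2 + ζ 1 ^ 2 = 1

/-- The standard inner product on `ℝ²`. -/
def dot2 (u v : Fin 2 → ℝ) : ℝ := u 0 * v 0 + u 1 * v 1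

/-- Hessian matrix of second partial derivatives of `f` at `x`. -/
def Hess (f : (Fin 2 → ℝ) → ℝ) (x : Fin 2 → ℝ) : Matrix (Fin 2) (Fin 2) ℝ :=
  Matrix.of fun i j => fderiv ℝ (fun y => fderiv ℝ f y (Pi.single j 1)) x (Pi.single i 1)

/-- The form `Q_x(ζ) = det (ζ₁ Hess φ₁(x) + ζ₂ Hess φ₂(x))`. -/
def Qform (φ : (Fin 2 → ℝ) → Fin 2 → ℝ) (x ζ : Fin 2 → ℝ) : ℝ :=
  (ζ 0 • Hess (fun y => φ y 0) x + ζ 1 • Hess (fun y => φ y 1) x).det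

/-- `x` is an elliptic point for `φ`: `min_{ζ ∈ S¹} |Q_x(ζ)| > 0`. -/
def Elliptic (φ : (Fin 2 → ℝ) → Fin 2 → ℝ) (x : Fin 2 → ℝ) : Prop :=
  ∃ ε : ℝ, 0 < ε ∧ ∀ ζ : Fin 2 → ℝ, onS1 ζ → ε ≤ |Qform φ x ζ|

/-- The symmetric matrix `K(x)` associated with the quadratic form `Q_x`,
i.e. the matrix with entries `k₁₁ = det Hess φ₁`, `k₂₂ = det Hess φ₂`,
`k₁₂ = k₂₁ = ½(∂₁₁φ₁ ∂₂₂φ₂ + ∂₂₂φ₁ ∂₁₁φ₂ − 2 ∂₁₂φ₁ ∂₁₂φ₂)`, which satisfies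
`Q_x(ζ) = ⟨K(x)ζ, ζ⟩`. -/
def Kmat (φ : (Fin 2 → ℝ) → Fin 2 → ℝ) (x : Fin 2 → ℝ) : Matrix (Fin 2) (Fin 2) ℝ :=
  Matrix.of
    ![![(Hess (fun y => φ y 0) x).det,
        ((Hess (fun y => φ y 0) x) 0 0 * (Hess (fun y => φ y 1) x) 1 1
          + (Hess (fun y => φ y 0) x) 1 1 * (Hess (fun y => φ y 1) x) 0 0
          - 2 * (Hess (fun y => φ y 0) x) 0 1 * (Hess (fun y => φ y 1) x) 0 1) / 2],
      ![((Hess (fun y => φ y 0) x) 0 0 * (Hess (fun y => φ y 1) x) 1 1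
          + (Hess (fun y => φ y 0) x) 1 1 * (Hess (fun y => φ y 1) x) 0 0
          - 2 * (Hess (fun y => φ y 0) x) 0 1 * (Hess (fun y => φ y 1) x) 0 1) / 2,
        (Hess (fun y => φ y 1) x).det]]

/-- The function `G(ζ,s) = ⟨φ(1,s), ζ⟩`. -/
def Gfun (φ : (Fin 2 → ℝ) → Fin 2 → ℝ) (ζ : Fin 2 → ℝ) (s : ℝ) : ℝ :=
  dot2 (φ ![1, s]) ζ

/-- The standard inner product on `ℝ⁴`. -/
def dot4 (u v : Fin 4 → ℝ) : ℝ := u 0 * v 0 + u 1 * v 1 + u 2 * v 2 + u 3 * v 3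

/-- The graph map `x ↦ (x, φ(x)) ∈ ℝ⁴`. -/
def graphMap (φ : (Fin 2 → ℝ) → Fin 2 → ℝ) (x : Fin 2 → ℝ) : Fin 4 → ℝ :=
  ![x 0, x 1, φ x 0, φ x 1]

/-- The Fourier transform on `ℝ⁴`, `ĝ(ξ) = ∫ e^{-i⟨x,ξ⟩} g(x) dx`. -/
def ftrans (g : (Fin 4 → ℝ) → ℂ) (ξ : Fin 4 → ℝ) : ℂ :=
  ∫ x : Fin 4 → ℝ, Complex.exp (-Complex.I * (dot4 x ξ : ℂ)) * g x

/-- The Fourier transform of the measure `μ`,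
`μ̂(ξ) = ∫_{V₁^{c,d}} e^{-i⟨(x,φ(x)),ξ⟩} dx`. -/
def muHat (α₁ α₂ c d : ℝ) (φ : (Fin 2 → ℝ) → Fin 2 → ℝ) (ξ : Fin 4 → ℝ) : ℂ :=
  ∫ x in V1 α₁ α₂ c d, Complex.exp (-Complex.I * (dot4 (graphMap φ x) ξ : ℂ))

/-- Convolution with the measure `μ`: `(μ ∗ g)(y) = ∫_{V₁^{c,d}} g(y − (x, φ(x))) dx`. -/
def muConv (α₁ α₂ c d : ℝ) (φ : (Fin 2 → ℝ) → Fin 2 → ℝ) (g : (Fin 4 → ℝ) → ℂ)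
    (y : Fin 4 → ℝ) : ℂ :=
  ∫ x in V1 α₁ α₂ c d, g (y - graphMap φ x)

/-- The function `H(ζ,s)` of Remark 2.4 / Statement 19, built from `G(ζ,s) = ⟨φ(1,s),ζ⟩`. -/
def Hfun (α₁ α₂ m : ℝ) (φ : (Fin 2 → ℝ) → Fin 2 → ℝ) (ζ : Fin 2 → ℝ) (s : ℝ) : ℝ :=
  m * (m - α₁) * Gfun φ ζ s * deriv (deriv (Gfun φ ζ)) s
    + α₂ * (α₁ - α₂) * s * deriv (Gfun φ ζ) s * deriv (deriv (Gfun φ ζ)) s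
    - (m - α₂) ^ 2 * (deriv (Gfun φ ζ) s) ^ 2

/-- Constants in the sublevel set estimate of order `ℓ`. -/
def sublevelConst : ℕ → ℝ
  | 0 => 2
  | n + 1 => 2 + 4 * sublevelConst n

lemma sublevelConst_pos (n : ℕ) : 0 < sublevelConst n := by
  induction n with
  | zero => norm_num [sublevelConst]
  | succ n ih => simp only [sublevelConst]; linarith

lemma mul_abs_sub_le_of_le_abs_deriv {f f' : ℝ → ℝ} {u v κ : ℝ}
    (hf : ∀ s ∈ Icc u v, HasDerivAt f (f' s) s) (hκ : ∀ s ∈ Icc u v, κ ≤ |f' s|)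
    {s t : ℝ} (hs : s ∈ Icc u v) (ht : t ∈ Icc u v) :
    κ * |t - s| ≤ |f t - f s| := by
  wlog hst : s < t generalizing s t with H
  · rcases (not_lt.1 hst).eq_or_lt with h | h
    · simp [h]
    · rw [abs_sub_comm t s, abs_sub_comm (f t)]
      exact H ht hs h
  have hsub : Icc s t ⊆ Icc u v := Icc_subset_Icc hs.1 ht.2
  obtain ⟨ξ, hξ, h⟩ := exists_hasDerivAt_eq_slope f f' hst
    (fun x hx => (hf x (hsub hx)).continuousAt.continuousWithinAt)
    (fun x hx => hf x (hsub (Ioo_subset_Icc_self hx)))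
  have hpos : 0 < t - s := by linarith
  have h2 : f t - f s = f' ξ * (t - s) := by rw [h]; field_simp
  rw [h2, abs_mul]
  exact mul_le_mul_of_nonneg_right (hκ ξ (hsub (Ioo_subset_Icc_self hξ))) (abs_nonneg _)

/-- Sublevel set estimate: if the derivative of order `n + 1` is at least `κ` in absolute value,
the set where the function is at most `κ r ^ (n + 1)` has measure `O(r)`. -/
lemma volume_sublevel_le (n : ℕ) : ∀ (G : ℕ → ℝ → ℝ) (u v κ r : ℝ), 0 < κ → 0 < r →
    (∀ i, ∀ s ∈ Icc u v, HasDerivAt (G i) (G (i + 1) s) s) →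
    (∀ s ∈ Icc u v, κ ≤ |G (n + 1) s|) →
    volume {s | s ∈ Icc u v ∧ |G 0 s| ≤ κ * r ^ (n + 1)}
      ≤ ENNReal.ofReal (sublevelConst n * r) := by
  induction n with
  | zero =>
    intro G u v κ r hκ hr hG hlow
    refine (Real.volume_le_diam _).trans ?_
    refine Metric.ediam_le ?_
    rintro s ⟨hs, hs'⟩ t ⟨ht, ht'⟩
    rw [edist_dist]
    apply ENNReal.ofReal_le_ofReal
    have h1 := mul_abs_sub_le_of_le_abs_deriv (hG 0) hlow hs ht
    have h2 : |G 0 t - G 0 s| ≤ κ * r + κ * r := by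
      refine (abs_sub _ _).trans ?_
      simp only [zero_add, pow_one] at hs' ht'
      linarith
    have h3 : κ * |t - s| ≤ κ * (2 * r) := by linarith
    rw [Real.dist_eq, abs_sub_comm]
    simpa [sublevelConst] using le_of_mul_le_mul_left h3 hκ
  | succ n ih =>
    intro G u v κ r hκ hr hG hlow
    by_cases huv : u ≤ v
    swap
    · rw [Icc_eq_empty huv]; simp
    have hcont : ContinuousOn (fun s => |G (n + 1) s|) (Icc u v) := fun s hs =>
      (hG (n + 1) s hs).continuousAt.abs.continuousWithinAt
    obtain ⟨p, hp, hmin⟩ := isCompact_Icc.exists_isMinOn (nonempty_Icc.2 huv) hcont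
    have hbig : ∀ t ∈ Icc u v, κ * |t - p| / 2 ≤ |G (n + 1) t| := by
      intro t ht
      have h1 := mul_abs_sub_le_of_le_abs_deriv (hG (n + 1)) hlow hp ht
      have h2 := abs_sub (G (n + 1) t) (G (n + 1) p)
      have h3 : |G (n + 1) p| ≤ |G (n + 1) t| := hmin ht
      linarith
    have hpow : κ * r ^ (n + 1 + 1) ≤ κ * r / 2 * (2 * r) ^ (n + 1) := by
      have : (1 : ℝ) ≤ 2 ^ n := one_le_pow₀ (by norm_num)
      have h0 : 0 < κ * r ^ (n + 1 + 1) := by positivity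
      calc κ * r ^ (n + 1 + 1) ≤ 2 ^ n * (κ * r ^ (n + 1 + 1)) := by nlinarith
        _ = _ := by rw [mul_pow]; ring
    have hL := ih G u (p - r) (κ * r / 2) (2 * r) (by positivity) (by positivity)
      (fun i s hs => hG i s ⟨hs.1, by linarith [hs.2, hp.2]⟩)
      (fun s hs => by
        have hs' : s ∈ Icc u v := ⟨hs.1, by linarith [hs.2, hp.2]⟩
        refine le_trans ?_ (hbig s hs')
        have : r ≤ |s - p| := by
          rw [abs_sub_comm]
          exact le_trans (by linarith [hs.2]) (le_abs_self _)
        have := mul_le_mul_of_nonneg_left this hκ.le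
        linarith)
    have hR := ih G (p + r) v (κ * r / 2) (2 * r) (by positivity) (by positivity)
      (fun i s hs => hG i s ⟨by linarith [hs.1, hp.1], hs.2⟩)
      (fun s hs => by
        have hs' : s ∈ Icc u v := ⟨by linarith [hs.1, hp.1], hs.2⟩
        refine le_trans ?_ (hbig s hs')
        have : r ≤ |s - p| := le_trans (by linarith [hs.1]) (le_abs_self _)
        have := mul_le_mul_of_nonneg_left this hκ.le
        linarith)
    have hsub : {s | s ∈ Icc u v ∧ |G 0 s| ≤ κ * r ^ (n + 1 + 1)} ⊆
        Icc (p - r) (p + r) ∪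
        ({s | s ∈ Icc u (p - r) ∧ |G 0 s| ≤ κ * r / 2 * (2 * r) ^ (n + 1)} ∪
        {s | s ∈ Icc (p + r) v ∧ |G 0 s| ≤ κ * r / 2 * (2 * r) ^ (n + 1)}) := by
      rintro s ⟨hs, hs'⟩
      by_cases h1 : s ≤ p - r
      · exact Or.inr (Or.inl ⟨⟨hs.1, h1⟩, hs'.trans hpow⟩)
      by_cases h2 : p + r ≤ s
      · exact Or.inr (Or.inr ⟨⟨h2, hs.2⟩, hs'.trans hpow⟩)
      · exact Or.inl ⟨by linarith, by linarith⟩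
    refine (measure_mono hsub).trans ((measure_union_le _ _).trans ?_)
    refine (add_le_add_right ((measure_union_le _ _).trans (add_le_add hL hR)) _).trans ?_
    rw [Real.volume_Icc]
    have hc := sublevelConst_pos n
    rw [← ENNReal.ofReal_add (by positivity) (by positivity),
      ← ENNReal.ofReal_add (by linarith) (by positivity)]
    apply ENNReal.ofReal_le_ofReal
    simp only [sublevelConst]
    nlinarith

/-- If the derivative of order `n + 1` is at least `κ` in absolute value, the negative power
`|G| ^ (-ρ)` is integrable with a bound depending only on `κ, n, ρ`, once `ρ (n + 1) < 1`. -/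
lemma lintegral_rpow_neg_le (n : ℕ) (ρ κ u v : ℝ) (hρ : 0 ≤ ρ) (hρn : ρ * (n + 1) < 1)
    (hκ : 0 < κ) : ∃ C : ℝ≥0∞, C ≠ ∞ ∧ ∀ (G : ℕ → ℝ → ℝ),
    (∀ i, ∀ s ∈ Icc u v, HasDerivAt (G i) (G (i + 1) s) s) →
    (∀ s ∈ Icc u v, κ ≤ |G (n + 1) s|) →
    ∫⁻ s in Icc u v, (ENNReal.ofReal |G 0 s|) ^ (-ρ) ≤ C := by
  set q : ℝ := 2 ^ (ρ * (n + 1) - 1) with hq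
  have hq1 : q < 1 := Real.rpow_lt_one_of_one_lt_of_neg (by norm_num) (by linarith)
  have hq0 : 0 < q := by positivity
  set A : ℝ := κ ^ (-ρ) * 2 ^ (ρ * (n + 1)) with hA
  have hA0 : 0 < A := by positivity
  have hc := sublevelConst_pos n
  refine ⟨ENNReal.ofReal (κ ^ (-ρ)) * volume (Icc u v) +
    ENNReal.ofReal (A * sublevelConst n) * ∑' k : ℕ, (ENNReal.ofReal q) ^ k, ?_, ?_⟩
  · refine ENNReal.add_ne_top.2 ⟨ENNReal.mul_ne_top (by simp) (by simp),
      ENNReal.mul_ne_top (by simp) ?_⟩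
    rw [ENNReal.tsum_geometric]
    refine ENNReal.inv_ne_top.2 ?_
    have : ENNReal.ofReal q < 1 := by simpa using hq1
    exact (tsub_pos_of_lt this).ne'
  intro G hG hlow
  have hcont : ContinuousOn (fun s => |G 0 s|) (Icc u v) := fun s hs =>
    (hG 0 s hs).continuousAt.abs.continuousWithinAt
  set E : ℕ → Set ℝ := fun k => {s | s ∈ Icc u v ∧ |G 0 s| ≤ κ * ((2 : ℝ)⁻¹ ^ k) ^ (n + 1)}
    with hE
  have hEm : ∀ k, MeasurableSet (E k) := fun k =>
    (hcont.preimage_isClosed_of_isClosed isClosed_Icc isClosed_Iic).measurableSet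
  have hEv : ∀ k, volume (E k) ≤ ENNReal.ofReal (sublevelConst n * 2⁻¹ ^ k) := fun k =>
    volume_sublevel_le n G u v κ _ hκ (by positivity) hG hlow
  set w : ℕ → ℝ := fun k => A * (2 ^ (ρ * (n + 1))) ^ k with hw
  have hzero : volume {s | s ∈ Icc u v ∧ G 0 s = 0} = 0 := by
    have hle : ∀ k : ℕ, volume {s | s ∈ Icc u v ∧ G 0 s = 0} ≤
        ENNReal.ofReal (sublevelConst n * 2⁻¹ ^ k) := fun k => by
      refine le_trans (measure_mono ?_) (hEv k)
      rintro s ⟨hs, h0⟩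
      exact ⟨hs, by rw [h0, abs_zero]; positivity⟩
    have hlim : Filter.Tendsto (fun k : ℕ => ENNReal.ofReal (sublevelConst n * 2⁻¹ ^ k))
        Filter.atTop (nhds 0) := by
      have := (tendsto_pow_atTop_nhds_zero_of_lt_one (r := (2 : ℝ)⁻¹) (by norm_num)
        (by norm_num)).const_mul (sublevelConst n)
      simpa using ENNReal.tendsto_ofReal this
    exact le_antisymm (ge_of_tendsto' hlim hle) zero_le
  have hpt : ∀ᵐ s ∂(volume.restrict (Icc u v)), (ENNReal.ofReal |G 0 s|) ^ (-ρ) ≤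
      ENNReal.ofReal (κ ^ (-ρ)) + ∑' k : ℕ, (E k).indicator (fun _ => ENNReal.ofReal (w k)) s := by
    rw [ae_restrict_iff' measurableSet_Icc]
    have : ∀ᵐ s ∂volume, ¬ (s ∈ Icc u v ∧ G 0 s = 0) := by
      rw [ae_iff]; simpa only [not_not] using hzero
    filter_upwards [this] with s hs0 hs
    have hne : G 0 s ≠ 0 := fun h => hs0 ⟨hs, h⟩
    have hpos : 0 < |G 0 s| := abs_pos.2 hne
    rw [ENNReal.ofReal_rpow_of_pos hpos]
    by_cases hbig : κ ≤ |G 0 s|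
    · refine le_trans (ENNReal.ofReal_le_ofReal ?_) le_self_add
      exact Real.rpow_le_rpow_of_nonpos hκ hbig (by linarith)
    · push Not at hbig
      have hex : ∃ k : ℕ, κ * ((2 : ℝ)⁻¹ ^ k) ^ (n + 1) < |G 0 s| := by
        have hlim : Filter.Tendsto (fun k : ℕ => κ * ((2 : ℝ)⁻¹ ^ k) ^ (n + 1))
            Filter.atTop (nhds 0) := by
          have := ((tendsto_pow_atTop_nhds_zero_of_lt_one (r := (2 : ℝ)⁻¹) (by norm_num)
            (by norm_num)).pow (n + 1)).const_mul κ
          simpa using this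
        exact (hlim.eventually (gt_mem_nhds hpos)).exists
      classical
      obtain ⟨j, hj⟩ : ∃ j, Nat.find hex = j + 1 := by
        refine Nat.exists_eq_succ_of_ne_zero fun h0 => ?_
        have := Nat.find_spec hex
        rw [h0] at this
        simp at this
        linarith
      have h1 := Nat.find_spec hex
      rw [hj] at h1
      have h2 := Nat.find_min hex (m := j) (by omega)
      push Not at h2
      have hmem : s ∈ E j := ⟨hs, h2⟩
      refine le_trans ?_ le_add_self
      refine le_trans ?_ (ENNReal.le_tsum j)
      rw [indicator_of_mem hmem]
      apply ENNReal.ofReal_le_ofReal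
      refine (Real.rpow_le_rpow_of_nonpos (by positivity) h1.le (by linarith)).trans (le_of_eq ?_)
      rw [Real.mul_rpow hκ.le (by positivity), hw]
      simp only [hA]
      rw [mul_assoc]
      congr 1
      rw [← pow_succ', ← pow_mul, inv_pow, Real.inv_rpow (by positivity),
        ← Real.rpow_neg (by positivity),
        neg_neg, ← Real.rpow_natCast, ← Real.rpow_natCast, ← Real.rpow_mul (by norm_num),
        ← Real.rpow_mul (by norm_num)]
      congr 1
      push_cast
      ring
  refine (lintegral_mono_ae hpt).trans ?_
  rw [lintegral_add_left measurable_const, lintegral_const,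
    lintegral_tsum (fun k => (measurable_const.indicator (hEm k)).aemeasurable)]
  rw [Measure.restrict_apply_univ, ← ENNReal.tsum_mul_left]
  gcongr with k
  rw [lintegral_indicator (hEm k), lintegral_const, Measure.restrict_apply_univ]
  refine (mul_le_mul_right (((Measure.restrict_le_self) _).trans (hEv k)) _).trans ?_
  rw [← ENNReal.ofReal_mul (by positivity), ← ENNReal.ofReal_pow hq0.le,
    ← ENNReal.ofReal_mul (by positivity)]
  apply ENNReal.ofReal_le_ofReal
  simp only [hw]
  refine le_of_eq ?_
  have : q = 2 ^ (ρ * (n + 1)) * 2⁻¹ := by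
    rw [hq, Real.rpow_sub (by norm_num), Real.rpow_one]; rfl
  rw [this, mul_pow]
  ring

/-- Uniform integrability of `|ζ₁ p₀ + ζ₂ p₁| ^ (-ρ)` over the unit circle, when no combination
vanishes to an order `ℓ` with `ρ ℓ ≥ 1`. -/
lemma exists_lintegral_rpow_neg_le {a b c d ρ : ℝ} (hac : a < c) (hdb : d < b) (hρ : 0 ≤ ρ)
    {p₀ p₁ : ℝ → ℝ} (h₀ : AnalyticOnNhd ℝ p₀ (Ioo a b)) (h₁ : AnalyticOnNhd ℝ p₁ (Ioo a b))
    (hord : ∀ ζ : ℝ × ℝ, ζ.1 ^ 2 + ζ.2 ^ 2 = 1 → ∀ s ∈ Icc c d, ∃ ℓ : ℕ, ρ * ℓ < 1 ∧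
      ζ.1 * iteratedDeriv ℓ p₀ s + ζ.2 * iteratedDeriv ℓ p₁ s ≠ 0) :
    ∃ C : ℝ≥0∞, C ≠ ∞ ∧ ∀ ζ : ℝ × ℝ, ζ.1 ^ 2 + ζ.2 ^ 2 = 1 →
      ∫⁻ s in Icc c d, (ENNReal.ofReal |ζ.1 * p₀ s + ζ.2 * p₁ s|) ^ (-ρ) ≤ C := by
  set K : Set ((ℝ × ℝ) × ℝ) := {ζ : ℝ × ℝ | ζ.1 ^ 2 + ζ.2 ^ 2 = 1} ×ˢ Icc c d with hK
  have hS : IsCompact {ζ : ℝ × ℝ | ζ.1 ^ 2 + ζ.2 ^ 2 = 1} := by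
    refine (isCompact_Icc (a := ((-1, -1) : ℝ × ℝ)) (b := (1, 1))).of_isClosed_subset
      (isClosed_eq (by fun_prop) continuous_const) ?_
    rintro ⟨x, y⟩ h
    simp only [mem_ofPred_eq] at h
    simp only [mem_Icc, Prod.mk_le_mk]
    refine ⟨⟨?_, ?_⟩, ?_, ?_⟩ <;> nlinarith [sq_nonneg x, sq_nonneg y]
  have hKc : IsCompact K := hS.prod isCompact_Icc
  have key : ∃ C : ℝ≥0∞, C ≠ ∞ ∧ ∀ ζ : ℝ × ℝ, ζ.1 ^ 2 + ζ.2 ^ 2 = 1 →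
      ∫⁻ s in {s | (ζ, s) ∈ K}, (ENNReal.ofReal |ζ.1 * p₀ s + ζ.2 * p₁ s|) ^ (-ρ) ≤ C := by
    refine hKc.induction_on (p := fun S => ∃ C : ℝ≥0∞, C ≠ ∞ ∧ ∀ ζ : ℝ × ℝ,
      ζ.1 ^ 2 + ζ.2 ^ 2 = 1 →
      ∫⁻ s in {s | (ζ, s) ∈ S}, (ENNReal.ofReal |ζ.1 * p₀ s + ζ.2 * p₁ s|) ^ (-ρ) ≤ C)
      ⟨0, by simp, by simp⟩ ?_ ?_ ?_
    · rintro S T hST ⟨C, hC, h⟩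
      exact ⟨C, hC, fun ζ hζ => (lintegral_mono_set
        (show {s | (ζ, s) ∈ S} ⊆ {s | (ζ, s) ∈ T} from fun s hs => hST hs)).trans (h ζ hζ)⟩
    · rintro S T ⟨C, hC, h⟩ ⟨C', hC', h'⟩
      refine ⟨C + C', ENNReal.add_ne_top.2 ⟨hC, hC'⟩, fun ζ hζ => ?_⟩
      refine le_trans ?_ (add_le_add (h ζ hζ) (h' ζ hζ))
      exact lintegral_union_le _ {s | (ζ, s) ∈ S} {s | (ζ, s) ∈ T}
    · rintro ⟨ζ₀, s₀⟩ ⟨hζ₀, hs₀⟩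
      obtain ⟨ℓ, hℓ, hne⟩ := hord ζ₀ hζ₀ s₀ hs₀
      have hs₀' : s₀ ∈ Ioo a b := ⟨hac.trans_le hs₀.1, hs₀.2.trans_lt hdb⟩
      have han : ∀ i, AnalyticOnNhd ℝ (iteratedDeriv i p₀) (Ioo a b) ∧
          AnalyticOnNhd ℝ (iteratedDeriv i p₁) (Ioo a b) := by
        intro i
        rw [iteratedDeriv_eq_iterate, iteratedDeriv_eq_iterate]
        exact ⟨h₀.iterated_deriv i, h₁.iterated_deriv i⟩
      set Gf : ℝ × ℝ → ℕ → ℝ → ℝ := fun ζ i s =>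
        ζ.1 * iteratedDeriv i p₀ s + ζ.2 * iteratedDeriv i p₁ s with hGf
      have hder : ∀ ζ i, ∀ s ∈ Ioo a b, HasDerivAt (Gf ζ i) (Gf ζ (i + 1) s) s := by
        intro ζ i s hs
        have e0 := ((han i).1 s hs).differentiableAt.hasDerivAt
        have e1 := ((han i).2 s hs).differentiableAt.hasDerivAt
        rw [← iteratedDeriv_succ] at e0 e1
        exact (e0.const_mul ζ.1).add (e1.const_mul ζ.2)
      have hcont : ContinuousAt (fun x : (ℝ × ℝ) × ℝ => |Gf x.1 ℓ x.2|) (ζ₀, s₀) := by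
        have e0 : ContinuousAt (fun x : (ℝ × ℝ) × ℝ => iteratedDeriv ℓ p₀ x.2) (ζ₀, s₀) :=
          ContinuousAt.comp_of_eq ((han ℓ).1 s₀ hs₀').continuousAt continuousAt_snd rfl
        have e1 : ContinuousAt (fun x : (ℝ × ℝ) × ℝ => iteratedDeriv ℓ p₁ x.2) (ζ₀, s₀) :=
          ContinuousAt.comp_of_eq ((han ℓ).2 s₀ hs₀').continuousAt continuousAt_snd rfl
        simp only [hGf]
        fun_prop
      set κ : ℝ := |Gf ζ₀ ℓ s₀| / 2 with hκ
      have hpos : 0 < |Gf ζ₀ ℓ s₀| := abs_pos.2 hne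
      have hκ0 : 0 < κ := by positivity
      have hev : ∀ᶠ x : (ℝ × ℝ) × ℝ in nhds (ζ₀, s₀), κ < |Gf x.1 ℓ x.2| :=
        hcont.eventually (lt_mem_nhds (by simp only [hκ]; linarith))
      have hev2 : ∀ᶠ x : (ℝ × ℝ) × ℝ in nhds (ζ₀, s₀), x.2 ∈ Ioo a b :=
        continuousAt_snd.eventually (isOpen_Ioo.mem_nhds hs₀')
      obtain ⟨r, hr, hball⟩ := Metric.eventually_nhds_iff_ball.1 (hev.and hev2)
      have hr2 : 0 < r / 2 := by positivity
      refine ⟨Metric.ball ζ₀ r ×ˢ Icc (s₀ - r / 2) (s₀ + r / 2), mem_nhdsWithin_of_mem_nhds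
        (prod_mem_nhds (Metric.ball_mem_nhds _ hr) (Icc_mem_nhds (by linarith) (by linarith))), ?_⟩
      have hmem : ∀ ζ ∈ Metric.ball ζ₀ r, ∀ s ∈ Icc (s₀ - r / 2) (s₀ + r / 2),
          κ < |Gf ζ ℓ s| ∧ s ∈ Ioo a b := by
        intro ζ hζ s hs
        refine hball (ζ, s) ?_
        rw [← ball_prod_same]
        refine ⟨hζ, ?_⟩
        rw [Metric.mem_ball, Real.dist_eq, abs_lt]
        constructor <;> linarith [hs.1, hs.2]
      obtain ⟨C, hC, hb⟩ : ∃ C : ℝ≥0∞, C ≠ ∞ ∧ ∀ ζ ∈ Metric.ball ζ₀ r,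
          ∫⁻ s in Icc (s₀ - r / 2) (s₀ + r / 2), (ENNReal.ofReal |Gf ζ 0 s|) ^ (-ρ) ≤ C := by
        rcases ℓ with _ | n
        · refine ⟨(ENNReal.ofReal κ) ^ (-ρ) * volume (Icc (s₀ - r / 2) (s₀ + r / 2)), ?_, ?_⟩
          · rw [ENNReal.ofReal_rpow_of_pos hκ0]
            exact ENNReal.mul_ne_top (by simp) (by simp)
          · intro ζ hζ
            rw [← setLIntegral_const]
            refine setLIntegral_mono measurable_const fun s hs => ?_
            rw [ENNReal.rpow_neg, ENNReal.rpow_neg]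
            gcongr
            exact (hmem ζ hζ s hs).1.le
        · obtain ⟨C, hC, h⟩ := lintegral_rpow_neg_le n ρ κ (s₀ - r / 2) (s₀ + r / 2) hρ
            (by exact_mod_cast hℓ) hκ0
          exact ⟨C, hC, fun ζ hζ => h (Gf ζ) (fun i s hs => hder ζ i s (hmem ζ hζ s hs).2)
            (fun s hs => (hmem ζ hζ s hs).1.le)⟩
      refine ⟨C, hC, fun ζ hζ => ?_⟩
      by_cases hz : ζ ∈ Metric.ball ζ₀ r
      · refine le_trans (lintegral_mono_set fun s hs => hs.2) ((le_of_eq ?_).trans (hb ζ hz))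
        simp [hGf]
      · have : {s | (ζ, s) ∈ Metric.ball ζ₀ r ×ˢ Icc (s₀ - r / 2) (s₀ + r / 2)} = ∅ := by
          ext s; simp only [mem_ofPred_eq, mem_prod, hz, false_and, mem_empty_iff_false]
        rw [this]; simp
  obtain ⟨C, hC, h⟩ := key
  refine ⟨C, hC, fun ζ hζ => ?_⟩
  refine le_trans (le_of_eq ?_) (h ζ hζ)
  congr 2
  ext s
  simp [hK, hζ]

lemma norm_integral_cexp_le_of_le_abs_deriv {f f' f'' : ℝ → ℝ} {x y κ : ℝ} (hxy : x ≤ y)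
    (hκ : 0 < κ) (hf : ∀ t ∈ Icc x y, HasDerivAt f (f' t) t)
    (hf' : ∀ t ∈ Icc x y, HasDerivAt f' (f'' t) t) (hc : ContinuousOn f'' (Icc x y))
    (h0 : ∀ t ∈ Icc x y, 0 ≤ f'' t) (hl : ∀ t ∈ Icc x y, κ ≤ |f' t|) :
    ‖∫ t in x..y, Complex.exp (Complex.I * f t)‖ ≤ 4 / κ := by
  have hne : ∀ t ∈ Icc x y, f' t ≠ 0 := fun t ht => abs_pos.1 (hκ.trans_le (hl t ht))
  have hinv : ∀ t ∈ Icc x y, |(f' t)⁻¹| ≤ 1 / κ := fun t ht => by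
    rw [abs_inv, one_div]; exact inv_anti₀ hκ (hl t ht)
  have hcf : ContinuousOn f (Icc x y) := fun t ht => (hf t ht).continuousAt.continuousWithinAt
  have hcf' : ContinuousOn f' (Icc x y) := fun t ht => (hf' t ht).continuousAt.continuousWithinAt
  have hcE : ContinuousOn (fun t => Complex.exp (Complex.I * f t)) (Icc x y) := by
    fun_prop
  have hcq : ContinuousOn (fun t => f'' t / f' t ^ 2) (Icc x y) :=
    hc.div (hcf'.pow 2) fun t ht => pow_ne_zero 2 (hne t ht)
  have hcG : ContinuousOn (fun t => Complex.exp (Complex.I * f t) * (-Complex.I) *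
      ((f'' t / f' t ^ 2 : ℝ) : ℂ)) (Icc x y) := by fun_prop
  have hu : uIcc x y = Icc x y := uIcc_of_le hxy
  have hiE : IntervalIntegrable (fun t => Complex.exp (Complex.I * f t)) volume x y :=
    (hu ▸ hcE).intervalIntegrable
  have hiq : IntervalIntegrable (fun t => f'' t / f' t ^ 2) volume x y :=
    (hu ▸ hcq).intervalIntegrable
  have hiG : IntervalIntegrable (fun t => Complex.exp (Complex.I * f t) * (-Complex.I) *
      ((f'' t / f' t ^ 2 : ℝ) : ℂ)) volume x y := (hu ▸ hcG).intervalIntegrable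
  have hder : ∀ t ∈ uIcc x y, HasDerivAt
      (fun t => Complex.exp (Complex.I * f t) * (-Complex.I) * (((f' t)⁻¹ : ℝ) : ℂ))
      (Complex.exp (Complex.I * f t) - Complex.exp (Complex.I * f t) * (-Complex.I) *
      ((f'' t / f' t ^ 2 : ℝ) : ℂ)) t := by
    intro t ht
    rw [hu] at ht
    have h1 : HasDerivAt (fun t => Complex.exp (Complex.I * f t))
        (Complex.exp (Complex.I * f t) * (Complex.I * (f' t : ℂ))) t :=
      ((hf t ht).ofReal_comp.const_mul Complex.I).cexp
    have h2 := ((hf' t ht).fun_inv (hne t ht)).ofReal_comp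
    refine ((h1.mul_const (-Complex.I)).fun_mul h2).congr_deriv ?_
    have := Complex.ofReal_ne_zero.2 (hne t ht)
    push_cast
    field_simp
    linear_combination (-(f' t : ℂ) ^ 2) * Complex.I_sq
  have hq : ∫ t in x..y, f'' t / f' t ^ 2 = -(f' y)⁻¹ - -(f' x)⁻¹ := by
    refine intervalIntegral.integral_eq_sub_of_hasDerivAt (f := fun t => -(f' t)⁻¹)
      (fun t ht => ?_) hiq
    rw [hu] at ht
    convert ((hf' t ht).fun_inv (hne t ht)).fun_neg using 1
    ring
  have hmain := intervalIntegral.integral_eq_sub_of_hasDerivAt hder (hiE.sub hiG)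
  rw [intervalIntegral.integral_sub hiE hiG, sub_eq_iff_eq_add] at hmain
  rw [hmain]
  have hb : ∀ t ∈ Icc x y, ‖Complex.exp (Complex.I * f t) * (-Complex.I) *
      (((f' t)⁻¹ : ℝ) : ℂ)‖ ≤ 1 / κ := fun t ht => by
    rw [norm_mul, norm_mul, mul_comm Complex.I, Complex.norm_exp_ofReal_mul_I]
    simpa using hinv t ht
  have hG : ‖∫ t in x..y, Complex.exp (Complex.I * f t) * (-Complex.I) *
      ((f'' t / f' t ^ 2 : ℝ) : ℂ)‖ ≤ 2 / κ := by
    calc _ ≤ ∫ t in x..y, ‖Complex.exp (Complex.I * f t) * (-Complex.I) *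
          ((f'' t / f' t ^ 2 : ℝ) : ℂ)‖ := intervalIntegral.norm_integral_le_integral_norm hxy
      _ = ∫ t in x..y, f'' t / f' t ^ 2 := by
        refine intervalIntegral.integral_congr fun t ht => ?_
        rw [hu] at ht
        rw [norm_mul, norm_mul, mul_comm Complex.I, Complex.norm_exp_ofReal_mul_I,
          Complex.norm_real, Real.norm_of_nonneg (div_nonneg (h0 t ht) (sq_nonneg _))]
        simp
      _ ≤ 2 / κ := by
        rw [hq]
        have h1 := abs_le.1 (hinv x (left_mem_Icc.2 hxy))
        have h2 := abs_le.1 (hinv y (right_mem_Icc.2 hxy))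
        have h3 : 2 / κ = 1 / κ + 1 / κ := by ring
        linarith
  have h4 : 4 / κ = 1 / κ + 1 / κ + 2 / κ := by ring
  rw [h4]
  exact (norm_add_le _ _).trans (add_le_add ((norm_sub_le _ _).trans
    (add_le_add (hb y (right_mem_Icc.2 hxy)) (hb x (left_mem_Icc.2 hxy)))) hG)

/-- Van der Corput's lemma for the second derivative. -/
lemma norm_integral_cexp_le_of_le_deriv2 {f f' f'' : ℝ → ℝ} {x y κ : ℝ} (hxy : x ≤ y)
    (hκ : 0 < κ) (hf : ∀ t ∈ Icc x y, HasDerivAt f (f' t) t)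
    (hf' : ∀ t ∈ Icc x y, HasDerivAt f' (f'' t) t) (hc : ContinuousOn f'' (Icc x y))
    (hl : ∀ t ∈ Icc x y, κ ≤ f'' t) :
    ‖∫ t in x..y, Complex.exp (Complex.I * f t)‖ ≤ 18 / √κ := by
  have hcf : ContinuousOn f (Icc x y) := fun t ht => (hf t ht).continuousAt.continuousWithinAt
  have hcf' : ContinuousOn (fun t => |f' t|) (Icc x y) :=
    fun t ht => (hf' t ht).continuousAt.abs.continuousWithinAt
  have hcE : ContinuousOn (fun t => Complex.exp (Complex.I * f t)) (Icc x y) := by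
    fun_prop
  obtain ⟨z, hz, hmin⟩ := isCompact_Icc.exists_isMinOn (nonempty_Icc.2 hxy) hcf'
  have hbig : ∀ t ∈ Icc x y, κ * |t - z| / 2 ≤ |f' t| := by
    intro t ht
    have h1 := mul_abs_sub_le_of_le_abs_deriv hf'
      (fun s hs => (hl s hs).trans (le_abs_self _)) hz ht
    have h2 := abs_sub (f' t) (f' z)
    have h3 : |f' z| ≤ |f' t| := hmin ht
    linarith
  set δ : ℝ := 1 / √κ with hδ
  have hs : 0 < √κ := Real.sqrt_pos.2 hκ
  have hδ0 : 0 < δ := by positivity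
  have hκδ : κ * δ / 2 = √κ / 2 := by
    rw [hδ]; nth_rw 1 [← Real.mul_self_sqrt hκ.le]; field_simp
  have hpiece : ∀ p q, x ≤ p → q ≤ y → p ≤ q → (∀ t ∈ Icc p q, δ ≤ |t - z|) →
      ‖∫ t in p..q, Complex.exp (Complex.I * f t)‖ ≤ 8 / √κ := by
    intro p q hp hq hpq hd
    have hsub : Icc p q ⊆ Icc x y := Icc_subset_Icc hp hq
    have h := norm_integral_cexp_le_of_le_abs_deriv hpq (by positivity : 0 < √κ / 2)
      (fun t ht => hf t (hsub ht)) (fun t ht => hf' t (hsub ht)) (hc.mono hsub)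
      (fun t ht => hκ.le.trans (hl t (hsub ht))) (fun t ht => by
        refine le_trans ?_ (hbig t (hsub ht))
        rw [← hκδ]
        have := mul_le_mul_of_nonneg_left (hd t ht) hκ.le
        linarith)
    refine h.trans (le_of_eq ?_)
    field_simp
    norm_num
  have hmid : ∀ p q, p ≤ q → q - p ≤ 2 * δ →
      ‖∫ t in p..q, Complex.exp (Complex.I * f t)‖ ≤ 2 / √κ := by
    intro p q hpq h
    refine (intervalIntegral.norm_integral_le_of_norm_le_const (C := 1) fun t _ => ?_).trans ?_
    · rw [mul_comm, Complex.norm_exp_ofReal_mul_I]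
    · rw [one_mul, abs_of_nonneg (by linarith)]
      refine h.trans (le_of_eq ?_)
      rw [hδ]; ring
  set p := max x (z - δ) with hp
  set q := min y (z + δ) with hq
  have hxp : x ≤ p := le_max_left _ _
  have hqy : q ≤ y := min_le_left _ _
  have hpz : p ≤ z := max_le hz.1 (by linarith)
  have hzq : z ≤ q := le_min hz.2 (by linarith)
  have hFint : ∀ u ∈ Icc x y, ∀ v ∈ Icc x y,
      IntervalIntegrable (fun t => Complex.exp (Complex.I * f t)) volume u v := by
    intro u hu v hv
    exact (hcE.mono (fun t ht => ⟨(le_min hu.1 hv.1).trans ht.1,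
      ht.2.trans (max_le hu.2 hv.2)⟩)).intervalIntegrable
  have hxm : x ∈ Icc x y := left_mem_Icc.2 hxy
  have hym : y ∈ Icc x y := right_mem_Icc.2 hxy
  have hpm : p ∈ Icc x y := ⟨hxp, hpz.trans hz.2⟩
  have hqm : q ∈ Icc x y := ⟨hz.1.trans hzq, hqy⟩
  rw [← intervalIntegral.integral_add_adjacent_intervals (hFint x hxm p hpm) (hFint p hpm y hym),
    ← intervalIntegral.integral_add_adjacent_intervals (hFint p hpm q hqm) (hFint q hqm y hym)]
  have e1 : ‖∫ t in x..p, Complex.exp (Complex.I * f t)‖ ≤ 8 / √κ := by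
    rcases le_total (z - δ) x with h | h
    · rw [hp, max_eq_left h]; simp; positivity
    · have hpe : p = z - δ := max_eq_right h
      refine hpiece x p le_rfl hpm.2 hxp fun t ht => ?_
      rw [abs_sub_comm]
      exact le_trans (by linarith [ht.2]) (le_abs_self _)
  have e3 : ‖∫ t in q..y, Complex.exp (Complex.I * f t)‖ ≤ 8 / √κ := by
    rcases le_total y (z + δ) with h | h
    · rw [hq, min_eq_left h]; simp; positivity
    · have hqe : q = z + δ := min_eq_right h
      refine hpiece q y hqm.1 le_rfl hqy fun t ht => ?_
      exact le_trans (by linarith [ht.1]) (le_abs_self _)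
  have e2 := hmid p q (hpz.trans hzq) (by
    have h1 : z - δ ≤ p := le_max_right _ _
    have h2 : q ≤ z + δ := min_le_right _ _
    linarith)
  have h18 : 18 / √κ = 8 / √κ + (2 / √κ + 8 / √κ) := by ring
  rw [h18]
  exact (norm_add_le _ _).trans (add_le_add e1 ((norm_add_le _ _).trans (add_le_add e2 e3)))

lemma norm_integral_cexp_neg (f : ℝ → ℝ) (x y : ℝ) :
    ‖∫ t in x..y, Complex.exp (Complex.I * ((-f t : ℝ) : ℂ))‖
      = ‖∫ t in x..y, Complex.exp (Complex.I * f t)‖ := by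
  rw [← Complex.norm_conj (∫ t in x..y, Complex.exp (Complex.I * f t)),
    ← intervalIntegral.intervalIntegral_conj]
  congr 2
  funext t
  rw [← Complex.exp_conj, map_mul, Complex.conj_I, Complex.conj_ofReal]
  push_cast
  ring_nf

lemma norm_integral_cexp_le_of_deriv2 {f f' f'' : ℝ → ℝ} {x y κ : ℝ} (hxy : x ≤ y)
    (hκ : 0 < κ) (hf : ∀ t ∈ Icc x y, HasDerivAt f (f' t) t)
    (hf' : ∀ t ∈ Icc x y, HasDerivAt f' (f'' t) t) (hc : ContinuousOn f'' (Icc x y))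
    (hl : (∀ t ∈ Icc x y, κ ≤ f'' t) ∨ ∀ t ∈ Icc x y, f'' t ≤ -κ) :
    ‖∫ t in x..y, Complex.exp (Complex.I * f t)‖ ≤ 18 / √κ := by
  rcases hl with hl | hl
  · exact norm_integral_cexp_le_of_le_deriv2 hxy hκ hf hf' hc hl
  · rw [← norm_integral_cexp_neg]
    exact norm_integral_cexp_le_of_le_deriv2 hxy hκ (fun t ht => (hf t ht).fun_neg)
      (fun t ht => (hf' t ht).fun_neg) hc.neg fun t ht => by linarith [hl t ht]

lemma norm_integral_cexp_le_of_deriv2_eq_mul {f f' g h h' : ℝ → ℝ} {x y κ δ : ℝ}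
    (hxy : x ≤ y) (hκ : 0 < κ) (hδ0 : 0 < δ) (hf : ∀ t ∈ Icc x y, HasDerivAt f (f' t) t)
    (hf' : ∀ t ∈ Icc x y, HasDerivAt f' (g t * h t) t) (hc : ContinuousOn g (Icc x y))
    (hg : ∀ t ∈ Icc x y, 1 / 4 ≤ g t)
    (hh : ∀ t ∈ Icc x y, HasDerivAt h (h' t) t) (hh' : ∀ t ∈ Icc x y, κ ≤ h' t) :
    ‖∫ t in x..y, Complex.exp (Complex.I * f t)‖ ≤ 36 / √(κ * δ / 8) + 2 * δ := by
  have hcf : ContinuousOn f (Icc x y) := fun t ht => (hf t ht).continuousAt.continuousWithinAt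
  have hch : ContinuousOn h (Icc x y) := fun t ht => (hh t ht).continuousAt.continuousWithinAt
  have hcE : ContinuousOn (fun t => Complex.exp (Complex.I * f t)) (Icc x y) := by
    fun_prop
  have hmono : MonotoneOn h (Icc x y) := by
    refine monotoneOn_of_deriv_nonneg (convex_Icc x y) hch
      (fun t ht => (hh t (interior_subset ht)).differentiableAt.differentiableWithinAt)
      fun t ht => ?_
    rw [(hh t (interior_subset ht)).deriv]
    exact hκ.le.trans (hh' t (interior_subset ht))
  obtain ⟨z, hz, hmin⟩ := isCompact_Icc.exists_isMinOn (nonempty_Icc.2 hxy) hch.abs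
  have hbig : ∀ t ∈ Icc x y, κ * |t - z| / 2 ≤ |h t| := by
    intro t ht
    have h1 := mul_abs_sub_le_of_le_abs_deriv hh
      (fun s hs => (hh' s hs).trans (le_abs_self _)) hz ht
    have h2 := abs_sub (h t) (h z)
    have h3 : |h z| ≤ |h t| := hmin ht
    linarith
  have hpiece : ∀ p q, x ≤ p → q ≤ y → p ≤ q → ((∀ t ∈ Icc p q, z + δ ≤ t) ∨
      ∀ t ∈ Icc p q, t ≤ z - δ) →
      ‖∫ t in p..q, Complex.exp (Complex.I * f t)‖ ≤ 18 / √(κ * δ / 8) := by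
    intro p q hp hq hpq hd
    have hsub : Icc p q ⊆ Icc x y := Icc_subset_Icc hp hq
    refine norm_integral_cexp_le_of_deriv2 hpq (by positivity)
      (fun t ht => hf t (hsub ht)) (fun t ht => hf' t (hsub ht))
      ((hc.mul hch).mono hsub) ?_
    refine hd.imp (fun hd t ht => ?_) (fun hd t ht => ?_)
    · have h1 := hbig t (hsub ht)
      have h2 := hmono hz (hsub ht) (by linarith [hd t ht])
      have h3 : |h z| ≤ |h t| := hmin (hsub ht)
      have h4 : κ * δ / 2 ≤ |h t| := by
        refine le_trans ?_ h1
        have := mul_le_mul_of_nonneg_left ((by linarith [hd t ht] : δ ≤ t - z).trans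
          (le_abs_self _)) hκ.le
        linarith
      have h5 : 0 ≤ h t := by
        by_contra! h0
        rw [abs_of_neg h0, abs_of_neg (h2.trans_lt h0)] at h3
        have : h z = h t := by linarith
        have h6 := mul_abs_sub_le_of_le_abs_deriv hh
          (fun s hs => (hh' s hs).trans (le_abs_self _)) hz (hsub ht)
        rw [this, sub_self, abs_zero] at h6
        have h7 : 0 < κ * |t - z| := mul_pos hκ (abs_pos.2 (by linarith [hd t ht]))
        linarith
      rw [abs_of_nonneg h5] at h4
      have := mul_le_mul (hg t (hsub ht)) h4 (by positivity) (by linarith [hg t (hsub ht)])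
      linarith
    · have h1 := hbig t (hsub ht)
      have h2 := hmono (hsub ht) hz (by linarith [hd t ht])
      have h3 : |h z| ≤ |h t| := hmin (hsub ht)
      have h4 : κ * δ / 2 ≤ |h t| := by
        refine le_trans ?_ h1
        rw [abs_sub_comm]
        have := mul_le_mul_of_nonneg_left ((by linarith [hd t ht] : δ ≤ z - t).trans
          (le_abs_self _)) hκ.le
        linarith
      have h5 : h t ≤ 0 := by
        by_contra! h0
        rw [abs_of_pos h0, abs_of_pos (h0.trans_le h2)] at h3
        have : h z = h t := by linarith
        have h6 := mul_abs_sub_le_of_le_abs_deriv hh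
          (fun s hs => (hh' s hs).trans (le_abs_self _)) hz (hsub ht)
        rw [this, sub_self, abs_zero] at h6
        have h7 : 0 < κ * |t - z| := mul_pos hκ (abs_pos.2 (by linarith [hd t ht]))
        linarith
      rw [abs_of_nonpos h5] at h4
      have := mul_le_mul (hg t (hsub ht)) h4 (by positivity) (by linarith [hg t (hsub ht)])
      linarith
  have hmid : ∀ p q, p ≤ q → q - p ≤ 2 * δ →
      ‖∫ t in p..q, Complex.exp (Complex.I * f t)‖ ≤ 2 * δ := by
    intro p q hpq h
    refine (intervalIntegral.norm_integral_le_of_norm_le_const (C := 1) fun t _ => ?_).trans ?_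
    · rw [mul_comm, Complex.norm_exp_ofReal_mul_I]
    · rwa [one_mul, abs_of_nonneg (by linarith)]
  set p := max x (z - δ) with hp
  set q := min y (z + δ) with hq
  have hxp : x ≤ p := le_max_left _ _
  have hqy : q ≤ y := min_le_left _ _
  have hpz : p ≤ z := max_le hz.1 (by linarith)
  have hzq : z ≤ q := le_min hz.2 (by linarith)
  have hFint : ∀ u ∈ Icc x y, ∀ v ∈ Icc x y,
      IntervalIntegrable (fun t => Complex.exp (Complex.I * f t)) volume u v := by
    intro u hu v hv
    exact (hcE.mono (fun t ht => ⟨(le_min hu.1 hv.1).trans ht.1,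
      ht.2.trans (max_le hu.2 hv.2)⟩)).intervalIntegrable
  have hxm : x ∈ Icc x y := left_mem_Icc.2 hxy
  have hym : y ∈ Icc x y := right_mem_Icc.2 hxy
  have hpm : p ∈ Icc x y := ⟨hxp, hpz.trans hz.2⟩
  have hqm : q ∈ Icc x y := ⟨hz.1.trans hzq, hqy⟩
  rw [← intervalIntegral.integral_add_adjacent_intervals (hFint x hxm p hpm) (hFint p hpm y hym),
    ← intervalIntegral.integral_add_adjacent_intervals (hFint p hpm q hqm) (hFint q hqm y hym)]
  have e1 : ‖∫ t in x..p, Complex.exp (Complex.I * f t)‖ ≤ 18 / √(κ * δ / 8) := by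
    rcases le_total (z - δ) x with h | h
    · rw [hp, max_eq_left h]; simp; positivity
    · have hpe : p = z - δ := max_eq_right h
      exact hpiece x p le_rfl hpm.2 hxp (Or.inr fun t ht => hpe ▸ ht.2)
  have e3 : ‖∫ t in q..y, Complex.exp (Complex.I * f t)‖ ≤ 18 / √(κ * δ / 8) := by
    rcases le_total y (z + δ) with h | h
    · rw [hq, min_eq_left h]; simp; positivity
    · have hqe : q = z + δ := min_eq_right h
      exact hpiece q y hqm.1 le_rfl hqy (Or.inl fun t ht => hqe ▸ ht.1)
  have e2 := hmid p q (hpz.trans hzq) (by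
    have h1 : z - δ ≤ p := le_max_right _ _
    have h2 : q ≤ z + δ := min_le_right _ _
    linarith)
  have h18 : 36 / √(κ * δ / 8) + 2 * δ
      = 18 / √(κ * δ / 8) + (2 * δ + 18 / √(κ * δ / 8)) := by ring
  rw [h18]
  exact (norm_add_le _ _).trans (add_le_add e1 ((norm_add_le _ _).trans (add_le_add e2 e3)))

/-- Insertion of a monotone amplitude in an oscillatory integral. -/
lemma norm_integral_mul_le_of_norm_integral_le {ψ ψ' : ℝ → ℝ} {e : ℝ → ℂ} {x y E : ℝ}
    (hxy : x ≤ y) (he : Continuous e) (hψ : ∀ t ∈ Icc x y, HasDerivAt ψ (ψ' t) t)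
    (hψc : ContinuousOn ψ' (Icc x y)) (hψ0 : 0 ≤ ψ x) (hψ' : ∀ t ∈ Icc x y, 0 ≤ ψ' t)
    (hE : ∀ t ∈ Icc x y, ‖∫ s in x..t, e s‖ ≤ E) :
    ‖∫ t in x..y, (ψ t : ℂ) * e t‖ ≤ 2 * ψ y * E := by
  have hu : uIcc x y = Icc x y := uIcc_of_le hxy
  have hi : IntervalIntegrable ψ' volume x y := (hu ▸ hψc).intervalIntegrable
  have hi' : IntervalIntegrable (fun t => (ψ' t : ℂ)) volume x y := by
    refine ContinuousOn.intervalIntegrable (hu ▸ ?_)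
    fun_prop
  rw [intervalIntegral.integral_mul_deriv_eq_deriv_mul (u := fun t => (ψ t : ℂ))
    (v := fun t => ∫ s in x..t, e s) (u' := fun t => (ψ' t : ℂ))
    (fun t ht => (hψ t (hu ▸ ht)).ofReal_comp)
    (fun t _ => intervalIntegral.integral_hasDerivAt_right (he.intervalIntegrable _ _)
      (he.stronglyMeasurableAtFilter _ _) he.continuousAt) hi' (he.intervalIntegrable _ _)]
  have hE0 : 0 ≤ E := (norm_nonneg _).trans (hE x (left_mem_Icc.2 hxy))
  have hFint := intervalIntegral.integral_eq_sub_of_hasDerivAt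
    (fun t ht => hψ t (hu ▸ ht)) hi
  have hnn : 0 ≤ ∫ t in x..y, ψ' t := intervalIntegral.integral_nonneg hxy hψ'
  have h1 : ‖∫ t in x..y, (ψ' t : ℂ) * ∫ s in x..t, e s‖ ≤ (ψ y - ψ x) * E := by
    rw [← hFint, ← intervalIntegral.integral_mul_const]
    refine intervalIntegral.norm_integral_le_of_norm_le hxy ?_ (hi.mul_const E)
    refine Filter.Eventually.of_forall fun t ht => ?_
    have ht' := Ioc_subset_Icc_self ht
    rw [norm_mul, Complex.norm_real, Real.norm_of_nonneg (hψ' t ht')]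
    exact mul_le_mul_of_nonneg_left (hE t ht') (hψ' t ht')
  simp only [intervalIntegral.integral_same, mul_zero, sub_zero]
  have h2 : ‖(ψ y : ℂ) * ∫ s in x..y, e s‖ ≤ ψ y * E := by
    rw [norm_mul, Complex.norm_real, Real.norm_of_nonneg (by linarith)]
    exact mul_le_mul_of_nonneg_left (hE y (right_mem_Icc.2 hxy)) (by linarith)
  have h3 : (ψ y - ψ x) * E ≤ ψ y * E := mul_le_mul_of_nonneg_right (by linarith) hE0
  refine (norm_sub_le _ _).trans ((add_le_add h2 (h1.trans h3)).trans (le_of_eq (by ring)))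

lemma hasDerivAt_phase {γ M a b B w : ℝ} (hw : 0 < w) :
    HasDerivAt (fun u : ℝ => a * u + b * u ^ γ + B * u ^ M)
      (a + b * (γ * w ^ (γ - 1)) + B * (M * w ^ (M - 1))) w := by
  have h1 := (hasDerivAt_id w).const_mul a
  have h2 := (hasDerivAt_rpow_const (p := γ) (Or.inl hw.ne')).const_mul b
  have h3 := (hasDerivAt_rpow_const (p := M) (Or.inl hw.ne')).const_mul B
  simpa using (h1.fun_add h2).fun_add h3

lemma hasDerivAt_phase_deriv {γ M a b B w : ℝ} (hw : 0 < w) :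
    HasDerivAt (fun w : ℝ => a + b * (γ * w ^ (γ - 1)) + B * (M * w ^ (M - 1)))
      (w ^ (γ - 2) * (b * γ * (γ - 1) + B * M * (M - 1) * w ^ (M - γ))) w := by
  have h2 := ((hasDerivAt_rpow_const (p := γ - 1) (Or.inl hw.ne')).const_mul γ).const_mul b
  have h3 := ((hasDerivAt_rpow_const (p := M - 1) (Or.inl hw.ne')).const_mul M).const_mul B
  refine ((h2.const_add a).fun_add h3).congr_deriv ?_
  have e1 : w ^ (M - 1 - 1) = w ^ (γ - 2) * w ^ (M - γ) := by
    rw [← rpow_add hw]; ring_nf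
  have e2 : γ - 1 - 1 = γ - 2 := by ring
  rw [e1, e2]
  ring

set_option maxHeartbeats 800000 in
/-- Van der Corput bound for the phases `a w + b w ^ γ + B w ^ M` on `[1, 2]`. -/
lemma exists_block_bound {γ M : ℝ} (hγ : 0 < γ) (hM : 3 * (1 + γ) ≤ M) :
    ∃ C : ℝ, 0 < C ∧ ∀ a b B : ℝ, 0 < B → ∀ lam : ℝ, lam = |b| * |γ * (γ - 1)| / (B * M * (M - 1)) →
      ‖∫ w in (1 : ℝ)..2, ((w ^ γ : ℝ) : ℂ) *
        Complex.exp (Complex.I * ((a * w + b * w ^ γ + B * w ^ M : ℝ) : ℂ))‖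
      ≤ C * (B ^ (-(1 / 2) : ℝ) + B ^ (-(1 / 3) : ℝ) * min lam lam⁻¹) := by
  set κ := M - γ with hκdef
  have hκ1 : 1 ≤ κ := by rw [hκdef]; linarith
  have hM1 : 2 ≤ M := by linarith
  have hMM : 1 ≤ M * (M - 1) := by nlinarith
  set R : ℝ := 2 ^ (κ + 1) with hR
  have hR0 : 0 < R := by positivity
  have hR4 : 4 ≤ R := by
    calc (4 : ℝ) = 2 ^ (2 : ℝ) := by norm_num
      _ ≤ R := rpow_le_rpow_of_exponent_le (by norm_num) (by linarith)
  refine ⟨2 * 2 ^ γ * (110 * R), by positivity, ?_⟩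
  intro a b B hB lam hlam
  set K := B * M * (M - 1) with hK
  have hKB : B ≤ K := by
    rw [hK, mul_assoc]
    nlinarith
  have hK0 : 0 < K := hB.trans_le hKB
  set β := b * γ * (γ - 1) with hβ
  have hlam' : lam = |β| / K := by rw [hlam, hβ, mul_assoc, abs_mul b]
  have hlam0 : 0 ≤ lam := by rw [hlam']; positivity
  set f : ℝ → ℝ := fun u => a * u + b * u ^ γ + B * u ^ M with hf
  set E : ℝ := 110 * R * (B ^ (-(1 / 2) : ℝ) + B ^ (-(1 / 3) : ℝ) * min lam lam⁻¹) with hE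
  have hcont : Continuous fun w => Complex.exp (Complex.I * (f w : ℂ)) := by
    have h1 : Continuous fun w : ℝ => w ^ γ := Real.continuous_rpow_const hγ.le
    have h2 : Continuous fun w : ℝ => w ^ M := Real.continuous_rpow_const (by linarith)
    fun_prop
  have hg : ∀ w ∈ Icc (1 : ℝ) 2, 1 / 4 ≤ w ^ (γ - 2) := by
    intro w hw
    calc (1 / 4 : ℝ) = 2 ^ (-2 : ℝ) := by norm_num [rpow_neg]
      _ ≤ w ^ (-2 : ℝ) := rpow_le_rpow_of_nonpos (by linarith [hw.1]) hw.2 (by norm_num)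
      _ ≤ _ := rpow_le_rpow_of_exponent_le hw.1 (by linarith)
  have hgc : ContinuousOn (fun w : ℝ => w ^ (γ - 2)) (Icc 1 2) := fun w hw =>
    (continuousAt_rpow_const w _ (Or.inl (by linarith [hw.1]))).continuousWithinAt
  have hhd : ∀ w ∈ Icc (1 : ℝ) 2, HasDerivAt (fun w : ℝ => β + K * w ^ κ)
      (K * (κ * w ^ (κ - 1))) w := fun w hw =>
    ((hasDerivAt_rpow_const (p := κ) (Or.inl (by linarith [hw.1]))).const_mul K).const_add β
  have hhc : ContinuousOn (fun w : ℝ => β + K * w ^ κ) (Icc 1 2) := fun w hw =>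
    (hhd w hw).continuousAt.continuousWithinAt
  have hhl : ∀ w ∈ Icc (1 : ℝ) 2, K ≤ K * (κ * w ^ (κ - 1)) := by
    intro w hw
    have := one_le_rpow hw.1 (by linarith : 0 ≤ κ - 1)
    have h2 : 1 ≤ κ * w ^ (κ - 1) := by nlinarith
    nlinarith
  have hsq : ∀ c : ℝ, 0 < c → √c = c ^ (1 / 2 : ℝ) := fun c _ => Real.sqrt_eq_rpow c
  have hpow2 : K ^ (-(1 / 2) : ℝ) ≤ B ^ (-(1 / 2) : ℝ) :=
    rpow_le_rpow_of_nonpos hB hKB (by norm_num)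
  have hpow3 : K ^ (-(1 / 3) : ℝ) ≤ B ^ (-(1 / 3) : ℝ) :=
    rpow_le_rpow_of_nonpos hB hKB (by norm_num)
  have hsqrt8 : √(8 : ℝ) ≤ 3 := by
    rw [Real.sqrt_le_left (by norm_num)]; norm_num
  have hmin0 : 0 ≤ min lam lam⁻¹ := le_min hlam0 (inv_nonneg.2 hlam0)
  have hB2 : 0 < B ^ (-(1 / 2) : ℝ) := by positivity
  have hB3 : 0 < B ^ (-(1 / 3) : ℝ) := by positivity
  have hEb : ∀ t ∈ Icc (1 : ℝ) 2, ‖∫ s in (1 : ℝ)..t, Complex.exp (Complex.I * (f s : ℂ))‖ ≤ E := by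
    intro t ht
    have hsub : Icc 1 t ⊆ Icc (1 : ℝ) 2 := Icc_subset_Icc le_rfl ht.2
    have hpos : ∀ w ∈ Icc 1 t, (0 : ℝ) < w := fun w hw => by linarith [hw.1]
    by_cases hnr : -(K / 2) ≤ β ∨ β ≤ -(R * K)
    · have h18 : ‖∫ s in (1 : ℝ)..t, Complex.exp (Complex.I * (f s : ℂ))‖ ≤ 18 / √(K / 8) := by
        refine norm_integral_cexp_le_of_deriv2 ht.1 (by positivity)
          (fun w hw => hasDerivAt_phase (hpos w hw))
          (fun w hw => hasDerivAt_phase_deriv (hpos w hw)) ((hgc.mul hhc).mono hsub) ?_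
        refine hnr.imp (fun h w hw => ?_) (fun h w hw => ?_)
        · have h1 : 1 ≤ w ^ κ := one_le_rpow hw.1 (by linarith)
          have h2 : K / 2 ≤ β + K * w ^ κ := by nlinarith
          have := mul_le_mul (hg w (hsub hw)) h2 (by positivity) (by linarith [hg w (hsub hw)])
          linarith
        · have h1 : w ^ κ ≤ R / 2 := by
            calc w ^ κ ≤ 2 ^ κ := rpow_le_rpow (hpos w hw).le (hsub hw).2 (by linarith)
              _ = R / 2 := by rw [hR, rpow_add (by norm_num)]; norm_num
          have h2 : K / 2 ≤ -(β + K * w ^ κ) := by nlinarith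
          have := mul_le_mul (hg w (hsub hw)) h2 (by positivity) (by linarith [hg w (hsub hw)])
          linarith
      have h19 : 18 / √(K / 8) ≤ 54 * K ^ (-(1 / 2) : ℝ) := by
        rw [Real.sqrt_div hK0.le, hsq K hK0, rpow_neg hK0.le, div_div_eq_mul_div, ← div_eq_mul_inv]
        gcongr
        linarith
      refine h18.trans (h19.trans ?_)
      rw [hE]
      have h20 : 0 ≤ R * (B ^ (-(1 / 3) : ℝ) * min lam lam⁻¹) := by positivity
      have h21 := mul_le_mul_of_nonneg_right hR4 hB2.le
      linarith
    · push Not at hnr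
      have hβ0 : β < 0 := by nlinarith
      have hl1 : 1 / 2 ≤ lam := by
        rw [hlam', abs_of_neg hβ0, le_div_iff₀ hK0]; linarith
      have hl2 : lam ≤ R := by
        rw [hlam', abs_of_neg hβ0, div_le_iff₀ hK0]; linarith
      have hmin : R⁻¹ ≤ min lam lam⁻¹ := by
        refine le_min (le_trans ?_ hl1) (inv_anti₀ (by linarith) hl2)
        rw [inv_le_comm₀ hR0 (by norm_num)]; norm_num; linarith
      set δ : ℝ := K ^ (-(1 / 3) : ℝ) with hδ
      have hδ0 : 0 < δ := by positivity
      have h36 := norm_integral_cexp_le_of_deriv2_eq_mul ht.1 hK0 hδ0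
        (fun w hw => hasDerivAt_phase (a := a) (b := b) (B := B) (γ := γ) (M := M) (hpos w hw))
        (fun w hw => hasDerivAt_phase_deriv (hpos w hw)) (hgc.mono hsub)
        (fun w hw => hg w (hsub hw)) (fun w hw => hhd w (hsub hw)) (fun w hw => hhl w (hsub hw))
      have e1 : √(K * δ) = δ⁻¹ := by
        have : K * δ = K ^ (2 / 3 : ℝ) := by
          rw [hδ]; nth_rw 1 [← rpow_one K]; rw [← rpow_add hK0]; norm_num
        rw [this, Real.sqrt_eq_rpow, ← rpow_mul hK0.le, hδ, ← rpow_neg hK0.le]; norm_num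
      have e2 : 36 / √(K * δ / 8) + 2 * δ ≤ 110 * δ := by
        rw [Real.sqrt_div (by positivity), e1, div_div_eq_mul_div, div_inv_eq_mul]
        have := mul_le_mul_of_nonneg_right hsqrt8 hδ0.le
        linarith
      refine h36.trans (e2.trans ?_)
      have e3 : R * min lam lam⁻¹ ≥ 1 := by
        have := mul_le_mul_of_nonneg_left hmin hR0.le
        rwa [mul_inv_cancel₀ hR0.ne'] at this
      rw [hE]
      have e4 : δ ≤ B ^ (-(1 / 3) : ℝ) * (R * min lam lam⁻¹) :=
        hpow3.trans (le_mul_of_one_le_right hB3.le e3)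
      have e5 : 0 ≤ R * B ^ (-(1 / 2) : ℝ) := by positivity
      linarith
  have := norm_integral_mul_le_of_norm_integral_le (ψ := fun w => w ^ γ)
    (ψ' := fun w => γ * w ^ (γ - 1)) (E := E) one_le_two hcont
    (fun w hw => hasDerivAt_rpow_const (Or.inl (by linarith [hw.1])))
    (continuousOn_const.mul fun w hw =>
      (continuousAt_rpow_const w _ (Or.inl (by linarith [hw.1]))).continuousWithinAt)
    (by simp) (fun w hw => mul_nonneg hγ.le (rpow_nonneg (by linarith [hw.1]) _)) hEb
  refine this.trans (le_of_eq ?_)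
  rw [hE]; ring

lemma exists_sum_min_zpow_le {r : ℝ} (hr : 1 < r) :
    ∃ C : ℝ, 0 < C ∧ ∀ X : ℝ, 0 ≤ X → ∀ S : Finset ℤ,
      ∑ l ∈ S, min (r ^ l * X) (r ^ l * X)⁻¹ ≤ C := by
  have hr0 : 0 < r := by linarith
  have hq : Summable fun l : ℤ => r * r⁻¹ ^ l.natAbs := by
    refine Summable.mul_left _ (Summable.of_nat_of_neg ?_ ?_) <;>
    · simpa using summable_geometric_of_lt_one (inv_nonneg.2 hr0.le) (inv_lt_one_of_one_lt₀ hr)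
  refine ⟨∑' l : ℤ, r * r⁻¹ ^ l.natAbs, hq.tsum_pos (fun _ => by positivity) 0 (by simpa), ?_⟩
  intro X hX S
  rcases hX.eq_or_lt with h | hX
  · subst h
    simpa using tsum_nonneg fun l : ℤ => (by positivity : 0 ≤ r * r⁻¹ ^ l.natAbs)
  obtain ⟨k, hk1, hk2⟩ := exists_mem_Ico_zpow hX hr
  calc ∑ l ∈ S, min (r ^ l * X) (r ^ l * X)⁻¹
      ≤ ∑ l ∈ S, r * r⁻¹ ^ (l + k).natAbs := by
        refine Finset.sum_le_sum fun l _ => ?_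
        have hl : 0 < r ^ l := zpow_pos hr0 l
        rcases le_total 0 (l + k) with h | h
        · refine (min_le_right _ _).trans ?_
          have h1 : r⁻¹ ^ (l + k).natAbs = (r ^ (l + k))⁻¹ := by
            rw [inv_pow, ← zpow_natCast, Int.natAbs_of_nonneg h]
          rw [h1, zpow_add₀ hr0.ne']
          have h2 : (r ^ l * X)⁻¹ ≤ (r ^ l * r ^ k)⁻¹ :=
            inv_anti₀ (by positivity) (mul_le_mul_of_nonneg_left hk1 hl.le)
          have h3 : 0 ≤ (r ^ l * r ^ k)⁻¹ := by positivity
          nlinarith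
        · refine (min_le_left _ _).trans ?_
          have h1 : r⁻¹ ^ (l + k).natAbs = r ^ (l + k) := by
            rw [inv_pow, ← zpow_natCast, Int.ofNat_natAbs_of_nonpos h, zpow_neg, inv_inv]
          rw [h1, zpow_add₀ hr0.ne']
          calc r ^ l * X ≤ r ^ l * r ^ (k + 1) := mul_le_mul_of_nonneg_left hk2.le hl.le
            _ = _ := by rw [zpow_add_one₀ hr0.ne']; ring
    _ = ∑ l ∈ S.map (addRightEmbedding k), r * r⁻¹ ^ l.natAbs := by simp
    _ ≤ _ := hq.sum_le_tsum _ fun _ _ => by positivity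

lemma exists_sum_range_min_pow_le {r : ℝ} (hr : 1 < r) :
    ∃ C : ℝ, 0 < C ∧ ∀ X : ℝ, 0 ≤ X → ∀ J : ℕ,
      ∑ j ∈ Finset.range J, min (r ^ j * X) (r ^ j * X)⁻¹ ≤ C := by
  obtain ⟨C, hC, h⟩ := exists_sum_min_zpow_le hr
  refine ⟨C, hC, fun X hX J => ?_⟩
  simpa using h X hX ((Finset.range J).map Nat.castEmbedding)

/-- Uniform decay of the oscillatory integrals with phases `a u + b u ^ γ + B u ^ M`. -/
lemma exists_norm_integral_phase_le_of_pos {γ M : ℝ} (hγ : 0 < γ) (hM : 3 * (1 + γ) ≤ M) :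
    ∃ C : ℝ, 0 < C ∧ ∀ a b B : ℝ, 0 < B →
      ‖∫ u in (0 : ℝ)..1, ((u ^ γ : ℝ) : ℂ) *
        Complex.exp (Complex.I * ((a * u + b * u ^ γ + B * u ^ M : ℝ) : ℂ))‖
      ≤ C * B ^ (-((1 + γ) / M)) := by
  obtain ⟨C₀, hC₀, hblock⟩ := exists_block_bound hγ hM
  have hM0 : 0 < M := by linarith
  set κ := M - γ with hκ
  obtain ⟨C₁, hC₁, hsum₁⟩ := exists_sum_range_min_pow_le
    (one_lt_rpow (by norm_num : (1 : ℝ) < 2) (by norm_num : (0 : ℝ) < 1 / 2))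
  obtain ⟨C₂, hC₂, hsum₂⟩ := exists_sum_range_min_pow_le
    (one_lt_rpow (by norm_num : (1 : ℝ) < 2) (by rw [hκ]; linarith : (0 : ℝ) < κ))
  refine ⟨1 + 2 ^ (1 + γ) + C₀ * (C₁ + C₂), by positivity, ?_⟩
  intro a b B hB
  set f : ℝ → ℝ := fun u => a * u + b * u ^ γ + B * u ^ M with hf
  set F : ℝ → ℂ := fun u => ((u ^ γ : ℝ) : ℂ) * Complex.exp (Complex.I * (f u : ℂ)) with hF
  have hcont : Continuous F := by
    have h1 : Continuous fun w : ℝ => w ^ γ := Real.continuous_rpow_const hγ.le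
    have h2 : Continuous fun w : ℝ => w ^ M := Real.continuous_rpow_const (by linarith)
    fun_prop
  have hFn : ∀ u, 0 ≤ u → ‖F u‖ = u ^ γ := by
    intro u hu
    rw [hF]
    simp only
    rw [norm_mul, mul_comm Complex.I, Complex.norm_exp_ofReal_mul_I, mul_one, Complex.norm_real,
      Real.norm_of_nonneg (rpow_nonneg hu _)]
  have htriv : ∀ x, 0 ≤ x → ‖∫ u in (0 : ℝ)..x, F u‖ ≤ x ^ (1 + γ) := by
    intro x hx
    refine (intervalIntegral.norm_integral_le_of_norm_le_const (C := x ^ γ) ?_).trans ?_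
    · intro u hu
      rw [uIoc_of_le hx] at hu
      rw [hFn u hu.1.le]
      exact rpow_le_rpow hu.1.le hu.2 hγ.le
    · rw [sub_zero, abs_of_nonneg hx]
      rcases hx.eq_or_lt with h | h
      · rw [← h]; simp [rpow_nonneg]
      · rw [rpow_add h, rpow_one, mul_comm]
  change ‖∫ u in (0 : ℝ)..1, F u‖ ≤ _
  set ρ := (1 + γ) / M with hρ
  have hρ0 : 0 < ρ := by positivity
  have hBρ : 0 < B ^ (-ρ) := by positivity
  rcases le_or_gt B 1 with hB1 | hB1
  · have h1 := htriv 1 zero_le_one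
    rw [one_rpow] at h1
    have h2 : 1 ≤ B ^ (-ρ) := one_le_rpow_of_pos_of_le_one_of_nonpos hB hB1 (by linarith)
    have h3 : 1 ≤ 1 + 2 ^ (1 + γ) + C₀ * (C₁ + C₂) := by
      have : 0 ≤ 2 ^ (1 + γ) + C₀ * (C₁ + C₂) := by positivity
      linarith
    nlinarith
  set W := B ^ (1 / M) with hW
  have hW1 : 1 ≤ W := one_le_rpow hB1.le (by positivity)
  have hW0 : 0 < W := by linarith
  have hWM : W ^ M = B := by
    rw [hW, ← rpow_mul hB.le, one_div_mul_cancel hM0.ne', rpow_one]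
  have hWρ : W ^ (-(1 + γ)) = B ^ (-ρ) := by
    rw [hW, ← rpow_mul hB.le, hρ]; congr 1; field_simp
  obtain ⟨J, hJ1, hJ2⟩ := exists_nat_pow_near hW1 (by norm_num : (1 : ℝ) < 2)
  set x : ℕ → ℝ := fun j => (2 ^ j)⁻¹ with hx
  have hx0 : ∀ j, 0 < x j := fun j => by rw [hx]; positivity
  have hsplit : ∫ u in (0 : ℝ)..1, F u
      = (∫ u in (0 : ℝ)..x J, F u) - ∑ j ∈ Finset.range J, ∫ u in x j..x (j + 1), F u := by
    rw [intervalIntegral.sum_integral_adjacent_intervals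
      (fun k _ => hcont.intervalIntegrable _ _)]
    have : x 0 = 1 := by simp [hx]
    rw [this, eq_sub_iff_add_eq]
    exact intervalIntegral.integral_add_adjacent_intervals (hcont.intervalIntegrable _ _)
      (hcont.intervalIntegrable _ _)
  have hfirst : ‖∫ u in (0 : ℝ)..x J, F u‖ ≤ 2 ^ (1 + γ) * B ^ (-ρ) := by
    refine (htriv _ (hx0 J).le).trans ?_
    have h1 : x J ≤ 2 * W⁻¹ := by
      rw [hx, ← div_eq_mul_inv, le_div_iff₀ hW0, inv_mul_le_iff₀ (by positivity)]
      rw [pow_succ] at hJ2; exact hJ2.le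
    calc x J ^ (1 + γ) ≤ (2 * W⁻¹) ^ (1 + γ) := rpow_le_rpow (hx0 J).le h1 (by linarith)
      _ = _ := by rw [mul_rpow (by norm_num) (by positivity),
        inv_rpow hW0.le, ← rpow_neg hW0.le, hWρ]
  set L := |b| * |γ * (γ - 1)| / (B * M * (M - 1)) with hL
  have hL0 : 0 ≤ L := by
    have : 0 ≤ M - 1 := by linarith
    positivity
  have hblk : ∀ j ∈ Finset.range J, ‖∫ u in x j..x (j + 1), F u‖ ≤ C₀ * B ^ (-ρ) *
      (min ((2 ^ (1 / 2 : ℝ)) ^ j * (W / 2) ^ (-(1 / 2) : ℝ))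
          ((2 ^ (1 / 2 : ℝ)) ^ j * (W / 2) ^ (-(1 / 2) : ℝ))⁻¹ +
        min ((2 ^ κ) ^ j * (2 ^ κ * L)) ((2 ^ κ) ^ j * (2 ^ κ * L))⁻¹) := by
    intro j hj
    set X := x (j + 1) with hX
    have hX0 : 0 < X := hx0 _
    have hX2 : x j = X * 2 := by
      simp only [hX, hx, pow_succ]; field_simp
    have hY1 : 1 ≤ W * X := by
      rw [hX, hx, ← div_eq_mul_inv, le_div_iff₀ (by positivity), one_mul]
      exact le_trans (pow_le_pow_right₀ (by norm_num) (Finset.mem_range.1 hj)) hJ1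
    set Y := W * X with hY
    have hY0 : 0 < Y := by linarith
    have hBX : B * X ^ M = Y ^ M := by rw [hY, mul_rpow hW0.le hX0.le, hWM]
    have hXg : X ^ (1 + γ) = B ^ (-ρ) * Y ^ (1 + γ) := by
      rw [hY, mul_rpow hW0.le hX0.le, ← hWρ, ← mul_assoc, ← rpow_add hW0]; simp
    have hFint : ∫ u in x j..X, F u = -(((X ^ (1 + γ) : ℝ) : ℂ) *
        ∫ w in (1 : ℝ)..2, ((w ^ γ : ℝ) : ℂ) * Complex.exp (Complex.I *
          (((a * X) * w + (b * X ^ γ) * w ^ γ + (B * X ^ M) * w ^ M : ℝ) : ℂ))) := by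
      rw [intervalIntegral.integral_symm, hX2]
      congr 1
      have h1 := intervalIntegral.smul_integral_comp_mul_left (a := 1) (b := 2) F X
      rw [mul_one] at h1
      rw [← h1, Complex.real_smul, rpow_add hX0, rpow_one, Complex.ofReal_mul, mul_assoc,
        ← intervalIntegral.integral_const_mul (((X ^ γ : ℝ) : ℂ))]
      congr 1
      refine intervalIntegral.integral_congr fun w hw => ?_
      rw [uIcc_of_le one_le_two] at hw
      have hw0 : (0 : ℝ) ≤ w := by linarith [hw.1]
      simp only [hF, hf]
      rw [mul_rpow hX0.le hw0, mul_rpow hX0.le hw0, Complex.ofReal_mul, mul_assoc]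
      congr 5
      ring
    have hlamj : (2 ^ κ) ^ j * (2 ^ κ * L)
        = |b * X ^ γ| * |γ * (γ - 1)| / (B * X ^ M * M * (M - 1)) := by
      have e1 : (2 ^ κ : ℝ) ^ j * 2 ^ κ = X ^ (-κ) := by
        rw [← pow_succ, hX, hx, rpow_neg (by positivity), inv_rpow (by positivity), inv_inv,
          ← rpow_natCast, ← rpow_natCast, ← rpow_mul (by norm_num), ← rpow_mul (by norm_num),
          mul_comm]
      have e2 : X ^ M = X ^ γ * X ^ κ := by rw [← rpow_add hX0, hκ]; ring_nf
      have : M - 1 ≠ 0 := by linarith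
      have h3 : X ^ κ ≠ 0 := (rpow_pos_of_pos hX0 _).ne'
      have h4 : X ^ γ ≠ 0 := (rpow_pos_of_pos hX0 _).ne'
      rw [← mul_assoc, e1, hL, abs_mul b (X ^ γ), abs_of_pos (rpow_pos_of_pos hX0 γ), e2,
        rpow_neg hX0.le]
      field_simp
    have hBXpos : 0 < B * X ^ M := by positivity
    have hb := hblock (a * X) (b * X ^ γ) (B * X ^ M) hBXpos _ hlamj
    rw [hFint, norm_neg, norm_mul, Complex.norm_real, Real.norm_of_nonneg (by positivity)]
    refine (mul_le_mul_of_nonneg_left hb (by positivity)).trans ?_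
    rw [hXg, hBX]
    have hmin0 : 0 ≤ min ((2 ^ κ) ^ j * (2 ^ κ * L)) ((2 ^ κ) ^ j * (2 ^ κ * L))⁻¹ :=
      le_min (by positivity) (by positivity)
    have h3 : Y ^ (1 + γ) * (Y ^ M) ^ (-(1 / 3) : ℝ) ≤ 1 := by
      rw [← rpow_mul hY0.le, ← rpow_add hY0]
      exact rpow_le_one_of_one_le_of_nonpos hY1 (by linarith)
    have hz : (2 ^ (1 / 2 : ℝ) : ℝ) ^ j * (W / 2) ^ (-(1 / 2) : ℝ) = Y ^ (-(1 / 2) : ℝ) := by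
      have e1 : Y = (W / 2) * (2 ^ j)⁻¹ := by
        simp only [hY, hX, hx, pow_succ]; field_simp
      rw [e1, mul_rpow (by positivity) (by positivity), ← rpow_natCast, ← rpow_natCast,
        ← rpow_neg (by norm_num), ← rpow_mul (by norm_num), ← rpow_mul (by norm_num)]
      ring_nf
    have h2 : Y ^ (1 + γ) * (Y ^ M) ^ (-(1 / 2) : ℝ) ≤ min (Y ^ (-(1 / 2) : ℝ))
        (Y ^ (-(1 / 2) : ℝ))⁻¹ := by
      rw [← rpow_mul hY0.le, ← rpow_add hY0, ← rpow_neg hY0.le]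
      exact le_min (rpow_le_rpow_of_exponent_le hY1 (by linarith))
        (rpow_le_rpow_of_exponent_le hY1 (by linarith))
    rw [hz]
    calc _ = C₀ * B ^ (-ρ) * (Y ^ (1 + γ) * (Y ^ M) ^ (-(1 / 2) : ℝ) +
          Y ^ (1 + γ) * (Y ^ M) ^ (-(1 / 3) : ℝ) *
          min ((2 ^ κ) ^ j * (2 ^ κ * L)) ((2 ^ κ) ^ j * (2 ^ κ * L))⁻¹) := by ring
      _ ≤ _ := by
        refine mul_le_mul_of_nonneg_left (add_le_add h2 ?_) (by positivity)
        exact mul_le_of_le_one_left hmin0 h3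
  have hsum : ‖∑ j ∈ Finset.range J, ∫ u in x j..x (j + 1), F u‖
      ≤ C₀ * B ^ (-ρ) * (C₁ + C₂) := by
    refine (norm_sum_le _ _).trans ((Finset.sum_le_sum hblk).trans ?_)
    rw [← Finset.mul_sum, Finset.sum_add_distrib]
    exact mul_le_mul_of_nonneg_left (add_le_add (hsum₁ _ (by positivity) J)
      (hsum₂ _ (by positivity) J)) (by positivity)
  rw [hsplit]
  refine (norm_sub_le _ _).trans ((add_le_add hfirst hsum).trans ?_)
  nlinarith

/-- Uniform decay of the oscillatory integrals with phases `a u + b u ^ γ + B u ^ M`. -/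
lemma exists_norm_integral_phase_le {γ M : ℝ} (hγ : 0 < γ) (hM : 3 * (1 + γ) ≤ M) :
    ∃ C : ℝ, 0 < C ∧ ∀ a b B : ℝ, B ≠ 0 →
      ‖∫ u in (0 : ℝ)..1, ((u ^ γ : ℝ) : ℂ) *
        Complex.exp (Complex.I * ((a * u + b * u ^ γ + B * u ^ M : ℝ) : ℂ))‖
      ≤ C * |B| ^ (-((1 + γ) / M)) := by
  obtain ⟨C, hC, h⟩ := exists_norm_integral_phase_le_of_pos hγ hM
  refine ⟨C, hC, fun a b B hB => ?_⟩
  rcases hB.lt_or_gt with hB | hB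
  · rw [abs_of_neg hB]
    refine le_trans (le_of_eq ?_) (h (-a) (-b) (-B) (by linarith))
    rw [← Complex.norm_conj, ← intervalIntegral.intervalIntegral_conj]
    congr 2
    funext t
    rw [map_mul, ← Complex.exp_conj, map_mul, Complex.conj_I, Complex.conj_ofReal,
      Complex.conj_ofReal]
    push_cast
    ring_nf
  · rw [abs_of_pos hB]; exact h a b B hB

lemma mem_Vab_iff {α₁ α₂ a b : ℝ} (hα₁ : 0 < α₁) {x : Fin 2 → ℝ} :
    x ∈ Vab α₁ α₂ a b ↔ 0 < x 0 ∧ a * x 0 ^ (α₂ / α₁) < x 1 ∧ x 1 < b * x 0 ^ (α₂ / α₁) := by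
  constructor
  · rintro ⟨s, t, has, hsb, ht, rfl⟩
    have e : (t ^ α₁) ^ (α₂ / α₁) = t ^ α₂ := by
      rw [← rpow_mul ht.le, mul_div_cancel₀ _ hα₁.ne']
    have h2 : 0 < t ^ α₂ := by positivity
    simp only [dil, Matrix.cons_val_zero, Matrix.cons_val_one, mul_one, e]
    exact ⟨by positivity, by nlinarith, by nlinarith⟩
  · rintro ⟨h0, h1, h2⟩
    have hp : 0 < x 0 ^ (α₂ / α₁) := by positivity
    refine ⟨x 1 / x 0 ^ (α₂ / α₁), x 0 ^ (1 / α₁), (lt_div_iff₀ hp).2 h1, (div_lt_iff₀ hp).2 h2,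
      by positivity, ?_⟩
    ext i
    fin_cases i
    · simp [dil, ← rpow_mul h0.le, inv_mul_cancel₀ hα₁.ne']
    · simp only [dil, Fin.mk_one, Matrix.cons_val_one,
      Matrix.cons_val_zero, Matrix.cons_val_fin_one]
      rw [← rpow_mul h0.le, one_div_mul_eq_div]
      field_simp

lemma mem_V1_iff {α₁ α₂ c d : ℝ} (hα₁ : 0 < α₁) {x : Fin 2 → ℝ} :
    x ∈ V1 α₁ α₂ c d ↔ x ∈ Vab α₁ α₂ c d ∧ x 0 < 1 := by
  constructor
  · rintro ⟨s, t, hcs, hsd, ht, ht1, rfl⟩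
    refine ⟨⟨s, t, hcs, hsd, ht, rfl⟩, ?_⟩
    simpa [dil] using rpow_lt_one ht.le ht1 hα₁
  · rintro ⟨⟨s, t, hcs, hsd, ht, rfl⟩, h⟩
    refine ⟨s, t, hcs, hsd, ht, ?_, rfl⟩
    by_contra! h1
    have := one_le_rpow h1 hα₁.le
    simp [dil] at h
    linarith

lemma isOpen_Vab {α₁ α₂ a b : ℝ} (hα₁ : 0 < α₁) (hα₂ : 0 < α₂) : IsOpen (Vab α₁ α₂ a b) := by
  have : Vab α₁ α₂ a b = {x | 0 < x 0 ∧ a * x 0 ^ (α₂ / α₁) < x 1 ∧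
      x 1 < b * x 0 ^ (α₂ / α₁)} := by
    ext x; exact mem_Vab_iff hα₁
  rw [this]
  have hc : Continuous fun x : Fin 2 → ℝ => x 0 ^ (α₂ / α₁) :=
    (continuous_apply 0).rpow_const fun _ => Or.inr (by positivity)
  exact (isOpen_lt continuous_const (continuous_apply 0)).and
    ((isOpen_lt (by fun_prop) (by fun_prop)).and (isOpen_lt (by fun_prop) (by fun_prop)))

lemma isOpen_V1 {α₁ α₂ c d : ℝ} (hα₁ : 0 < α₁) (hα₂ : 0 < α₂) : IsOpen (V1 α₁ α₂ c d) := by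
  have : V1 α₁ α₂ c d = Vab α₁ α₂ c d ∩ {x | x 0 < 1} := by
    ext x; exact mem_V1_iff hα₁
  rw [this]
  exact (isOpen_Vab hα₁ hα₂).inter (isOpen_lt (by fun_prop) (by fun_prop))

lemma Vab_mono {α₁ α₂ a b c d : ℝ} (hac : a ≤ c) (hdb : d ≤ b) :
    Vab α₁ α₂ c d ⊆ Vab α₁ α₂ a b := by
  rintro x ⟨s, t, h1, h2, h3, h4⟩
  exact ⟨s, t, by linarith, by linarith, h3, h4⟩

lemma V1_subset_Vab {α₁ α₂ c d : ℝ} : V1 α₁ α₂ c d ⊆ Vab α₁ α₂ c d := by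
  rintro x ⟨s, t, h1, h2, h3, _, h4⟩
  exact ⟨s, t, h1, h2, h3, h4⟩

lemma dil_one (α₁ α₂ : ℝ) (x : Fin 2 → ℝ) : dil α₁ α₂ 1 x = x := by
  ext i; fin_cases i <;> simp [dil]

lemma one_mem_Vab {α₁ α₂ a b s : ℝ} (has : a < s) (hsb : s < b) : ![1, s] ∈ Vab α₁ α₂ a b :=
  ⟨s, 1, has, hsb, one_pos, (dil_one _ _ _).symm⟩

lemma dil_mem_Vab {α₁ α₂ a b t : ℝ} (ht : 0 < t) {x : Fin 2 → ℝ} (hx : x ∈ Vab α₁ α₂ a b) :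
    dil α₁ α₂ t x ∈ Vab α₁ α₂ a b := by
  obtain ⟨s, r, h1, h2, hr, rfl⟩ := hx
  refine ⟨s, t * r, h1, h2, by positivity, ?_⟩
  ext i
  fin_cases i <;> simp [dil, mul_rpow ht.le hr.le, mul_assoc]

/-- Euler's identity for functions homogeneous under nonisotropic dilations. -/
lemma euler_identity {α₁ α₂ a b k : ℝ} {Φ : (Fin 2 → ℝ) → ℝ}
    (hhom : ∀ x ∈ Vab α₁ α₂ a b, ∀ t : ℝ, 0 < t → Φ (dil α₁ α₂ t x) = t ^ k * Φ x)
    {x : Fin 2 → ℝ} (hx : x ∈ Vab α₁ α₂ a b) (hd : DifferentiableAt ℝ Φ x) :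
    α₁ * x 0 * fderiv ℝ Φ x (Pi.single 0 1) + α₂ * x 1 * fderiv ℝ Φ x (Pi.single 1 1)
      = k * Φ x := by
  have hdil : HasDerivAt (fun t => dil α₁ α₂ t x) ![α₁ * x 0, α₂ * x 1] 1 := by
    rw [hasDerivAt_pi]
    intro i
    fin_cases i
    · simpa [dil] using (hasDerivAt_rpow_const (x := 1) (p := α₁)
      (Or.inl one_ne_zero)).mul_const (x 0)
    · simpa [dil] using (hasDerivAt_rpow_const (x := 1) (p := α₂)
      (Or.inl one_ne_zero)).mul_const (x 1)
  have h1 : HasDerivAt (fun t => Φ (dil α₁ α₂ t x)) (fderiv ℝ Φ x ![α₁ * x 0, α₂ * x 1]) 1 := by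
    have := hd.hasFDerivAt
    rw [← dil_one α₁ α₂ x] at this
    have h := this.comp_hasDerivAt (1 : ℝ) hdil
    rwa [dil_one] at h
  have h2 : HasDerivAt (fun t => Φ (dil α₁ α₂ t x)) (k * Φ x) 1 := by
    have h := (hasDerivAt_rpow_const (x := 1) (p := k) (Or.inl one_ne_zero)).mul_const (Φ x)
    simp only [one_rpow, mul_one] at h
    refine h.congr_of_eventuallyEq ?_
    filter_upwards [lt_mem_nhds one_pos] with t ht
    exact hhom x hx t ht
  rw [← h1.unique h2]
  have : ![α₁ * x 0, α₂ * x 1] = (α₁ * x 0) • Pi.single (0 : Fin 2) (1 : ℝ)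
      + (α₂ * x 1) • Pi.single (1 : Fin 2) (1 : ℝ) := by
    ext i; fin_cases i <;> simp
  rw [this, map_add, map_smul, map_smul, smul_eq_mul, smul_eq_mul]

lemma hasDerivAt_add_smul {E : Type*} [NormedAddCommGroup E] [NormedSpace ℝ E] {Φ : E → ℝ}
    {x v : E} (hd : DifferentiableAt ℝ Φ x) :
    HasDerivAt (fun r : ℝ => Φ (x + r • v)) (fderiv ℝ Φ x v) 0 := by
  have h1 : HasDerivAt (fun r : ℝ => x + r • v) v 0 := by
    simpa using ((hasDerivAt_id (0 : ℝ)).smul_const v).const_add x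
  have h2 : HasFDerivAt Φ (fderiv ℝ Φ x) (x + (0 : ℝ) • v) := by simpa using hd.hasFDerivAt
  exact h2.comp_hasDerivAt (0 : ℝ) h1

lemma homogeneous_fderiv {α₁ α₂ a b k : ℝ} (hα₁ : 0 < α₁) (hα₂ : 0 < α₂) {Φ : (Fin 2 → ℝ) → ℝ}
    (hd : ∀ x ∈ Vab α₁ α₂ a b, DifferentiableAt ℝ Φ x)
    (hhom : ∀ x ∈ Vab α₁ α₂ a b, ∀ t : ℝ, 0 < t → Φ (dil α₁ α₂ t x) = t ^ k * Φ x)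
    (j : Fin 2) (x : Fin 2 → ℝ) (hx : x ∈ Vab α₁ α₂ a b) (t : ℝ) (ht : 0 < t) :
    fderiv ℝ Φ (dil α₁ α₂ t x) (Pi.single j 1)
      = t ^ (k - ![α₁, α₂] j) * fderiv ℝ Φ x (Pi.single j 1) := by
  set κ := ![α₁, α₂] j with hκ
  have h1 := hasDerivAt_add_smul (v := t ^ κ • (Pi.single j 1 : Fin 2 → ℝ))
    (hd _ (dil_mem_Vab ht hx))
  have h2 := (hasDerivAt_add_smul (v := (Pi.single j 1 : Fin 2 → ℝ)) (hd x hx)).const_mul (t ^ k)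
  have h3 : (fun r : ℝ => Φ (dil α₁ α₂ t x + r • t ^ κ • (Pi.single j 1 : Fin 2 → ℝ)))
      =ᶠ[nhds 0] fun r => t ^ k * Φ (x + r • (Pi.single j 1 : Fin 2 → ℝ)) := by
    have hc : Filter.Tendsto (fun r : ℝ => x + r • (Pi.single j 1 : Fin 2 → ℝ))
      (nhds 0) (nhds x) := by
      have : Continuous fun r : ℝ => x + r • (Pi.single j 1 : Fin 2 → ℝ) := by fun_prop
      simpa using this.tendsto 0
    filter_upwards [hc.eventually ((isOpen_Vab hα₁ hα₂).mem_nhds hx)] with r hr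
    rw [← hhom _ hr t ht]
    congr 1
    ext i
    fin_cases i <;> fin_cases j <;> simp [dil, hκ] <;> ring
  have h4 := (h1.congr_of_eventuallyEq h3.symm).unique h2
  rw [map_smul, smul_eq_mul] at h4
  rw [rpow_sub ht, div_mul_eq_mul_div, eq_div_iff (by positivity), ← h4, mul_comm]

/-- The Hessian of a homogeneous function at `(1, s)`, in terms of `g s = Φ (1, s)`. -/
lemma hess_homogeneous {α₁ α₂ a b m : ℝ} (hα₁ : 0 < α₁) (hα₂ : 0 < α₂) {Φ : (Fin 2 → ℝ) → ℝ}
    (hΦ : AnalyticOnNhd ℝ Φ (Vab α₁ α₂ a b))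
    (hhom : ∀ x ∈ Vab α₁ α₂ a b, ∀ t : ℝ, 0 < t → Φ (dil α₁ α₂ t x) = t ^ m * Φ x)
    {g : ℝ → ℝ} (hg : ∀ s, g s = Φ ![1, s]) {s : ℝ} (has : a < s) (hsb : s < b) :
    Hess Φ ![1, s] 1 1 = deriv (deriv g) s ∧
    α₁ * Hess Φ ![1, s] 0 1 = (m - α₂) * deriv g s - α₂ * s * deriv (deriv g) s ∧
    α₁ * Hess Φ ![1, s] 1 0 = (m - α₂) * deriv g s - α₂ * s * deriv (deriv g) s ∧
    α₁ ^ 2 * Hess Φ ![1, s] 0 0 = (m - α₁) * (m * g s - α₂ * s * deriv g s)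
      - α₂ * s * ((m - α₂) * deriv g s - α₂ * s * deriv (deriv g) s) := by
  have hd : ∀ x ∈ Vab α₁ α₂ a b, DifferentiableAt ℝ Φ x := fun x hx => (hΦ x hx).differentiableAt
  have hdd : ∀ j, ∀ x ∈ Vab α₁ α₂ a b,
      DifferentiableAt ℝ (fun y => fderiv ℝ Φ y (Pi.single j 1)) x := fun j x hx =>
    ((hΦ x hx).fderiv.differentiableAt).clm_apply (differentiableAt_const _)
  have hline : ∀ {Ψ : (Fin 2 → ℝ) → ℝ}, (∀ x ∈ Vab α₁ α₂ a b, DifferentiableAt ℝ Ψ x) →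
      ∀ s, a < s → s < b → HasDerivAt (fun r => Ψ ![1, r])
        (fderiv ℝ Ψ ![1, s] (Pi.single 1 1)) s := by
    intro Ψ hΨ s h1 h2
    have hl : HasDerivAt (fun r : ℝ => (![1, r] : Fin 2 → ℝ)) (Pi.single 1 1) s := by
      rw [hasDerivAt_pi]
      intro i
      fin_cases i
      · simpa using hasDerivAt_const s (1 : ℝ)
      · exact hasDerivAt_id' s
    exact (hΨ _ (one_mem_Vab h1 h2)).hasFDerivAt.comp_hasDerivAt s hl
  have hgd : ∀ s, a < s → s < b → HasDerivAt g (fderiv ℝ Φ ![1, s] (Pi.single 1 1)) s := by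
    intro s h1 h2
    rw [show g = fun r => Φ ![1, r] from funext hg]
    exact hline hd s h1 h2
  have hnear : ∀ᶠ r in nhds s, a < r ∧ r < b := (lt_mem_nhds has).and (gt_mem_nhds hsb)
  have hg1 : deriv g =ᶠ[nhds s] fun r => fderiv ℝ Φ ![1, r] (Pi.single 1 1) := by
    filter_upwards [hnear] with r hr using (hgd r hr.1 hr.2).deriv
  have hg2 : HasDerivAt (deriv g) (Hess Φ ![1, s] 1 1) s :=
    (hline (hdd 1) s has hsb).congr_of_eventuallyEq hg1
  have e0 : ∀ r, a < r → r < b →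
      α₁ * fderiv ℝ Φ ![1, r] (Pi.single 0 1) = m * g r - α₂ * r * deriv g r := by
    intro r h1 h2
    have := euler_identity hhom (one_mem_Vab h1 h2) (hd _ (one_mem_Vab h1 h2))
    simp only [Matrix.cons_val_zero, Matrix.cons_val_one, mul_one] at this
    rw [(hgd r h1 h2).deriv, hg r]
    linarith
  have e1 := euler_identity (homogeneous_fderiv hα₁ hα₂ hd hhom 1) (one_mem_Vab has hsb)
    (hdd 1 _ (one_mem_Vab has hsb))
  have e2 := euler_identity (homogeneous_fderiv hα₁ hα₂ hd hhom 0) (one_mem_Vab has hsb)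
    (hdd 0 _ (one_mem_Vab has hsb))
  have e3 : HasDerivAt (fun r => α₁ * fderiv ℝ Φ ![1, r] (Pi.single 0 1))
      (α₁ * Hess Φ ![1, s] 1 0) s := (hline (hdd 0) s has hsb).const_mul α₁
  have e4 : HasDerivAt (fun r => α₁ * fderiv ℝ Φ ![1, r] (Pi.single 0 1))
      (m * deriv g s - (α₂ * deriv g s + α₂ * s * Hess Φ ![1, s] 1 1)) s := by
    have h1 := ((hasDerivAt_id s).const_mul α₂).fun_mul hg2
    have h2 := ((hgd s has hsb).const_mul m).fun_sub h1
    refine (h2.congr_of_eventuallyEq ?_).congr_deriv ?_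
    · filter_upwards [hnear] with r hr using e0 r hr.1 hr.2
    · rw [(hgd s has hsb).deriv]; simp
  have e5 := e3.unique e4
  have hF0 := e0 s has hsb
  have hF1 := (hgd s has hsb).deriv
  have hG2 := hg2.deriv
  simp only [Matrix.cons_val_zero, Matrix.cons_val_one, Matrix.cons_val_fin_one, mul_one] at e1 e2
  change α₁ * Hess Φ ![1, s] 0 1 + α₂ * s * Hess Φ ![1, s] 1 1 = _ at e1
  change α₁ * Hess Φ ![1, s] 0 0 + α₂ * s * Hess Φ ![1, s] 1 0 = _ at e2
  rw [hG2]
  rw [← hF1] at e1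
  refine ⟨rfl, by linarith, by linarith, ?_⟩
  have e6 : α₁ * (α₁ * Hess Φ ![1, s] 0 0 + α₂ * s * Hess Φ ![1, s] 1 0)
    = (m - α₁) * (α₁ * fderiv ℝ Φ ![1, s] (Pi.single 0 1)) := by rw [e2]; ring
  rw [hF0] at e6
  have e7 : α₁ * (α₂ * s * Hess Φ ![1, s] 1 0) = α₂ * s * (α₁ * Hess Φ ![1, s] 1 0) := by ring
  rw [mul_add, e7, e5] at e6
  linear_combination e6

lemma qform_homogeneous {α₁ α₂ a b m : ℝ} (hα₁ : 0 < α₁) (hα₂ : 0 < α₂)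
    {φ : (Fin 2 → ℝ) → Fin 2 → ℝ} (H1 : AnalyticOnNhd ℝ φ (Vab α₁ α₂ a b))
    (H2 : ∀ x ∈ Vab α₁ α₂ a b, ∀ t : ℝ, 0 < t → φ (dil α₁ α₂ t x) = t ^ m • φ x)
    {p : Fin 2 → ℝ → ℝ} (hp : ∀ i s, p i s = φ ![1, s] i) {s : ℝ} (has : a < s) (hsb : s < b)
    (ζ : Fin 2 → ℝ) {g g' g'' : ℝ} (hg : g = ζ 0 * p 0 s + ζ 1 * p 1 s)
    (hg' : g' = ζ 0 * deriv (p 0) s + ζ 1 * deriv (p 1) s)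
    (hg'' : g'' = ζ 0 * deriv (deriv (p 0)) s + ζ 1 * deriv (deriv (p 1)) s) :
    α₁ ^ 2 * Qform φ ![1, s] ζ = m * (m - α₁) * g * g'' + α₂ * (α₁ - α₂) * s * g' * g''
      - (m - α₂) ^ 2 * g' ^ 2 := by
  have hΦ : ∀ i, AnalyticOnNhd ℝ (fun x => φ x i) (Vab α₁ α₂ a b) := fun i x hx =>
    ((ContinuousLinearMap.proj i : (Fin 2 → ℝ) →L[ℝ] ℝ).analyticAt _).comp (H1 x hx)
  have hh : ∀ i, ∀ x ∈ Vab α₁ α₂ a b, ∀ t : ℝ, 0 < t →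
      φ (dil α₁ α₂ t x) i = t ^ m * φ x i := fun i x hx t ht => by rw [H2 x hx t ht]; rfl
  obtain ⟨a1, a2, a3, a4⟩ := hess_homogeneous hα₁ hα₂ (hΦ 0) (hh 0) (hp 0) has hsb
  obtain ⟨b1, b2, b3, b4⟩ := hess_homogeneous hα₁ hα₂ (hΦ 1) (hh 1) (hp 1) has hsb
  rw [Qform, Matrix.det_fin_two]
  simp only [Matrix.add_apply, Matrix.smul_apply, smul_eq_mul]
  rw [a1, b1]
  have e : α₁ ^ 2 * ((ζ 0 * Hess (fun y => φ y 0) ![1, s] 0 0 +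
    ζ 1 * Hess (fun y => φ y 1) ![1, s] 0 0) *
      (ζ 0 * deriv (deriv (p 0)) s + ζ 1 * deriv (deriv (p 1)) s) -
      (ζ 0 * Hess (fun y => φ y 0) ![1, s] 0 1 + ζ 1 * Hess (fun y => φ y 1) ![1, s] 0 1) *
      (ζ 0 * Hess (fun y => φ y 0) ![1, s] 1 0 + ζ 1 * Hess (fun y => φ y 1) ![1, s] 1 0))
      = (ζ 0 * (α₁ ^ 2 * Hess (fun y => φ y 0) ![1, s] 0 0)
          + ζ 1 * (α₁ ^ 2 * Hess (fun y => φ y 1) ![1, s] 0 0)) *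
        (ζ 0 * deriv (deriv (p 0)) s + ζ 1 * deriv (deriv (p 1)) s) -
        (ζ 0 * (α₁ * Hess (fun y => φ y 0) ![1, s] 0 1)
          + ζ 1 * (α₁ * Hess (fun y => φ y 1) ![1, s] 0 1)) *
        (ζ 0 * (α₁ * Hess (fun y => φ y 0) ![1, s] 1 0)
          + ζ 1 * (α₁ * Hess (fun y => φ y 1) ![1, s] 1 0)) := by ring
  rw [e, a2, a3, a4, b2, b3, b4, hg, hg', hg'']
  ring

/-- If a quadratic expression in an analytic function and its first two derivatives is bounded
below by a multiple of `|s - σ| ^ n` on one side of `σ`, then some derivative of low order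
does not vanish at `σ`. -/
lemma exists_iteratedDeriv_ne_zero {G : ℝ → ℝ} {σ : ℝ} (hG : AnalyticAt ℝ G σ) {n : ℕ}
    {D A₁ A₂ A₃ : ℝ} (hD : 0 < D) {l : Filter ℝ} [l.NeBot] (hl : l ≤ nhds σ)
    (hl' : ∀ᶠ s in l, s ≠ σ)
    (h : ∀ᶠ s in l, D * |s - σ| ^ n ≤ |A₁ * G s * deriv (deriv G) s
      + A₂ * s * deriv G s * deriv (deriv G) s - A₃ * deriv G s ^ 2|) :
    ∃ i ≤ (n + 1) / 2 + 1, iteratedDeriv i G σ ≠ 0 := by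
  by_contra! hz
  obtain ⟨k, hk⟩ : ∃ k, k = (n + 1) / 2 := ⟨_, rfl⟩
  rw [← hk] at hz
  have key : ∀ {F : ℝ → ℝ} (N : ℕ), AnalyticAt ℝ F σ → (∀ i < N, iteratedDeriv i F σ = 0) →
      ∃ g, ContinuousAt g σ ∧ ∀ᶠ z in nhds σ, F z = (z - σ) ^ N * g z := by
    intro F N hF hi
    obtain ⟨g, hg, hg'⟩ := (natCast_le_analyticOrderAt hF).1
      ((natCast_le_analyticOrderAt_iff_iteratedDeriv_eq_zero hF).2 hi)
    exact ⟨g, hg.continuousAt, hg'⟩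
  obtain ⟨g₀, hg₀, e₀⟩ := key (k + 2) hG fun i hi => hz i (by omega)
  obtain ⟨g₁, hg₁, e₁⟩ := key (k + 1) hG.deriv fun i hi => by
    rw [← iteratedDeriv_succ']; exact hz (i + 1) (by omega)
  obtain ⟨g₂, hg₂, e₂⟩ := key k hG.deriv.deriv fun i hi => by
    rw [← iteratedDeriv_succ', ← iteratedDeriv_succ']; exact hz (i + 2) (by omega)
  obtain ⟨r, hr⟩ : ∃ r, 2 * k = n + r := ⟨2 * k - n, by omega⟩
  set w : ℝ → ℝ := fun s => (s - σ) * ((s - σ) ^ r * (A₁ * (s - σ) * g₀ s * g₂ s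
      + A₂ * s * g₁ s * g₂ s - A₃ * (s - σ) * g₁ s ^ 2)) with hw
  have hwc : ContinuousAt w σ := by fun_prop
  have hw0 : w σ = 0 := by simp [hw]
  have hlim : Filter.Tendsto (fun s => |w s|) l (nhds 0) := by
    have := hwc.abs.tendsto
    rw [hw0, abs_zero] at this
    exact this.mono_left hl
  have hev : ∀ᶠ s in l, D ≤ |w s| := by
    filter_upwards [hl', h, hl e₀, hl e₁, hl e₂] with s hs h1 h2 h3 h4
    rw [h2, h3, h4] at h1
    have : A₁ * ((s - σ) ^ (k + 2) * g₀ s) * ((s - σ) ^ k * g₂ s)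
        + A₂ * s * ((s - σ) ^ (k + 1) * g₁ s) * ((s - σ) ^ k * g₂ s)
        - A₃ * ((s - σ) ^ (k + 1) * g₁ s) ^ 2 = (s - σ) ^ n * w s := by
      have e : (s - σ) ^ k * (s - σ) ^ k = (s - σ) ^ n * (s - σ) ^ r := by
        rw [← pow_add, ← pow_add, ← hr, two_mul]
      simp only [hw]
      linear_combination (s - σ) * (A₁ * (s - σ) * g₀ s * g₂ s
      + A₂ * s * g₁ s * g₂ s - A₃ * (s - σ) * g₁ s ^ 2) * e
    rw [this, abs_mul, abs_pow, mul_comm] at h1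
    have hp : 0 < |s - σ| ^ n := pow_pos (abs_pos.2 (sub_ne_zero.2 hs)) _
    nlinarith
  exact absurd (le_of_tendsto_of_tendsto tendsto_const_nhds hlim hev) (by simpa using hD)

lemma one_mem_closure_Vab {α₁ α₂ c d s : ℝ} (hcd : c < d) (hs : s ∈ Icc c d) :
    ![1, s] ∈ closure (Vab α₁ α₂ c d) := by
  rw [← closure_Ioo hcd.ne] at hs
  refine map_mem_closure (f := fun s : ℝ => (![1, s] : Fin 2 → ℝ)) ?_ hs
    fun x hx => one_mem_Vab hx.1 hx.2
  refine continuous_pi fun i => ?_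
  fin_cases i
  · exact continuous_const
  · exact continuous_id

lemma analyticOnNhd_line {α₁ α₂ a b : ℝ} {φ : (Fin 2 → ℝ) → Fin 2 → ℝ}
    (H1 : AnalyticOnNhd ℝ φ (Vab α₁ α₂ a b)) (i : Fin 2) :
    AnalyticOnNhd ℝ (fun s => φ ![1, s] i) (Ioo a b) := by
  intro s hs
  have h1 : AnalyticAt ℝ (fun s : ℝ => (![1, s] : Fin 2 → ℝ)) s := by
    refine analyticAt_pi_iff.2 fun i => ?_
    fin_cases i
    · exact analyticAt_const
    · exact analyticAt_id
  have h2 : AnalyticAt ℝ (fun s => φ ![1, s]) s :=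
    AnalyticAt.comp (f := fun s : ℝ => (![1, s] : Fin 2 → ℝ)) (H1 _ (one_mem_Vab hs.1 hs.2)) h1
  exact analyticAt_pi_iff.1 h2 i

lemma order_condition {α₁ α₂ m a b c d σ : ℝ} {φ : (Fin 2 → ℝ) → Fin 2 → ℝ}
    (hα₁ : 0 < α₁) (hα₂ : 0 < α₂) (hm : 3 * (α₁ + α₂) ≤ m)
    (H1 : AnalyticOnNhd ℝ φ (Vab α₁ α₂ a b))
    (H2 : ∀ x ∈ Vab α₁ α₂ a b, ∀ t : ℝ, 0 < t → φ (dil α₁ α₂ t x) = t ^ m • φ x)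
    (hac : a < c) (hcd : c < d) (hdb : d < b) (hσ : σ ∈ Icc c d)
    (H3 : {x | x ∈ closure (Vab α₁ α₂ c d) ∧ x ≠ 0 ∧ ¬ Elliptic φ x}
        = {x | ∃ t : ℝ, 0 < t ∧ x = dil α₁ α₂ t ![1, σ]})
    {n₁ n₂ : ℕ} (hn : ((max n₁ n₂ : ℕ) : ℝ) < 2 * m / (α₁ + α₂) - 3)
    {D δ : ℝ} (hD : 0 < D) (hδ : 0 < δ)
    (H4a : σ ∈ Ioc c d → ∀ s ∈ Ioo (σ - δ) σ, ∀ t : ℝ, 0 < t →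
      ∀ ζ : Fin 2 → ℝ, onS1 ζ →
        D * t ^ (2 * (m - α₁ - α₂)) * |s - σ| ^ n₁ ≤ |Qform φ (dil α₁ α₂ t ![1, s]) ζ|)
    (H4b : σ ∈ Ico c d → ∀ s ∈ Ioo σ (σ + δ), ∀ t : ℝ, 0 < t →
      ∀ ζ : Fin 2 → ℝ, onS1 ζ →
        D * t ^ (2 * (m - α₁ - α₂)) * |s - σ| ^ n₂ ≤ |Qform φ (dil α₁ α₂ t ![1, s]) ζ|)
    (ζ : ℝ × ℝ) (hζ : ζ.1 ^ 2 + ζ.2 ^ 2 = 1) (s : ℝ) (hs : s ∈ Icc c d) :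
    ∃ ℓ : ℕ, (α₁ + α₂) / m * ℓ < 1 ∧ ζ.1 * iteratedDeriv ℓ (fun s => φ ![1, s] 0) s
      + ζ.2 * iteratedDeriv ℓ (fun s => φ ![1, s] 1) s ≠ 0 := by
  have hm0 : 0 < m := by linarith
  set p : Fin 2 → ℝ → ℝ := fun i s => φ ![1, s] i with hp
  have hp' : ∀ i, AnalyticOnNhd ℝ (p i) (Ioo a b) := analyticOnNhd_line H1
  have hζ' : onS1 ![ζ.1, ζ.2] := by simpa [onS1] using hζ
  have hab : ∀ r ∈ Icc c d, r ∈ Ioo a b := fun r hr => ⟨by linarith [hr.1], by linarith [hr.2]⟩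
  rcases eq_or_ne s σ with rfl | hne
  · -- the degenerate direction
    set G : ℝ → ℝ := fun r => ζ.1 * p 0 r + ζ.2 * p 1 r with hGdef
    have hGa : AnalyticOnNhd ℝ G (Ioo a b) := fun r hr =>
      (analyticAt_const.mul (hp' 0 r hr)).add (analyticAt_const.mul (hp' 1 r hr))
    have hG1 : ∀ r ∈ Ioo a b, deriv G r = ζ.1 * deriv (p 0) r + ζ.2 * deriv (p 1) r := fun r hr =>
      (((hp' 0 r hr).differentiableAt.hasDerivAt.const_mul ζ.1).fun_add
        ((hp' 1 r hr).differentiableAt.hasDerivAt.const_mul ζ.2)).deriv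
    have hG2 : ∀ r ∈ Ioo a b,
        deriv (deriv G) r = ζ.1 * deriv (deriv (p 0)) r + ζ.2 * deriv (deriv (p 1)) r := by
      intro r hr
      rw [Filter.EventuallyEq.deriv_eq (f := fun r => ζ.1 * deriv (p 0) r + ζ.2 * deriv (p 1) r)
        (by filter_upwards [isOpen_Ioo.mem_nhds hr] with z hz using hG1 z hz)]
      exact (((hp' 0 r hr).deriv.differentiableAt.hasDerivAt.const_mul ζ.1).fun_add
        ((hp' 1 r hr).deriv.differentiableAt.hasDerivAt.const_mul ζ.2)).deriv
    have hGn : ∀ ℓ, iteratedDeriv ℓ G s = ζ.1 * iteratedDeriv ℓ (p 0) s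
        + ζ.2 * iteratedDeriv ℓ (p 1) s := by
      intro ℓ
      have h0 : ContDiffAt ℝ ℓ (p 0) s := ((hp' 0 s (hab s hσ)).contDiffAt)
      have h1 : ContDiffAt ℝ ℓ (p 1) s := ((hp' 1 s (hab s hσ)).contDiffAt)
      rw [hGdef, iteratedDeriv_fun_add (contDiffAt_const.mul h0) (contDiffAt_const.mul h1),
        iteratedDeriv_const_mul_field, iteratedDeriv_const_mul_field]
    have hQ : ∀ r ∈ Ioo a b, α₁ ^ 2 * |Qform φ ![1, r] ![ζ.1, ζ.2]| =
        |m * (m - α₁) * G r * deriv (deriv G) r + α₂ * (α₁ - α₂) * r * deriv G r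
          * deriv (deriv G) r - (m - α₂) ^ 2 * deriv G r ^ 2| := by
      intro r hr
      rw [← qform_homogeneous hα₁ hα₂ H1 H2 (p := p) (fun _ _ => rfl) hr.1 hr.2 ![ζ.1, ζ.2]
        (g := G r) (g' := deriv G r) (g'' := deriv (deriv G) r) rfl (hG1 r hr) (hG2 r hr),
        abs_mul, abs_of_nonneg (sq_nonneg α₁)]
    have hfin : ∀ n : ℕ, n ≤ max n₁ n₂ → (∃ i ≤ (n + 1) / 2 + 1, iteratedDeriv i G s ≠ 0) →
        ∃ ℓ : ℕ, (α₁ + α₂) / m * ℓ < 1 ∧ ζ.1 * iteratedDeriv ℓ (p 0) s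
          + ζ.2 * iteratedDeriv ℓ (p 1) s ≠ 0 := by
      rintro n hnn ⟨i, hi, hi'⟩
      refine ⟨i, ?_, by rwa [← hGn]⟩
      have h1 : (i : ℝ) ≤ (n + 3) / 2 := by
        have : 2 * i ≤ n + 3 := by omega
        have : (2 * i : ℝ) ≤ n + 3 := by exact_mod_cast this
        linarith
      have h2 : (n : ℝ) ≤ (max n₁ n₂ : ℕ) := by exact_mod_cast hnn
      have h3 : (i : ℝ) < m / (α₁ + α₂) := by
        have : 2 * m / (α₁ + α₂) = 2 * (m / (α₁ + α₂)) := by ring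
        linarith
      rw [lt_div_iff₀ (by positivity)] at h3
      rw [div_mul_eq_mul_div, div_lt_one hm0]
      linarith
    have hmemab : ∀ᶠ r in nhds s, r ∈ Ioo a b := isOpen_Ioo.mem_nhds (hab s hσ)
    rcases eq_or_lt_of_le hσ.1 with hcs | hcs
    · have hsd : s ∈ Ico c d := ⟨hσ.1, by linarith⟩
      refine hfin n₂ (le_max_right _ _) (exists_iteratedDeriv_ne_zero (hGa s (hab s hσ))
        (D := α₁ ^ 2 * D) (by positivity) (l := nhdsWithin s (Ioi s)) nhdsWithin_le_nhds
        (by filter_upwards [self_mem_nhdsWithin] with r hr using ne_of_gt hr)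
        (A₁ := m * (m - α₁)) (A₂ := α₂ * (α₁ - α₂)) (A₃ := (m - α₂) ^ 2) ?_)
      filter_upwards [nhdsWithin_le_nhds hmemab, Ioo_mem_nhdsGT (show s < s + δ by linarith)]
        with r hr hr'
      rw [← hQ r hr]
      have := H4b hsd r hr' 1 one_pos _ hζ'
      rw [dil_one, one_rpow, mul_one] at this
      rw [mul_assoc]
      gcongr
    · have hsd : s ∈ Ioc c d := ⟨hcs, hσ.2⟩
      refine hfin n₁ (le_max_left _ _) (exists_iteratedDeriv_ne_zero (hGa s (hab s hσ))
        (D := α₁ ^ 2 * D) (by positivity) (l := nhdsWithin s (Iio s)) nhdsWithin_le_nhds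
        (by filter_upwards [self_mem_nhdsWithin] with r hr using ne_of_lt hr)
        (A₁ := m * (m - α₁)) (A₂ := α₂ * (α₁ - α₂)) (A₃ := (m - α₂) ^ 2) ?_)
      filter_upwards [nhdsWithin_le_nhds hmemab, Ioo_mem_nhdsLT (show s - δ < s by linarith)]
        with r hr hr'
      rw [← hQ r hr]
      have := H4a hsd r hr' 1 one_pos _ hζ'
      rw [dil_one, one_rpow, mul_one] at this
      rw [mul_assoc]
      gcongr
  · have hell : Elliptic φ ![1, s] := by
      by_contra hne'
      have : (![1, s] : Fin 2 → ℝ) ∈ {x | x ∈ closure (Vab α₁ α₂ c d) ∧ x ≠ 0 ∧ ¬ Elliptic φ x} :=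
        ⟨one_mem_closure_Vab hcd hs, fun h => by simpa using congrFun h 0, hne'⟩
      rw [H3] at this
      obtain ⟨t, ht, hte⟩ := this
      have e0 := congrFun hte 0
      have e1 := congrFun hte 1
      simp only [dil, Matrix.cons_val_zero, Matrix.cons_val_one, mul_one,
        Matrix.cons_val_fin_one] at e0 e1
      have ht1 : t = 1 := by
        have := congrArg (fun z => z ^ α₁⁻¹) e0
        simpa [rpow_rpow_inv ht.le hα₁.ne'] using this.symm
      rw [ht1, one_rpow, one_mul] at e1
      exact hne e1
    obtain ⟨ε, hε, hell⟩ := hell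
    have h1 := hell _ hζ'
    by_contra! hcon
    have hl : (α₁ + α₂) / m * (1 : ℕ) < 1 := by
      rw [Nat.cast_one, mul_one, div_lt_one hm0]; linarith
    have z0 := hcon 0 (by simp)
    have z1 := hcon 1 hl
    simp only [iteratedDeriv_zero, iteratedDeriv_one] at z0 z1
    have hQ := qform_homogeneous hα₁ hα₂ H1 H2 (p := p) (fun _ _ => rfl) (hab s hs).1 (hab s hs).2
      ![ζ.1, ζ.2] (g := 0) (g' := 0) z0.symm z1.symm rfl
    have : Qform φ ![1, s] ![ζ.1, ζ.2] = 0 := by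
      have h2 : α₁ ^ 2 ≠ 0 := by positivity
      exact (mul_eq_zero.1 (by rw [hQ]; ring)).resolve_left h2
    rw [this, abs_zero] at h1
    linarith

lemma mem_V1_iff' {α₁ α₂ c d : ℝ} (hα₁ : 0 < α₁) {x : Fin 2 → ℝ} :
    x ∈ V1 α₁ α₂ c d ↔ x 0 ∈ Ioo (0 : ℝ) 1 ∧
      x 1 ∈ Ioo (c * x 0 ^ (α₂ / α₁)) (d * x 0 ^ (α₂ / α₁)) := by
  rw [mem_V1_iff hα₁, mem_Vab_iff hα₁]
  simp only [mem_Ioo]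
  tauto

lemma volume_V1_lt_top {α₁ α₂ c d : ℝ} (hα₁ : 0 < α₁) (hα₂ : 0 < α₂) :
    volume (V1 α₁ α₂ c d) < ∞ := by
  refine lt_of_le_of_lt (measure_mono (t := Icc (![0, -|c|] : Fin 2 → ℝ) ![1, |d|]) ?_)
    isCompact_Icc.measure_lt_top
  intro x hx
  obtain ⟨⟨h0, h1⟩, h2, h3⟩ := (mem_V1_iff' hα₁).1 hx
  have hp : 0 < x 0 ^ (α₂ / α₁) := by positivity
  have hp1 : x 0 ^ (α₂ / α₁) ≤ 1 := rpow_le_one h0.le h1.le (by positivity)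
  have := neg_abs_le c
  have := le_abs_self d
  have := abs_nonneg c
  have := abs_nonneg d
  rw [mem_Icc, Pi.le_def, Pi.le_def]
  simp only [Fin.forall_fin_two, Matrix.cons_val_zero, Matrix.cons_val_one,
    Matrix.cons_val_fin_one]
  exact ⟨⟨h0.le, by nlinarith⟩, h1.le, by nlinarith⟩

lemma integral_V1_eq {α₁ α₂ c d : ℝ} (hα₁ : 0 < α₁) (hα₂ : 0 < α₂) (hcd : c < d)
    {F : (Fin 2 → ℝ) → ℂ} (hF : ContinuousOn F (V1 α₁ α₂ c d)) {K : ℝ}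
    (hK : ∀ x ∈ V1 α₁ α₂ c d, ‖F x‖ ≤ K) :
    ∫ x in V1 α₁ α₂ c d, F x = ∫ s in Ioo c d, ∫ u in Ioo (0 : ℝ) 1,
      ((u ^ (α₂ / α₁) : ℝ) : ℂ) * F ![u, u ^ (α₂ / α₁) * s] := by
  classical
  set γ := α₂ / α₁ with hγ
  have hγ0 : 0 < γ := by positivity
  have hms : MeasurableSet (V1 α₁ α₂ c d) := (isOpen_V1 hα₁ hα₂).measurableSet
  have hFint : IntegrableOn F (V1 α₁ α₂ c d) :=
    IntegrableOn.of_bound (volume_V1_lt_top hα₁ hα₂) (hF.aestronglyMeasurable hms) K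
      (by filter_upwards [ae_restrict_mem hms] with x hx using hK x hx)
  have hmp := (volume_preserving_finTwoArrow ℝ).symm
  rw [← integral_indicator hms, ← hmp.integral_comp', Measure.volume_eq_prod,
    integral_prod (fun z => indicator (V1 α₁ α₂ c d) F (MeasurableEquiv.finTwoArrow.symm z))
      ((hmp.integrable_comp_emb (MeasurableEquiv.measurableEmbedding _)).2
      (hFint.integrable_indicator hms))]
  have hmem : ∀ u ∈ Ioo (0 : ℝ) 1, ∀ s ∈ Ioo c d, ![u, u ^ γ * s] ∈ V1 α₁ α₂ c d := by
    intro u hu s hs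
    have : 0 < u ^ γ := rpow_pos_of_pos hu.1 _
    refine (mem_V1_iff' hα₁).2 ⟨hu, ?_⟩
    simp only [Matrix.cons_val_zero, Matrix.cons_val_one, Matrix.cons_val_fin_one, mem_Ioo, ← hγ]
    constructor <;> nlinarith [hs.1, hs.2]
  have hinner : ∀ u, ∫ v, indicator (V1 α₁ α₂ c d) F (MeasurableEquiv.finTwoArrow.symm (u, v))
      = indicator (Ioo (0 : ℝ) 1) (fun u => ∫ s in Ioo c d,
          ((u ^ γ : ℝ) : ℂ) * F ![u, u ^ γ * s]) u := by
    intro u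
    by_cases hu : u ∈ Ioo (0 : ℝ) 1
    · have hup : 0 < u ^ γ := rpow_pos_of_pos hu.1 _
      rw [indicator_of_mem hu]
      have e1 : (fun v => indicator (V1 α₁ α₂ c d) F (MeasurableEquiv.finTwoArrow.symm (u, v)))
          = indicator (Ioo (u ^ γ * c) (u ^ γ * d)) fun v => F ![u, v] := by
        funext v
        have : MeasurableEquiv.finTwoArrow.symm (u, v) = ![u, v] := rfl
        rw [this, indicator_apply, indicator_apply, mem_V1_iff' hα₁]
        simp only [Matrix.cons_val_zero, Matrix.cons_val_one, Matrix.cons_val_fin_one, hu, true_and,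
          mul_comm, ← hγ]
      rw [e1, integral_indicator measurableSet_Ioo, ← integral_Ioc_eq_integral_Ioo,
        ← integral_Ioc_eq_integral_Ioo,
        ← intervalIntegral.integral_of_le (by gcongr), ← intervalIntegral.integral_of_le hcd.le,
        intervalIntegral.integral_const_mul,
        ← intervalIntegral.smul_integral_comp_mul_left]
      rfl
    · rw [indicator_of_notMem hu]
      have : (fun v => indicator (V1 α₁ α₂ c d) F (MeasurableEquiv.finTwoArrow.symm (u, v)))
          = fun _ => 0 := by
        funext v
        refine indicator_of_notMem (fun h => hu ?_) _
        exact ((mem_V1_iff' hα₁).1 h).1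
      rw [this, integral_zero]
  simp_rw [hinner]
  rw [integral_indicator measurableSet_Ioo, integral_integral_swap]
  rw [Measure.prod_restrict]
  have hK0 : 0 ≤ K := (norm_nonneg _).trans
    (hK _ (hmem (1 / 2) (by norm_num) ((c + d) / 2) ⟨by linarith, by linarith⟩))
  have hmp : MeasurableSet (Ioo (0 : ℝ) 1 ×ˢ Ioo c d) := measurableSet_Ioo.prod measurableSet_Ioo
  refine IntegrableOn.of_bound ?_ ?_ K ?_
  · rw [Measure.prod_prod]
    exact (ENNReal.mul_lt_top (by simp) (by simp))
  · refine ContinuousOn.aestronglyMeasurable ?_ hmp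
    have hc : ContinuousOn (fun z : ℝ × ℝ => z.1 ^ γ) (Ioo (0 : ℝ) 1 ×ˢ Ioo c d) :=
      (continuous_fst.rpow_const fun _ => Or.inr hγ0.le).continuousOn
    have hc2 : ContinuousOn (fun z : ℝ × ℝ => (![z.1, z.1 ^ γ * z.2] : Fin 2 → ℝ))
        (Ioo (0 : ℝ) 1 ×ˢ Ioo c d) := by
      refine continuousOn_pi.2 fun i => ?_
      fin_cases i
      · exact continuousOn_fst
      · exact hc.mul continuousOn_snd
    refine ContinuousOn.mul (Complex.continuous_ofReal.comp_continuousOn hc) ?_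
    exact hF.comp hc2 fun z hz => hmem z.1 hz.1 z.2 hz.2
  · filter_upwards [ae_restrict_mem hmp] with z hz
    have h1 : z.1 ^ γ ≤ 1 := rpow_le_one hz.1.1.le hz.1.2.le hγ0.le
    have h2 : 0 ≤ z.1 ^ γ := rpow_nonneg hz.1.1.le _
    have h3 := hK _ (hmem z.1 hz.1 z.2 hz.2)
    simp only [Function.uncurry, norm_mul, Complex.norm_real, Real.norm_eq_abs, abs_of_nonneg h2]
    nlinarith [norm_nonneg (F ![z.1, z.1 ^ γ * z.2])]

lemma exists_norm_integral_graphMap_le {α₁ α₂ m a b c d : ℝ} {φ : (Fin 2 → ℝ) → Fin 2 → ℝ}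
    (hα₁ : 0 < α₁) (hα₂ : 0 < α₂) (hm : 3 * (α₁ + α₂) ≤ m)
    (H1 : AnalyticOnNhd ℝ φ (Vab α₁ α₂ a b))
    (H2 : ∀ x ∈ Vab α₁ α₂ a b, ∀ t : ℝ, 0 < t → φ (dil α₁ α₂ t x) = t ^ m • φ x)
    (hac : a < c) (hcd : c < d) (hdb : d < b)
    (hord : ∀ ζ : ℝ × ℝ, ζ.1 ^ 2 + ζ.2 ^ 2 = 1 → ∀ s ∈ Icc c d, ∃ ℓ : ℕ, (α₁ + α₂) / m * ℓ < 1 ∧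
      ζ.1 * iteratedDeriv ℓ (fun s => φ ![1, s] 0) s
        + ζ.2 * iteratedDeriv ℓ (fun s => φ ![1, s] 1) s ≠ 0) :
    ∃ C : ℝ, 0 ≤ C ∧ ∀ η : Fin 4 → ℝ, 0 < η 2 ^ 2 + η 3 ^ 2 →
      ‖∫ x in V1 α₁ α₂ c d, Complex.exp (Complex.I * (dot4 (graphMap φ x) η : ℝ))‖
        ≤ C * (√(η 2 ^ 2 + η 3 ^ 2)) ^ (-((α₁ + α₂) / m)) := by
  have hm0 : 0 < m := by linarith
  set ρ := (α₁ + α₂) / m with hρ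
  have hρ0 : 0 < ρ := by positivity
  set γ := α₂ / α₁ with hγ
  have hγ0 : 0 < γ := by positivity
  have hM : 3 * (1 + γ) ≤ m / α₁ := by
    rw [hγ, le_div_iff₀ hα₁]
    field_simp
    linarith
  have hρM : (1 + γ) / (m / α₁) = ρ := by rw [hγ, hρ]; field_simp
  obtain ⟨C₁, hC₁, hph⟩ := exists_norm_integral_phase_le hγ0 hM
  rw [hρM] at hph
  obtain ⟨C₂, hC₂, hsub⟩ := exists_lintegral_rpow_neg_le hac hdb hρ0.le
    (analyticOnNhd_line H1 0) (analyticOnNhd_line H1 1) hord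
  refine ⟨C₁ * C₂.toReal, by positivity, fun η hη => ?_⟩
  set R := √(η 2 ^ 2 + η 3 ^ 2) with hR
  have hR0 : 0 < R := sqrt_pos.2 hη
  set ζ : ℝ × ℝ := (η 2 / R, η 3 / R) with hζ
  have hζ1 : ζ.1 ^ 2 + ζ.2 ^ 2 = 1 := by
    simp only [hζ, div_pow]
    rw [← add_div, hR, sq_sqrt hη.le, div_self hη.ne']
  have hφV : ContinuousOn φ (V1 α₁ α₂ c d) := fun x hx =>
    (H1 x (Vab_mono hac.le hdb.le (V1_subset_Vab hx))).continuousAt.continuousWithinAt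
  have hφi : ∀ i, ContinuousOn (fun x => φ x i) (V1 α₁ α₂ c d) := fun i =>
    (continuous_apply i).comp_continuousOn hφV
  have hcont : ContinuousOn (fun x => Complex.exp (Complex.I * (dot4 (graphMap φ x) η : ℝ)))
      (V1 α₁ α₂ c d) := by
    have : ContinuousOn (fun x => dot4 (graphMap φ x) η) (V1 α₁ α₂ c d) := by
      simp only [dot4, graphMap, Matrix.cons_val]
      have := hφi 0
      have := hφi 1
      fun_prop
    fun_prop
  rw [integral_V1_eq hα₁ hα₂ hcd hcont (K := 1) fun x _ => by
    rw [mul_comm, Complex.norm_exp_ofReal_mul_I]]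
  rw [← ENNReal.ofReal_le_ofReal_iff (by positivity), ofReal_norm]
  refine (enorm_integral_le_lintegral_enorm _).trans ?_
  calc ∫⁻ s in Ioo c d, ‖∫ u in Ioo (0 : ℝ) 1, ((u ^ γ : ℝ) : ℂ) *
        Complex.exp (Complex.I * (dot4 (graphMap φ ![u, u ^ γ * s]) η : ℝ))‖ₑ
      ≤ ∫⁻ s in Ioo c d, ENNReal.ofReal (C₁ * R ^ (-ρ)) *
        (ENNReal.ofReal |ζ.1 * φ ![1, s] 0 + ζ.2 * φ ![1, s] 1|) ^ (-ρ) := by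
        refine setLIntegral_mono' measurableSet_Ioo fun s hs => ?_
        have hsab : ![1, s] ∈ Vab α₁ α₂ a b := one_mem_Vab (by linarith [hs.1]) (by linarith [hs.2])
        set w := ζ.1 * φ ![1, s] 0 + ζ.2 * φ ![1, s] 1 with hw
        rcases eq_or_ne w 0 with h0 | h0
        · rw [h0, abs_zero, ENNReal.ofReal_zero, ENNReal.zero_rpow_of_neg (by linarith),
            ENNReal.mul_top (by simp only [ne_eq, ENNReal.ofReal_eq_zero, not_le]; positivity)]
          exact le_top
        · have hB : η 2 * φ ![1, s] 0 + η 3 * φ ![1, s] 1 = R * w := by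
            simp only [hw, hζ]; field_simp
          have h1 := hph (η 0) (η 1 * s) (R * w) (mul_ne_zero hR0.ne' h0)
          rw [abs_mul R w, abs_of_pos hR0, mul_rpow hR0.le (abs_nonneg w), ← mul_assoc] at h1
          rw [ENNReal.ofReal_rpow_of_pos (abs_pos.2 h0), ← ENNReal.ofReal_mul (by positivity),
            ← ofReal_norm]
          refine ENNReal.ofReal_le_ofReal (le_trans (le_of_eq ?_) h1)
          rw [← integral_Ioc_eq_integral_Ioo, ← intervalIntegral.integral_of_le zero_le_one]
          congr 1
          refine intervalIntegral.integral_congr_ae (by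
            refine Filter.Eventually.of_forall fun u hu => ?_
            rw [uIoc_of_le zero_le_one] at hu
            have hu0 := hu.1
            have e : (![u, u ^ γ * s] : Fin 2 → ℝ) = dil α₁ α₂ (u ^ (1 / α₁)) ![1, s] := by
              ext i
              fin_cases i
              · simp [dil, ← rpow_mul hu0.le, inv_mul_cancel₀ hα₁.ne']
              · simp only [dil, Fin.mk_one, Matrix.cons_val_one, Matrix.cons_val_zero,
                  Matrix.cons_val_fin_one]
                rw [← rpow_mul hu0.le, one_div_mul_eq_div]
            have e2 : φ ![u, u ^ γ * s] = u ^ (m / α₁) • φ ![1, s] := by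
              rw [e, H2 _ hsab _ (by positivity), ← rpow_mul hu0.le, one_div_mul_eq_div]
            congr 4
            simp only [dot4, graphMap, Matrix.cons_val, e2, Pi.smul_apply, smul_eq_mul]
            rw [← hB]
            ring)
    _ = ENNReal.ofReal (C₁ * R ^ (-ρ)) * ∫⁻ s in Ioo c d,
        (ENNReal.ofReal |ζ.1 * φ ![1, s] 0 + ζ.2 * φ ![1, s] 1|) ^ (-ρ) :=
        lintegral_const_mul' _ _ ENNReal.ofReal_ne_top
    _ ≤ ENNReal.ofReal (C₁ * R ^ (-ρ)) * C₂ := by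
        gcongr
        exact (lintegral_mono_set Ioo_subset_Icc_self).trans (hsub ζ hζ1)
    _ = ENNReal.ofReal (C₁ * C₂.toReal * R ^ (-ρ)) := by
        rw [mul_right_comm C₁, ENNReal.ofReal_mul (p := C₁ * R ^ (-ρ)) (by positivity),
          ENNReal.ofReal_toReal hC₂]

/-- The entire function `z ↦ r ^ (p (1 - z / 2))`, with value `0` for `r = 0`. -/
def cpowLine (p r : ℝ) (z : ℂ) : ℂ :=
  if r = 0 then 0 else Complex.exp ((Real.log r : ℂ) * (p * (1 - z / 2)))

lemma differentiable_cpowLine (p r : ℝ) : Differentiable ℂ (cpowLine p r) := by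
  unfold cpowLine
  split_ifs
  · exact differentiable_const _
  · fun_prop

lemma norm_cpowLine {p r : ℝ} (hr : 0 ≤ r) {z : ℂ} (hz : p * (1 - z.re / 2) ≠ 0) :
    ‖cpowLine p r z‖ = r ^ (p * (1 - z.re / 2)) := by
  unfold cpowLine
  split_ifs with h
  · rw [h, norm_zero, zero_rpow hz]
  · rw [Complex.norm_exp, rpow_def_of_pos (lt_of_le_of_ne hr (Ne.symm h))]
    congr 1
    simp

lemma cpowLine_eq_self {p r : ℝ} {z : ℂ} (hr : 0 ≤ r) (hz : (p : ℂ) * (1 - z / 2) = 1) :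
    cpowLine p r z = r := by
  unfold cpowLine
  split_ifs with h
  · simp [h]
  · rw [hz, mul_one, ← Complex.ofReal_exp, Real.exp_log (lt_of_le_of_ne hr (Ne.symm h))]

/-- Finite-dimensional form of the Stein interpolation theorem, for a family of bilinear forms
whose weighted sums are controlled on `ℓ¹ × ℓ¹` and on `ℓ² × ℓ²`. -/
lemma stein_interpolation_finset {ι κ : Type*} {s : Finset ι} {t : Finset κ} {S : Finset ℤ}
    {M : ℤ → ι → κ → ℂ} {u : ι → ℝ} {v : κ → ℝ} {θ C : ℝ} (hθ : 0 < θ) (hC : 0 ≤ C)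
    (hu : ∀ i, 0 ≤ u i) (hv : ∀ j, 0 ≤ v j)
    (h0 : ∀ c : ℤ → ℂ, (∀ l, ‖c l‖ ≤ 2 ^ (-2 * (l : ℝ))) → ∀ (x : ι → ℂ) (y : κ → ℂ),
      ‖∑ l ∈ S, ∑ i ∈ s, ∑ j ∈ t, c l * x i * y j * M l i j‖
        ≤ C * ((∑ i ∈ s, ‖x i‖ * u i) * ∑ j ∈ t, ‖y j‖ * v j))
    (h1 : ∀ c : ℤ → ℂ, (∀ l, ‖c l‖ ≤ 2 ^ (θ * (l : ℝ))) → ∀ (x : ι → ℂ) (y : κ → ℂ),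
      ‖∑ l ∈ S, ∑ i ∈ s, ∑ j ∈ t, c l * x i * y j * M l i j‖
        ≤ C * (√(∑ i ∈ s, ‖x i‖ ^ 2 * u i) * √(∑ j ∈ t, ‖y j‖ ^ 2 * v j)))
    {p : ℝ} (hp : p = (θ + 2) / (θ + 1)) {x : ι → ℝ} {y : κ → ℝ}
    (hx : ∀ i, 0 ≤ x i) (hy : ∀ j, 0 ≤ y j) :
    ‖∑ l ∈ S, ∑ i ∈ s, ∑ j ∈ t, (x i : ℂ) * y j * M l i j‖
      ≤ C * ((∑ i ∈ s, x i ^ p * u i) ^ (1 / p) * (∑ j ∈ t, y j ^ p * v j) ^ (1 / p)) := by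
  have hp0 : 0 < p := by rw [hp]; positivity
  set τ : ℝ := 2 / (2 + θ) with hτ
  have hτ0 : 0 < τ := by positivity
  have hτ1 : τ < 1 := by rw [hτ, div_lt_one (by positivity)]; linarith
  have hpτ : p * (1 - τ / 2) = 1 := by
    rw [hp, hτ]
    field_simp
    ring
  set cf : ℤ → ℂ → ℂ := fun l z =>
    Complex.exp (((-(l : ℝ) * Real.log 2 : ℝ) : ℂ) * (2 - (2 + θ) * z)) with hcf
  have hcfn : ∀ l z, ‖cf l z‖ = 2 ^ (-(l : ℝ) * (2 - (2 + θ) * z.re)) := by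
    intro l z
    rw [hcf]
    simp only
    rw [Complex.norm_exp, rpow_def_of_pos two_pos, Complex.re_ofReal_mul]
    congr 1
    simp
    ring
  set F : ℂ → ℂ := fun z => ∑ l ∈ S, ∑ i ∈ s, ∑ j ∈ t,
    cf l z * cpowLine p (x i) z * cpowLine p (y j) z * M l i j with hF
  have hFd : Differentiable ℂ F := by
    rw [hF]
    have := differentiable_cpowLine p
    have hc : ∀ l, Differentiable ℂ (cf l) := fun l => by rw [hcf]; fun_prop
    fun_prop
  set U := ∑ i ∈ s, x i ^ p * u i with hU
  set W := ∑ j ∈ t, y j ^ p * v j with hW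
  have hU0 : 0 ≤ U := Finset.sum_nonneg fun i _ => mul_nonneg (rpow_nonneg (hx i) _) (hu i)
  have hW0 : 0 ≤ W := Finset.sum_nonneg fun i _ => mul_nonneg (rpow_nonneg (hy i) _) (hv i)
  have hne : ∀ r : ℝ, r ≤ 1 → p * (1 - r / 2) ≠ 0 := fun r hr =>
    (mul_pos hp0 (by linarith)).ne'
  have ha : ∀ z ∈ Complex.re ⁻¹' {0}, ‖F z‖ ≤ C * (U * W) := by
    intro z hz
    have hz : z.re = 0 := hz
    refine (h0 (fun l => cf l z) (fun l => ?_) _ _).trans (le_of_eq ?_)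
    · rw [hcfn, hz]
      apply le_of_eq
      congr 1
      ring
    · simp_rw [norm_cpowLine (hx _) (hne z.re (by linarith)),
        norm_cpowLine (hy _) (hne z.re (by linarith)), hz, hU, hW]
      simp
  have hb : ∀ z ∈ Complex.re ⁻¹' {1}, ‖F z‖ ≤ C * (√U * √W) := by
    intro z hz
    have hz : z.re = 1 := hz
    refine (h1 (fun l => cf l z) (fun l => ?_) _ _).trans (le_of_eq ?_)
    · rw [hcfn, hz]
      apply le_of_eq
      congr 1
      ring
    · have e : ∀ r : ℝ, 0 ≤ r → ‖cpowLine p r z‖ ^ 2 = r ^ p := by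
        intro r hr
        rw [norm_cpowLine hr (hne z.re (by linarith)), hz, ← rpow_natCast, ← rpow_mul hr]
        congr 1
        push_cast
        ring
      simp_rw [e _ (hx _), e _ (hy _), hU, hW]
  have hB : BddAbove ((norm ∘ F) '' Complex.HadamardThreeLines.verticalClosedStrip 0 1) := by
    set H : ℝ → ℝ := fun r => ∑ l ∈ S, ∑ i ∈ s, ∑ j ∈ t,
      ‖cf l r * cpowLine p (x i) r * cpowLine p (y j) r * M l i j‖ with hH
    have hHc : Continuous H := by
      have := fun r => (differentiable_cpowLine p r).continuous
      have hc : ∀ l, Continuous (cf l) := fun l => by rw [hcf]; fun_prop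
      rw [hH]
      fun_prop
    obtain ⟨B, hB⟩ := (isCompact_Icc (a := (0 : ℝ)) (b := 1)).bddAbove_image hHc.continuousOn
    refine ⟨B, ?_⟩
    rintro _ ⟨z, hz, rfl⟩
    have hz : z.re ∈ Icc (0 : ℝ) 1 := hz
    refine le_trans ?_ (hB ⟨z.re, hz, rfl⟩)
    simp only [Function.comp, hF, hH]
    refine (norm_sum_le _ _).trans (Finset.sum_le_sum fun l _ => (norm_sum_le _ _).trans
      (Finset.sum_le_sum fun i _ => (norm_sum_le _ _).trans (Finset.sum_le_sum fun j _ => ?_)))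
    rw [norm_mul, norm_mul, norm_mul, norm_mul, norm_mul, norm_mul, hcfn, hcfn,
      norm_cpowLine (hx _) (hne z.re hz.2), norm_cpowLine (hy _) (hne z.re hz.2),
      norm_cpowLine (hx _) (hne _ (by simpa using hz.2)),
      norm_cpowLine (hy _) (hne _ (by simpa using hz.2))]
    simp
  have key := Complex.HadamardThreeLines.norm_le_interp_of_mem_verticalClosedStrip₀₁' F
    (z := (τ : ℂ)) ⟨by simpa using hτ0.le, by simpa using hτ1.le⟩ hFd.diffContOnCl hB ha hb
  have hFτ : F τ = ∑ l ∈ S, ∑ i ∈ s, ∑ j ∈ t, (x i : ℂ) * y j * M l i j := by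
    have hz : (p : ℂ) * (1 - (τ : ℂ) / 2) = 1 := by exact_mod_cast hpτ
    have hc : ∀ l, cf l τ = 1 := by
      intro l
      have : (2 : ℂ) - (2 + θ) * τ = 0 := by
        have : (2 : ℝ) - (2 + θ) * τ = 0 := by rw [hτ]; field_simp; ring
        exact_mod_cast this
      simp only [hcf, this, mul_zero, Complex.exp_zero]
    simp only [hF, hc, cpowLine_eq_self (hx _) hz, cpowLine_eq_self (hy _) hz, one_mul]
  rw [hFτ, Complex.ofReal_re] at key
  refine key.trans (le_of_eq ?_)
  have e1 : (1 - τ) + 1 / 2 * τ = 1 / p := by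
    rw [eq_div_iff hp0.ne']
    linarith
  have e2 : 1 / p ≠ 0 := by positivity
  have hpow : ∀ X : ℝ, 0 ≤ X → X ^ (1 - τ) * (√X) ^ τ = X ^ (1 / p) := by
    intro X hX
    rw [sqrt_eq_rpow, ← rpow_mul hX, ← rpow_add' hX (by rw [e1]; exact e2), e1]
  rw [mul_rpow hC (by positivity), mul_rpow hC (by positivity), mul_rpow hU0 hW0,
    mul_rpow (sqrt_nonneg _) (sqrt_nonneg _), ← hpow U hU0, ← hpow W hW0]
  have : C ^ (1 - τ) * C ^ τ = C := by
    rw [← rpow_add' hC (by norm_num)]; norm_num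
  calc _ = (C ^ (1 - τ) * C ^ τ) * ((U ^ (1 - τ) * (√U) ^ τ) * (W ^ (1 - τ) * (√W) ^ τ)) := by ring
    _ = _ := by rw [this]

/-- The planar Gaussian of mass one with parameter `a`, as a function of the squared radius. -/
def planeGauss (a r : ℝ) : ℝ := a / π * Real.exp (-(a * r))

/-- A dyadic approximate identity on the plane, vanishing at the origin, as a function of the
squared radius. -/
def dyadicBump (l : ℤ) (r : ℝ) : ℝ := 2 * planeGauss (4 ^ l) r - planeGauss (2 * 4 ^ l) r

/-- The Fourier transform of `dyadicBump l`, as a function of the squared radius. -/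
def dyadicBumpHat (l : ℤ) (q : ℝ) : ℝ :=
  2 * Real.exp (-(q / (4 * 4 ^ l))) - Real.exp (-(q / (4 * (2 * 4 ^ l))))

lemma abs_dyadicBump_le (l : ℤ) {r : ℝ} (hr : 0 ≤ r) :
    |dyadicBump l r| ≤ 4 ^ l * min (4 ^ l * r) (4 ^ l * r)⁻¹ := by
  have h4 : (0 : ℝ) < 4 ^ l := by positivity
  set x : ℝ := 4 ^ l * r with hx
  have hx0 : 0 ≤ x := by positivity
  have e : dyadicBump l r = 4 ^ l * (2 / π * (Real.exp (-x) * (1 - Real.exp (-x)))) := by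
    have : Real.exp (-(2 * 4 ^ l * r)) = Real.exp (-x) * Real.exp (-x) := by
      rw [← Real.exp_add]; congr 1; rw [hx]; ring
    rw [dyadicBump, planeGauss, planeGauss, this, ← hx]
    field_simp
  have h1 : Real.exp (-x) ≤ 1 := Real.exp_le_one_iff.2 (by linarith)
  have h2 := Real.exp_pos (-x)
  have h3 : 1 - Real.exp (-x) ≤ x := by linarith [Real.add_one_le_exp (-x)]
  have hπ : 2 / π ≤ 1 := (div_le_one pi_pos).2 (by linarith [pi_gt_three])
  have hπ0 : 0 < 2 / π := by positivity
  have hnn : 0 ≤ Real.exp (-x) * (1 - Real.exp (-x)) := mul_nonneg h2.le (by linarith)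
  rw [e, abs_of_nonneg (by positivity)]
  refine mul_le_mul_of_nonneg_left ((mul_le_of_le_one_left hnn hπ).trans (le_min ?_ ?_)) h4.le
  · nlinarith
  · rcases eq_or_lt_of_le hx0 with h0 | h0
    · simp [← h0]
    · refine (mul_le_of_le_one_right h2.le (by linarith)).trans ?_
      rw [Real.exp_neg]
      exact inv_anti₀ h0 (by linarith [Real.add_one_le_exp x])

lemma abs_dyadicBump_le_zpow (l : ℤ) {r : ℝ} (hr : 0 ≤ r) : |dyadicBump l r| ≤ 4 ^ l := by
  refine (abs_dyadicBump_le l hr).trans (mul_le_of_le_one_right (by positivity) ?_)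
  rcases le_total (4 ^ l * r) 1 with h | h
  · exact (min_le_left _ _).trans h
  · exact (min_le_right _ _).trans (inv_le_one_of_one_le₀ h)

lemma exists_norm_sum_dyadicBump_le : ∃ C : ℝ, 0 < C ∧ ∀ (S : Finset ℤ) (c : ℤ → ℂ),
    (∀ l, ‖c l‖ ≤ 2 ^ (-2 * (l : ℝ))) → ∀ r : ℝ, 0 ≤ r →
      ‖∑ l ∈ S, c l * ((dyadicBump l r - dyadicBump (l - 1) r : ℝ) : ℂ)‖ ≤ C := by
  obtain ⟨C, hC, h⟩ := exists_sum_min_zpow_le (r := 4) (by norm_num)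
  refine ⟨C + C, by positivity, fun S c hc r hr => ?_⟩
  have hc' : ∀ l, ‖c l‖ * 4 ^ l ≤ 1 := by
    intro l
    have : (2 : ℝ) ^ (-2 * (l : ℝ)) = ((4 : ℝ) ^ l)⁻¹ := by
      rw [rpow_mul two_pos.le, rpow_intCast, ← inv_zpow]
      congr 1
      rw [rpow_neg two_pos.le]
      norm_num
    calc ‖c l‖ * 4 ^ l ≤ ((4 : ℝ) ^ l)⁻¹ * 4 ^ l := by
          gcongr; rw [← this]; exact hc l
      _ = 1 := inv_mul_cancel₀ (by positivity)
  have h1 : ∀ l, ‖c l * ((dyadicBump l r - dyadicBump (l - 1) r : ℝ) : ℂ)‖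
      ≤ min (4 ^ l * r) (4 ^ l * r)⁻¹ + min (4 ^ l * (r / 4)) (4 ^ l * (r / 4))⁻¹ := by
    intro l
    rw [norm_mul, Complex.norm_real, Real.norm_eq_abs]
    have e1 := abs_dyadicBump_le l hr
    have e2 := abs_dyadicBump_le (l - 1) hr
    have e3 : (4 : ℝ) ^ (l - 1) = 4 ^ l / 4 := by rw [zpow_sub_one₀ (by norm_num)]; ring
    rw [e3] at e2
    have e4 : (4 : ℝ) ^ l / 4 * r = 4 ^ l * (r / 4) := by ring
    rw [e4] at e2
    have h4 : (0 : ℝ) < 4 ^ l := by positivity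
    have m1 : 0 ≤ min (4 ^ l * r) (4 ^ l * r)⁻¹ := by positivity
    have m2 : 0 ≤ min (4 ^ l * (r / 4)) (4 ^ l * (r / 4))⁻¹ := by positivity
    calc ‖c l‖ * |dyadicBump l r - dyadicBump (l - 1) r|
        ≤ ‖c l‖ * (4 ^ l * min (4 ^ l * r) (4 ^ l * r)⁻¹
          + 4 ^ l * min (4 ^ l * (r / 4)) (4 ^ l * (r / 4))⁻¹) := by
          gcongr
          refine (abs_sub _ _).trans (add_le_add e1 (e2.trans ?_))
          gcongr
          linarith
      _ = (‖c l‖ * 4 ^ l) * (min (4 ^ l * r) (4 ^ l * r)⁻¹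
          + min (4 ^ l * (r / 4)) (4 ^ l * (r / 4))⁻¹) := by ring
      _ ≤ _ := mul_le_of_le_one_left (by positivity) (hc' l)
  refine (norm_sum_le _ _).trans ((Finset.sum_le_sum fun l _ => h1 l).trans ?_)
  rw [Finset.sum_add_distrib]
  exact add_le_add (h _ hr _) (h _ (by positivity) _)

lemma exists_sum_sub_pred_eq (N : ℕ) : ∃ S : Finset ℤ,
    ∀ F : ℤ → ℂ, ∑ l ∈ S, (F l - F (l - 1)) = F N - F (-N) := by
  have hinj : Function.Injective fun k : ℕ => (k : ℤ) - N + 1 := fun i j h => by simpa using h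
  refine ⟨(Finset.range (2 * N)).map ⟨_, hinj⟩, fun F => ?_⟩
  rw [Finset.sum_map]
  have := Finset.sum_range_sub (fun k : ℕ => F ((k : ℤ) - N)) (2 * N)
  rw [show F N - F (-N) = F (((2 * N : ℕ) : ℤ) - N) - F (((0 : ℕ) : ℤ) - N) by
    congr 2
    · push_cast; ring
    · simp, ← this]
  refine Finset.sum_congr rfl fun k _ => ?_
  change F ((k : ℤ) - N + 1) - F ((k : ℤ) - N + 1 - 1) = _
  congr 2
  · push_cast; ring
  · ring

lemma exists_norm_sum_dyadicBumpHat_le {θ : ℝ} (hθ : 0 < θ) (hθ1 : θ ≤ 1) :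
    ∃ C : ℝ, 0 < C ∧ ∀ (S : Finset ℤ) (c : ℤ → ℂ),
    (∀ l, ‖c l‖ ≤ 2 ^ (θ * (l : ℝ))) → ∀ q : ℝ, 0 ≤ q →
      ‖∑ l ∈ S, c l * ((dyadicBumpHat l q - dyadicBumpHat (l - 1) q : ℝ) : ℂ)‖ ≤ C * √q ^ θ := by
  obtain ⟨C, hC, h⟩ := exists_sum_min_zpow_le (r := 2) (by norm_num)
  refine ⟨120 * C, by positivity, fun S c hc q hq => ?_⟩
  set Q := √q with hQ
  have hQ0 : 0 ≤ Q := sqrt_nonneg _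
  have hQq : q = Q ^ 2 := (sq_sqrt hq).symm
  -- the pointwise estimate
  have hE : ∀ t : ℝ, 0 ≤ t → |(2 * Real.exp (-(2 * t)) - Real.exp (-t))
      - (2 * Real.exp (-(8 * t)) - Real.exp (-(4 * t)))| ≤ 15 * min t t⁻¹ := by
    intro t ht
    have a1 : Real.exp (-(8 * t)) = Real.exp (-(2 * t)) * Real.exp (-(6 * t)) := by
      rw [← Real.exp_add]; congr 1; ring
    have a2 : Real.exp (-(4 * t)) = Real.exp (-t) * Real.exp (-(3 * t)) := by
      rw [← Real.exp_add]; congr 1; ring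
    have a3 : Real.exp (-(2 * t)) = Real.exp (-t) * Real.exp (-t) := by
      rw [← Real.exp_add]; congr 1; ring
    have b1 := Real.exp_pos (-t)
    have b2 := Real.exp_pos (-(6 * t))
    have b3 := Real.exp_pos (-(3 * t))
    have b4 := Real.exp_pos (-(2 * t))
    have c1 : Real.exp (-t) ≤ 1 := Real.exp_le_one_iff.2 (by linarith)
    have c2 := Real.add_one_le_exp (-(6 * t))
    have c3 := Real.add_one_le_exp (-(3 * t))
    have c4 : Real.exp (-(2 * t)) ≤ 1 := Real.exp_le_one_iff.2 (by linarith)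
    have c5 : Real.exp (-(6 * t)) ≤ 1 := Real.exp_le_one_iff.2 (by linarith)
    have c6 : Real.exp (-(3 * t)) ≤ 1 := Real.exp_le_one_iff.2 (by linarith)
    set P := Real.exp (-(2 * t)) * (1 - Real.exp (-(6 * t))) with hP
    set R := Real.exp (-t) * (1 - Real.exp (-(3 * t))) with hR
    have hP0 : 0 ≤ P := mul_nonneg b4.le (by linarith)
    have hR0 : 0 ≤ R := mul_nonneg b1.le (by linarith)
    have hP1 : P ≤ 6 * t := (mul_le_of_le_one_left (by linarith) c4).trans (by linarith)
    have hR1 : R ≤ 3 * t := (mul_le_of_le_one_left (by linarith) c1).trans (by linarith)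
    have hP2 : P ≤ Real.exp (-t) :=
      (mul_le_of_le_one_right b4.le (by linarith)).trans (by rw [a3]; nlinarith)
    have hR2 : R ≤ Real.exp (-t) := mul_le_of_le_one_right b1.le (by linarith)
    have e : (2 * Real.exp (-(2 * t)) - Real.exp (-t))
      - (2 * Real.exp (-(8 * t)) - Real.exp (-(4 * t))) = 2 * P - R := by
      rw [hP, hR, a1, a2]; ring
    rw [e]
    rcases eq_or_lt_of_le ht with h0 | h0
    · have hPR : 2 * P - R = 0 := by linarith
      rw [hPR, abs_zero]
      positivity
    · have he : Real.exp (-t) ≤ t⁻¹ := by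
        rw [Real.exp_neg]
        exact inv_anti₀ h0 (by linarith [Real.add_one_le_exp t])
      rw [mul_min_of_nonneg _ _ (by norm_num : (0 : ℝ) ≤ 15)]
      have : 0 < t⁻¹ := by positivity
      refine le_min ?_ ?_ <;> rw [abs_le] <;> constructor <;> linarith
  have hψ : ∀ l : ℤ, dyadicBumpHat l q - dyadicBumpHat (l - 1) q
      = (2 * Real.exp (-(2 * (q / (8 * 4 ^ l)))) - Real.exp (-(q / (8 * 4 ^ l))))
      - (2 * Real.exp (-(8 * (q / (8 * 4 ^ l)))) - Real.exp (-(4 * (q / (8 * 4 ^ l))))) := by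
    intro l
    have e3 : (4 : ℝ) ^ (l - 1) = 4 ^ l / 4 := by rw [zpow_sub_one₀ (by norm_num)]; ring
    have h4 : (4 : ℝ) ^ l ≠ 0 := by positivity
    have d1 : q / (4 * 4 ^ l) = 2 * (q / (8 * 4 ^ l)) := by field_simp; ring
    have d2 : q / (4 * (2 * 4 ^ l)) = q / (8 * 4 ^ l) := by congr 1; ring
    have d3 : q / (4 * (4 ^ l / 4)) = 8 * (q / (8 * 4 ^ l)) := by field_simp
    have d4 : q / (4 * (2 * (4 ^ l / 4))) = 4 * (q / (8 * 4 ^ l)) := by field_simp; ring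
    rw [dyadicBumpHat, dyadicBumpHat, e3, d1, d2, d3, d4]
  rcases eq_or_lt_of_le hQ0 with hz | hQpos
  · have hq0 : ∀ l, dyadicBumpHat l q = 1 := by
      intro l
      rw [hQq, ← hz]
      norm_num [dyadicBumpHat]
    simp only [hq0, sub_self, Complex.ofReal_zero, mul_zero, Finset.sum_const_zero, norm_zero]
    positivity
  have h1 : ∀ l, ‖c l * ((dyadicBumpHat l q - dyadicBumpHat (l - 1) q : ℝ) : ℂ)‖
      ≤ 120 * Q ^ θ * min (2 ^ (-l) * Q) (2 ^ (-l) * Q)⁻¹ := by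
    intro l
    set X : ℝ := 2 ^ (-l) * Q with hX
    have hX0 : 0 < X := by positivity
    have h4 : (4 : ℝ) ^ l = (2 ^ l) ^ 2 := by
      rw [← zpow_natCast, ← zpow_mul, mul_comm, zpow_mul]; norm_num
    have h2 : (0 : ℝ) < 2 ^ l := by positivity
    have ht : q / (8 * 4 ^ l) = X ^ 2 / 8 := by
      rw [hQq, h4, hX, zpow_neg]
      field_simp
    have hcl : ‖c l‖ ≤ Q ^ θ * X ^ (-θ) := by
      refine (hc l).trans (le_of_eq ?_)
      rw [hX, mul_rpow (by positivity) hQ0, rpow_neg hQ0 θ, ← rpow_intCast, ← rpow_mul two_pos.le]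
      have : Q ^ θ ≠ 0 := by positivity
      field_simp
      congr 1
      push_cast
      ring
    have hmin : X ^ (-θ) * min (X ^ 2 / 8) (X ^ 2 / 8)⁻¹ ≤ 8 * min X X⁻¹ := by
      have hXθ : 0 < X ^ (-θ) := by positivity
      rcases le_total X 1 with hx | hx
      · have m1 : X ≤ X⁻¹ := hx.trans ((one_le_inv₀ hX0).2 hx)
        have m2 : X ^ (-θ) ≤ X ^ (-1 : ℝ) := rpow_le_rpow_of_exponent_ge hX0 hx (by linarith)
        rw [rpow_neg_one] at m2
        rw [min_eq_left m1]
        calc _ ≤ X⁻¹ * (X ^ 2 / 8) := by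
              gcongr; exact min_le_left _ _
          _ = X / 8 := by field_simp
          _ ≤ _ := by linarith
      · have m1 : X⁻¹ ≤ X := (inv_le_one_of_one_le₀ hx).trans hx
        have m2 : X ^ (-θ) ≤ 1 := rpow_le_one_of_one_le_of_nonpos hx (by linarith)
        rw [min_eq_right m1]
        calc _ ≤ 1 * (X ^ 2 / 8)⁻¹ := by
              gcongr; exact min_le_right _ _
          _ = 8 * (X⁻¹ * X⁻¹) := by field_simp
          _ ≤ 8 * (X⁻¹ * 1) := by gcongr; exact inv_le_one_of_one_le₀ hx
          _ = _ := by ring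
    rw [norm_mul, Complex.norm_real, Real.norm_eq_abs, hψ, ht]
    calc _ ≤ (Q ^ θ * X ^ (-θ)) * (15 * min (X ^ 2 / 8) (X ^ 2 / 8)⁻¹) := by
          gcongr
          exact hE _ (by positivity)
      _ = 15 * Q ^ θ * (X ^ (-θ) * min (X ^ 2 / 8) (X ^ 2 / 8)⁻¹) := by ring
      _ ≤ 15 * Q ^ θ * (8 * min X X⁻¹) := by gcongr
      _ = _ := by ring
  refine (norm_sum_le _ _).trans ((Finset.sum_le_sum fun l _ => h1 l).trans ?_)
  rw [← Finset.mul_sum]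
  have h2 := h Q hQ0 (S.map (Equiv.neg ℤ).toEmbedding)
  rw [Finset.sum_map] at h2
  calc 120 * Q ^ θ * ∑ l ∈ S, min (2 ^ (-l) * Q) (2 ^ (-l) * Q)⁻¹ ≤ 120 * Q ^ θ * C := by
        gcongr
        exact h2
    _ = 120 * C * Q ^ θ := by ring

open scoped FourierTransform in
/-- The bilinear form `(f, g) ↦ ∫∫ K(x) f(y - x) g(y) dy dx`. -/
def convForm {E : Type*} [AddCommGroup E] [MeasureSpace E] (K f g : E → ℂ) : ℂ :=
  ∫ x, K x * ∫ y, f (y - x) * g y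

section
variable {E : Type*} [NormedAddCommGroup E] [InnerProductSpace ℝ E] [FiniteDimensional ℝ E]
  [MeasurableSpace E] [BorelSpace E]

lemma integral_norm_mul_le_eLpNorm {f g : E → ℂ} (hf : MemLp f 2) (hg : MemLp g 2) :
    ∫ y, ‖f y‖ * ‖g y‖ ≤ (eLpNorm f 2 volume).toReal * (eLpNorm g 2 volume).toReal := by
  have h := integral_mul_norm_le_Lp_mul_Lq (μ := (volume : Measure E)) (f := f) (g := g)
    (p := 2) (q := 2) Real.HolderConjugate.two_two (by simpa using hf) (by simpa using hg)
  rw [hf.eLpNorm_eq_integral_rpow_norm (by norm_num) (by norm_num),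
    hg.eLpNorm_eq_integral_rpow_norm (by norm_num) (by norm_num),
    ENNReal.toReal_ofReal (by positivity), ENNReal.toReal_ofReal (by positivity)]
  simpa using h

lemma integrable_comp_sub_mul {f g : E → ℂ} (hf : MemLp f 2) (hg : MemLp g 2) (x : E) :
    Integrable fun y => f (y - x) * g y := by
  have := hf.comp_measurePreserving (measurePreserving_sub_right (volume : Measure E) x)
  exact (MemLp.integrable_mul this hg)

lemma norm_integral_comp_sub_mul_le {f g : E → ℂ} (hf : MemLp f 2) (hg : MemLp g 2) (x : E) :
    ‖∫ y, f (y - x) * g y‖ ≤ (eLpNorm f 2 volume).toReal * (eLpNorm g 2 volume).toReal := by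
  have hmp := measurePreserving_sub_right (volume : Measure E) x
  have h := integral_norm_mul_le_eLpNorm (hf.comp_measurePreserving hmp) hg
  rw [eLpNorm_comp_measurePreserving hf.1 hmp] at h
  refine (norm_integral_le_integral_norm _).trans ?_
  simpa using h

lemma aestronglyMeasurable_integral_comp_sub_mul {f g : E → ℂ}
    (hf : AEStronglyMeasurable f volume) (hg : AEStronglyMeasurable g volume) :
    AEStronglyMeasurable (fun x => ∫ y, f (y - x) * g y) (volume : Measure E) := by
  have h : AEStronglyMeasurable (fun p : E × E => f (p.2 - p.1) * g p.2)
      ((volume : Measure E).prod volume) := by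
    refine AEStronglyMeasurable.mul ?_ (hg.comp_quasiMeasurePreserving
      Measure.quasiMeasurePreserving_snd)
    refine hf.comp_quasiMeasurePreserving (f := fun p : E × E => p.2 - p.1) ?_
    exact (quasiMeasurePreserving_sub (volume : Measure E) volume).comp
      (Measure.measurePreserving_swap).quasiMeasurePreserving
  exact h.integral_prod_right'

lemma integrable_mul_integral_comp_sub_mul {K f g : E → ℂ} (hK : Integrable K) (hf : MemLp f 2)
    (hg : MemLp g 2) : Integrable fun x => K x * ∫ y, f (y - x) * g y := by
  refine hK.mul_bdd (c := (eLpNorm f 2 volume).toReal * (eLpNorm g 2 volume).toReal)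
    (aestronglyMeasurable_integral_comp_sub_mul hf.1 hg.1)
    (.of_forall fun x => norm_integral_comp_sub_mul_le hf hg x)

lemma norm_convForm_le {K f g : E → ℂ} (hK : Integrable K) (hf : MemLp f 2) (hg : MemLp g 2) :
    ‖convForm K f g‖ ≤ (∫ x, ‖K x‖) *
      ((eLpNorm f 2 volume).toReal * (eLpNorm g 2 volume).toReal) := by
  rw [convForm, ← integral_mul_const]
  refine norm_integral_le_of_norm_le (hK.norm.mul_const _) (.of_forall fun x => ?_)
  rw [norm_mul]
  gcongr
  exact norm_integral_comp_sub_mul_le hf hg x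

lemma convForm_sub_left {K f f' g : E → ℂ} (hK : Integrable K) (hf : MemLp f 2)
    (hf' : MemLp f' 2) (hg : MemLp g 2) :
    convForm K (f - f') g = convForm K f g - convForm K f' g := by
  simp only [convForm]
  rw [← integral_sub (integrable_mul_integral_comp_sub_mul hK hf hg)
    (integrable_mul_integral_comp_sub_mul hK hf' hg)]
  congr 1 with x
  rw [← mul_sub, ← integral_sub (integrable_comp_sub_mul hf hg x)
    (integrable_comp_sub_mul hf' hg x)]
  simp only [Pi.sub_apply, sub_mul]

lemma convForm_sub_right {K f g g' : E → ℂ} (hK : Integrable K) (hf : MemLp f 2)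
    (hg : MemLp g 2) (hg' : MemLp g' 2) :
    convForm K f (g - g') = convForm K f g - convForm K f g' := by
  simp only [convForm]
  rw [← integral_sub (integrable_mul_integral_comp_sub_mul hK hf hg)
    (integrable_mul_integral_comp_sub_mul hK hf hg')]
  congr 1 with x
  rw [← mul_sub, ← integral_sub (integrable_comp_sub_mul hf hg x)
    (integrable_comp_sub_mul hf hg' x)]
  simp only [Pi.sub_apply, mul_sub]

open scoped FourierTransform SchwartzMap in
lemma norm_convForm_schwartz_le {K : E → ℂ} (hK : Integrable K) {M : ℝ}
    (hM : ∀ ξ, ‖𝓕 K ξ‖ ≤ M) (f g : 𝓢(E, ℂ)) :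
    ‖convForm K f g‖ ≤ M * ((eLpNorm f 2 volume).toReal * (eLpNorm g 2 volume).toReal) := by
  set F : 𝓢(E, ℂ) := 𝓕 f
  set G : 𝓢(E, ℂ) := 𝓕⁻ g with hG
  have hFG : 𝓕 G = g := FourierTransform.fourier_fourierInv_eq g
  have hn : ∀ h : 𝓢(E, ℂ), (eLpNorm (𝓕 h : 𝓢(E, ℂ)) 2 volume).toReal
      = (eLpNorm h 2 volume).toReal := by
    intro h
    have m1 : MemLp (𝓕 h : 𝓢(E, ℂ)) 2 (volume : Measure E) := (𝓕 h : 𝓢(E, ℂ)).memLp 2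
    rw [m1.eLpNorm_eq_integral_rpow_norm (by norm_num) (by norm_num),
      (h.memLp (μ := volume) 2).eLpNorm_eq_integral_rpow_norm (by norm_num) (by norm_num)]
    have := SchwartzMap.integral_norm_sq_fourier h
    simp [this]
  have hFint : Integrable fun ξ => F ξ * G ξ :=
    MemLp.integrable_mul (p := 2) (q := 2) (F.memLp 2) (G.memLp 2)
  have hc : ∀ x, ∫ y, f (y - x) * g y = 𝓕 (fun ξ => F ξ * G ξ) x := by
    intro x
    have h1 := VectorFourier.integral_fourierIntegral_smul_eq_flip (L := innerₗ E)
      (μ := volume) (ν := volume)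
      Real.continuous_fourierChar continuous_inner (f.integrable.comp_sub_right x) G.integrable
    have h2 : ∀ ξ, VectorFourier.fourierIntegral 𝐞 volume (innerₗ E) (fun y => f (y - x)) ξ
        = 𝐞 (-inner ℝ ξ x) • F ξ := by
      intro ξ
      have := congrFun (VectorFourier.fourierIntegral_comp_add_right 𝐞 volume (innerₗ E) f (-x)) ξ
      simp only [Function.comp_def, ← sub_eq_add_neg] at this
      rw [this, real_inner_comm]
      simp
      rfl
    have h3 : ∀ y, VectorFourier.fourierIntegral 𝐞 volume (innerₗ E).flip G y = g y := by
      intro y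
      rw [flip_innerₗ, ← hFG]
      rfl
    simp only [h2, h3, smul_eq_mul] at h1
    rw [← h1, Real.fourier_eq]
    simp only [Circle.smul_def, smul_eq_mul, mul_assoc]
  have h4 : convForm K f g = ∫ ξ, 𝓕 K ξ * (F ξ * G ξ) := by
    have h1 := VectorFourier.integral_fourierIntegral_smul_eq_flip (L := innerₗ E)
      (μ := volume) (ν := volume)
      Real.continuous_fourierChar continuous_inner hK hFint
    rw [flip_innerₗ] at h1
    simp only [convForm, hc]
    exact h1.symm
  have hM0 : 0 ≤ M := (norm_nonneg _).trans (hM 0)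
  rw [h4]
  calc _ ≤ ∫ ξ, M * (‖F ξ‖ * ‖G ξ‖) := by
        refine norm_integral_le_of_norm_le ?_ (.of_forall fun ξ => ?_)
        · simpa only [norm_mul] using! hFint.norm.const_mul M
        · rw [norm_mul, norm_mul]
          gcongr
          exact hM ξ
    _ ≤ _ := by
        rw [integral_const_mul]
        gcongr
        refine (integral_norm_mul_le_eLpNorm (F.memLp 2) (G.memLp 2)).trans_eq ?_
        rw [hn f, ← hFG, hn G]

open scoped FourierTransform SchwartzMap in
/-- Plancherel bound for a convolution form with bounded multiplier. -/
lemma norm_convForm_le_of_fourier {K : E → ℂ} (hK : Integrable K) {M : ℝ}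
    (hM : ∀ ξ, ‖𝓕 K ξ‖ ≤ M) {f g : E → ℂ} (hf : MemLp f 2) (hg : MemLp g 2) :
    ‖convForm K f g‖ ≤ M * ((eLpNorm f 2 volume).toReal * (eLpNorm g 2 volume).toReal) := by
  have happ : ∀ h : E → ℂ, MemLp h 2 → ∀ ε : ℝ, 0 < ε → ∃ h' : 𝓢(E, ℂ),
      (eLpNorm (h - ⇑h') 2 volume).toReal ≤ ε := by
    intro h hh ε hε
    obtain ⟨k, hk1, hk2, hk3⟩ := MemLp.exist_eLpNorm_sub_le (by norm_num) (by norm_num) hh hε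
    exact ⟨hk1.toSchwartzMap hk2, ENNReal.toReal_le_of_le_ofReal hε.le hk3⟩
  set a := (eLpNorm f 2 volume).toReal
  set b := (eLpNorm g 2 volume).toReal
  set κ := ∫ x, ‖K x‖
  have hκ : 0 ≤ κ := by positivity
  have hM0 : 0 ≤ M := (norm_nonneg _).trans (hM 0)
  have key : ∀ ε : ℝ, 0 < ε → ‖convForm K f g‖
      ≤ M * ((a + ε) * (b + ε)) + (κ * (ε * b) + κ * ((a + ε) * ε)) := by
    intro ε hε
    obtain ⟨f', hf'⟩ := happ f hf ε hε
    obtain ⟨g', hg'⟩ := happ g hg ε hε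
    have mf := f'.memLp (μ := volume) 2
    have mg := g'.memLp (μ := volume) 2
    have tri : ∀ (h : E → ℂ) (h' : 𝓢(E, ℂ)), MemLp h 2 →
        (eLpNorm h' 2 volume).toReal ≤ (eLpNorm h 2 volume).toReal
          + (eLpNorm (h - ⇑h') 2 volume).toReal := by
      intro h h' hh
      have mh := h'.memLp (μ := volume) 2
      rw [← ENNReal.toReal_add hh.2.ne (hh.sub mh).2.ne]
      refine ENNReal.toReal_mono (ENNReal.add_ne_top.2 ⟨hh.2.ne, (hh.sub mh).2.ne⟩) ?_
      have e : (h' : E → ℂ) = h - (h - ⇑h') := by simp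
      conv_lhs => rw [e]
      exact eLpNorm_sub_le hh.1 (hh.sub mh).1 (by norm_num)
    have e : convForm K f g = convForm K f' g' + (convForm K (f - ⇑f') g
        + convForm K f' (g - ⇑g')) := by
      rw [convForm_sub_left hK hf mf hg, convForm_sub_right hK mf hg mg]
      ring
    have t1 := tri f f' hf
    have t2 := tri g g' hg
    have t1' : (eLpNorm f' 2 volume).toReal ≤ a + ε := by linarith
    have t2' : (eLpNorm g' 2 volume).toReal ≤ b + ε := by linarith
    rw [e]
    refine (norm_add_le _ _).trans (add_le_add ?_ ((norm_add_le _ _).trans (add_le_add ?_ ?_)))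
    · refine (norm_convForm_schwartz_le hK hM f' g').trans ?_
      gcongr
    · refine (norm_convForm_le hK (hf.sub mf) hg).trans ?_
      gcongr
    · refine (norm_convForm_le hK mf (hg.sub mg)).trans ?_
      gcongr
  have hlim : Filter.Tendsto (fun ε : ℝ => M * ((a + ε) * (b + ε))
      + (κ * (ε * b) + κ * ((a + ε) * ε))) (nhdsWithin 0 (Ioi 0)) (nhds (M * (a * b))) := by
    have : Continuous fun ε : ℝ => M * ((a + ε) * (b + ε))
      + (κ * (ε * b) + κ * ((a + ε) * ε)) := by fun_prop
    have h := (this.tendsto 0).mono_left (nhdsWithin_le_nhds (s := Ioi 0))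
    simpa using h
  exact ge_of_tendsto hlim (Filter.eventually_of_mem self_mem_nhdsWithin fun ε hε => key ε hε)

end

open scoped FourierTransform in
/-- Plancherel bound for a convolution form on `ℝ⁴`. -/
lemma norm_convForm_le_of_fourier_pi {K : (Fin 4 → ℝ) → ℂ} (hK : Integrable K) {M : ℝ}
    (hM : ∀ η : Fin 4 → ℝ, ‖∫ y, K y * Complex.exp (-Complex.I * (dot4 y η : ℂ))‖ ≤ M)
    {f g : (Fin 4 → ℝ) → ℂ} (hf : MemLp f 2) (hg : MemLp g 2) :
    ‖convForm K f g‖ ≤ M * ((eLpNorm f 2 volume).toReal * (eLpNorm g 2 volume).toReal) := by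
  have hmp : MeasurePreserving (MeasurableEquiv.toLp 2 (Fin 4 → ℝ)).symm :=
    EuclideanSpace.volume_preserving_symm_measurableEquiv_toLp (Fin 4)
  set e := (MeasurableEquiv.toLp 2 (Fin 4 → ℝ)).symm with he
  have hs : ∀ x y, e (y - x) = e y - e x := fun x y => rfl
  have hform : convForm (K ∘ e) (f ∘ e) (g ∘ e) = convForm K f g := by
    simp only [convForm, Function.comp_apply, hs]
    rw [← hmp.integral_comp' (g := fun x => K x * ∫ y, f (y - x) * g y)]
    congr 1 with x
    rw [hmp.integral_comp' (g := fun y => f (y - e x) * g y)]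
  have hF : ∀ ξ, ‖𝓕 (K ∘ e) ξ‖ ≤ M := by
    intro ξ
    refine le_of_eq_of_le ?_ (hM ((2 * π) • e ξ))
    rw [Real.fourier_eq']
    rw [← hmp.integral_comp'
      (g := fun y => K y * Complex.exp (-Complex.I * (dot4 y ((2 * π) • e ξ) : ℂ)))]
    congr 2 with v
    rw [smul_eq_mul, mul_comm, Function.comp_apply]
    congr 2
    have : inner ℝ v ξ = dot4 (e v) (e ξ) := by
      simp only [PiLp.inner_apply, Fin.sum_univ_four, dot4, he]
      simp [mul_comm]
    rw [this]
    simp only [dot4, Pi.smul_apply, smul_eq_mul]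
    push_cast
    ring
  have h := norm_convForm_le_of_fourier ((hmp.integrable_comp hK.1).2 hK) hF
    (hf.comp_measurePreserving hmp) (hg.comp_measurePreserving hmp)
  rwa [hform, eLpNorm_comp_measurePreserving hf.1 hmp,
    eLpNorm_comp_measurePreserving hg.1 hmp] at h

lemma norm_convForm_le_of_bound {K : (Fin 4 → ℝ) → ℂ} {C : ℝ} (hC : ∀ x, ‖K x‖ ≤ C)
    {f g : (Fin 4 → ℝ) → ℂ} (hf : Integrable f) (hg : Integrable g) :
    ‖convForm K f g‖ ≤ C * ((∫ y, ‖f y‖) * ∫ y, ‖g y‖) := by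
  have hC0 : 0 ≤ C := (norm_nonneg _).trans (hC 0)
  have h1 : Integrable (fun p : (Fin 4 → ℝ) × (Fin 4 → ℝ) => ‖f (p.2 - p.1)‖ * ‖g p.2‖)
      (volume.prod volume) := by
    have h : Integrable (fun p : (Fin 4 → ℝ) × (Fin 4 → ℝ) => ‖f p.1‖ * ‖g p.2‖)
      (volume.prod volume) := hf.norm.mul_prod hg.norm
    have hmp : MeasurePreserving (fun p : (Fin 4 → ℝ) × (Fin 4 → ℝ) => (p.2 - p.1, p.2))
        (volume.prod volume) (volume.prod volume) := by
      have h2 : MeasurePreserving (fun p : (Fin 4 → ℝ) × (Fin 4 → ℝ) => (p.1, p.1 - p.2))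
          (volume.prod volume) (volume.prod volume) := by
        refine (MeasurePreserving.id _).skew_product (g := fun y x => y - x)
          (measurable_fst.sub measurable_snd) (.of_forall fun y => ?_)
        exact (Measure.measurePreserving_sub_left volume y).map_eq
      exact Measure.measurePreserving_swap.comp (h2.comp Measure.measurePreserving_swap)
    exact hmp.integrable_comp_of_integrable h
  calc _ ≤ ∫ x, C * ∫ y, ‖f (y - x)‖ * ‖g y‖ := by
        refine norm_integral_le_of_norm_le (h1.integral_prod_left.const_mul C)
          (.of_forall fun x => ?_)
        rw [norm_mul]
        gcongr
        · exact hC x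
        · refine (norm_integral_le_integral_norm _).trans_eq ?_
          simp only [norm_mul]
    _ = C * ∫ y, ∫ x, ‖f (y - x)‖ * ‖g y‖ := by
        rw [integral_const_mul, integral_integral_swap h1]
    _ = _ := by
        congr 1
        rw [← integral_const_mul]
        congr 1 with y
        rw [integral_mul_const, integral_sub_left_eq_self (fun x => ‖f x‖) volume y]

lemma measurePreserving_splitFour : MeasurePreserving
    (fun p : (Fin 2 → ℝ) × (Fin 2 → ℝ) => (![p.1 0, p.1 1, p.2 0, p.2 1] : Fin 4 → ℝ))
    (volume.prod volume) volume := by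
  have h1 := volume_measurePreserving_sumPiEquivProdPi_symm
    (fun _ : Fin 2 ⊕ Fin 2 => ℝ)
  have h2 := volume_measurePreserving_piCongrLeft (fun _ : Fin 4 => ℝ)
    (finSumFinEquiv : Fin 2 ⊕ Fin 2 ≃ Fin 4)
  convert! h2.comp h1 using 1
  funext p
  funext i
  have hk : ∀ j, ((MeasurableEquiv.piCongrLeft (fun _ : Fin 4 => ℝ)
      (finSumFinEquiv : Fin 2 ⊕ Fin 2 ≃ Fin 4)) ((MeasurableEquiv.sumPiEquivProdPi
      (fun _ : Fin 2 ⊕ Fin 2 => ℝ)).symm p)) (finSumFinEquiv j) =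
      Sum.elim p.1 p.2 j := by
    intro j
    rw [MeasurableEquiv.coe_piCongrLeft, Equiv.piCongrLeft_apply_apply]
    cases j <;> rfl
  fin_cases i
  · exact (hk (Sum.inl 0)).symm
  · exact (hk (Sum.inl 1)).symm
  · exact (hk (Sum.inr 0)).symm
  · exact (hk (Sum.inr 1)).symm

lemma measurePreserving_graphShear {φ : (Fin 2 → ℝ) → Fin 2 → ℝ} (hφ : Measurable φ) :
    MeasurePreserving (fun p : (Fin 2 → ℝ) × (Fin 2 → ℝ) =>
      (![p.1 0, p.1 1, φ p.1 0 + p.2 0, φ p.1 1 + p.2 1] : Fin 4 → ℝ))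
    (volume.prod volume) volume := by
  have h : MeasurePreserving (fun p : (Fin 2 → ℝ) × (Fin 2 → ℝ) => (p.1, φ p.1 + p.2))
      (volume.prod volume) (volume.prod volume) := by
    refine (MeasurePreserving.id _).skew_product (g := fun x u => φ x + u)
      ((hφ.comp measurable_fst).add measurable_snd) (.of_forall fun x => ?_)
    exact (measurePreserving_add_left volume (φ x)).map_eq
  exact measurePreserving_splitFour.comp h

/-- The radial functions `Ψ(|u|²)` and `Ψh(|η|²)` on the plane are a Fourier pair. -/
def IsPlaneFourierPair (Ψ Ψh : ℝ → ℂ) : Prop :=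
  Measurable Ψ ∧ Integrable (fun u : Fin 2 → ℝ => Ψ (u 0 ^ 2 + u 1 ^ 2)) ∧
    ∀ η₀ η₁ : ℝ, ∫ u : Fin 2 → ℝ, Ψ (u 0 ^ 2 + u 1 ^ 2)
      * Complex.exp (-Complex.I * ((u 0 * η₀ + u 1 * η₁ : ℝ) : ℂ)) = Ψh (η₀ ^ 2 + η₁ ^ 2)

lemma IsPlaneFourierPair.integrable_mul_exp {Ψ Ψh : ℝ → ℂ} (h : IsPlaneFourierPair Ψ Ψh)
    (η₀ η₁ : ℝ) : Integrable fun u : Fin 2 → ℝ => Ψ (u 0 ^ 2 + u 1 ^ 2)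
      * Complex.exp (-Complex.I * ((u 0 * η₀ + u 1 * η₁ : ℝ) : ℂ)) := by
  refine h.2.1.mul_bdd (c := 1) (by fun_prop) (.of_forall fun u => ?_)
  rw [neg_mul, mul_comm, ← neg_mul, ← Complex.ofReal_neg, Complex.norm_exp_ofReal_mul_I]

lemma IsPlaneFourierPair.add {Ψ Ψh Ψ' Ψh' : ℝ → ℂ} (h : IsPlaneFourierPair Ψ Ψh)
    (h' : IsPlaneFourierPair Ψ' Ψh') :
    IsPlaneFourierPair (fun r => Ψ r + Ψ' r) (fun r => Ψh r + Ψh' r) := by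
  refine ⟨h.1.add h'.1, h.2.1.add h'.2.1, fun η₀ η₁ => ?_⟩
  simp only [add_mul]
  rw [integral_add (h.integrable_mul_exp _ _) (h'.integrable_mul_exp _ _), h.2.2, h'.2.2]

lemma IsPlaneFourierPair.const_mul {Ψ Ψh : ℝ → ℂ} (h : IsPlaneFourierPair Ψ Ψh) (c : ℂ) :
    IsPlaneFourierPair (fun r => c * Ψ r) (fun r => c * Ψh r) := by
  refine ⟨h.1.const_mul c, h.2.1.const_mul c, fun η₀ η₁ => ?_⟩
  simp only [mul_assoc]
  rw [integral_const_mul, h.2.2]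

lemma IsPlaneFourierPair.sum {ι : Type*} (S : Finset ι) {Ψ Ψh : ι → ℝ → ℂ}
    (h : ∀ i, IsPlaneFourierPair (Ψ i) (Ψh i)) :
    IsPlaneFourierPair (fun r => ∑ i ∈ S, Ψ i r) (fun r => ∑ i ∈ S, Ψh i r) := by
  classical
  induction S using Finset.induction_on with
  | empty => exact ⟨by simp, by simp, by simp⟩
  | insert i S hi ih =>
    simp only [Finset.sum_insert hi]
    exact (h i).add ih

lemma isPlaneFourierPair_planeGauss {a : ℝ} (ha : 0 < a) :
    IsPlaneFourierPair (fun r => (planeGauss a r : ℂ)) fun q =>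
      (Real.exp (-(q / (4 * a))) : ℂ) := by
  have hre : 0 < (a : ℂ).re := by simpa using ha
  have e : ∀ (c : Fin 2 → ℂ) (u : Fin 2 → ℝ), (planeGauss a (u 0 ^ 2 + u 1 ^ 2) : ℂ)
      * Complex.exp (∑ i, c i * u i)
      = (a / π : ℂ) * Complex.exp (-a * ∑ i, (u i : ℂ) ^ 2 + ∑ i, c i * u i) := by
    intro c u
    rw [Complex.exp_add, planeGauss]
    push_cast
    simp only [Fin.sum_univ_two]
    ring_nf
  have ec : ∀ (η₀ η₁ : ℝ) (u : Fin 2 → ℝ), -Complex.I * ((u 0 * η₀ + u 1 * η₁ : ℝ) : ℂ)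
      = ∑ i, (![-Complex.I * η₀, -Complex.I * η₁] : Fin 2 → ℂ) i * u i := by
    intro η₀ η₁ u
    simp only [Fin.sum_univ_two]
    push_cast
    simp
    ring
  refine ⟨?_, ?_, fun η₀ η₁ => ?_⟩
  · unfold planeGauss
    fun_prop
  · have h := (GaussianFourier.integrable_cexp_neg_mul_sum_add (ι := Fin 2) hre 0).const_mul
      (a / π : ℂ)
    simp only [← e] at h
    simpa using h
  · simp only [ec, e]
    rw [integral_const_mul, GaussianFourier.integral_cexp_neg_mul_sum_add hre]
    have hpi : (π : ℂ) ≠ 0 := by exact_mod_cast Real.pi_ne_zero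
    have ha' : (a : ℂ) ≠ 0 := by exact_mod_cast ha.ne'
    simp only [Fintype.card_fin, Fin.sum_univ_two]
    norm_num
    rw [← mul_assoc]
    have : (a / π : ℂ) * (π / a) = 1 := by field_simp
    rw [this, one_mul]
    congr 1
    rw [mul_pow, mul_pow, Complex.I_sq]
    ring

lemma isPlaneFourierPair_dyadicBump (l : ℤ) : IsPlaneFourierPair
    (fun r => (dyadicBump l r : ℂ)) fun q => (dyadicBumpHat l q : ℂ) := by
  have h1 := (isPlaneFourierPair_planeGauss (a := 4 ^ l) (by positivity)).const_mul 2
  have h2 := (isPlaneFourierPair_planeGauss (a := 2 * 4 ^ l) (by positivity)).const_mul (-1)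
  convert! h1.add h2 using 2
  · simp only [dyadicBump]
    push_cast
    ring
  · simp only [dyadicBumpHat]
    push_cast
    ring

lemma isPlaneFourierPair_sum_dyadicBump (S : Finset ℤ) (c : ℤ → ℂ) : IsPlaneFourierPair
    (fun r => ∑ l ∈ S, c l * ((dyadicBump l r - dyadicBump (l - 1) r : ℝ) : ℂ))
    (fun q => ∑ l ∈ S, c l * ((dyadicBumpHat l q - dyadicBumpHat (l - 1) q : ℝ) : ℂ)) := by
  refine IsPlaneFourierPair.sum S fun l => IsPlaneFourierPair.const_mul ?_ (c l)
  convert! (isPlaneFourierPair_dyadicBump l).add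
    ((isPlaneFourierPair_dyadicBump (l - 1)).const_mul (-1)) using 2 <;>
  · push_cast
    ring

/-- The surface measure of the graph of `φ` over `V`, smoothed in the last two variables. -/
def smoothGraph (V : Set (Fin 2 → ℝ)) (φ : (Fin 2 → ℝ) → Fin 2 → ℝ) (Ψ : ℝ → ℂ)
    (y : Fin 4 → ℝ) : ℂ :=
  V.indicator (fun x => Ψ ((y 2 - φ x 0) ^ 2 + (y 3 - φ x 1) ^ 2)) ![y 0, y 1]

lemma smoothGraph_shear (V : Set (Fin 2 → ℝ)) (φ : (Fin 2 → ℝ) → Fin 2 → ℝ) (Ψ : ℝ → ℂ)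
    (x u : Fin 2 → ℝ) : smoothGraph V φ Ψ ![x 0, x 1, φ x 0 + u 0, φ x 1 + u 1]
      = V.indicator 1 x * Ψ (u 0 ^ 2 + u 1 ^ 2) := by
  have : (![x 0, x 1] : Fin 2 → ℝ) = x := by ext i; fin_cases i <;> rfl
  by_cases hx : x ∈ V <;> simp [smoothGraph, this, hx]

lemma smoothGraph_sum {ι : Type*} (S : Finset ι) (V : Set (Fin 2 → ℝ))
    (φ : (Fin 2 → ℝ) → Fin 2 → ℝ) (c : ι → ℂ) (Ψ : ι → ℝ → ℂ) (y : Fin 4 → ℝ) :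
    smoothGraph V φ (fun r => ∑ i ∈ S, c i * Ψ i r) y
      = ∑ i ∈ S, c i * smoothGraph V φ (Ψ i) y := by
  by_cases hx : ![y 0, y 1] ∈ V <;> simp [smoothGraph, hx]

lemma norm_smoothGraph_le {V : Set (Fin 2 → ℝ)} {φ : (Fin 2 → ℝ) → Fin 2 → ℝ} {Ψ : ℝ → ℂ}
    {C : ℝ} (hΨ : ∀ r, 0 ≤ r → ‖Ψ r‖ ≤ C) (y : Fin 4 → ℝ) : ‖smoothGraph V φ Ψ y‖ ≤ C := by
  have hC : 0 ≤ C := (norm_nonneg _).trans (hΨ 0 le_rfl)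
  by_cases hx : ![y 0, y 1] ∈ V
  · simpa [smoothGraph, hx] using hΨ _ (by positivity)
  · simpa [smoothGraph, hx] using hC

lemma measurable_smoothGraph {V : Set (Fin 2 → ℝ)} (hV : MeasurableSet V)
    {φ : (Fin 2 → ℝ) → Fin 2 → ℝ} (hφ : Measurable φ) {Ψ : ℝ → ℂ} (hΨ : Measurable Ψ) :
    Measurable (smoothGraph V φ Ψ) := by
  have hp : Measurable fun y : Fin 4 → ℝ => (![y 0, y 1] : Fin 2 → ℝ) := by
    refine measurable_pi_lambda _ fun i => ?_
    fin_cases i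
    · exact measurable_pi_apply 0
    · exact measurable_pi_apply 1
  have h0 : Measurable fun y : Fin 4 → ℝ => φ ![y 0, y 1] 0 :=
    (measurable_pi_apply 0).comp (hφ.comp hp)
  have h1 : Measurable fun y : Fin 4 → ℝ => φ ![y 0, y 1] 1 :=
    (measurable_pi_apply 1).comp (hφ.comp hp)
  have h : smoothGraph V φ Ψ = ((fun y : Fin 4 → ℝ => ![y 0, y 1]) ⁻¹' V).indicator
      fun y => Ψ ((y 2 - φ ![y 0, y 1] 0) ^ 2 + (y 3 - φ ![y 0, y 1] 1) ^ 2) := by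
    funext y
    simp only [smoothGraph, indicator]
    rfl
  rw [h]
  refine Measurable.indicator (hΨ.comp ?_) (hp hV)
  exact (((measurable_pi_apply 2).sub h0).pow_const 2).add
    (((measurable_pi_apply 3).sub h1).pow_const 2)

section
variable {V : Set (Fin 2 → ℝ)} {φ : (Fin 2 → ℝ) → Fin 2 → ℝ}

lemma integrable_smoothGraph (hV : MeasurableSet V) (hV' : volume V < ∞) (hφ : Measurable φ)
    {Ψ Ψh : ℝ → ℂ} (h : IsPlaneFourierPair Ψ Ψh) : Integrable (smoothGraph V φ Ψ) := by
  have hmp := measurePreserving_graphShear hφ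
  refine (hmp.integrable_comp (measurable_smoothGraph hV hφ h.1).aestronglyMeasurable).1 ?_
  simp only [Function.comp_def, smoothGraph_shear]
  refine Integrable.mul_prod (f := V.indicator (1 : (Fin 2 → ℝ) → ℂ)) ?_ h.2.1
  exact (integrable_indicator_iff hV).2 (integrableOn_const hV'.ne)

/-- Integration against the smoothed surface measure. -/
lemma integral_smoothGraph_mul (hV : MeasurableSet V) (hV' : volume V < ∞) (hφ : Measurable φ)
    {Ψ Ψh : ℝ → ℂ} (h : IsPlaneFourierPair Ψ Ψh) {F : (Fin 4 → ℝ) → ℂ}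
    (hF : AEStronglyMeasurable F volume) {B : ℝ} (hB : ∀ y, ‖F y‖ ≤ B) :
    ∫ y, smoothGraph V φ Ψ y * F y = ∫ x in V, ∫ u : Fin 2 → ℝ,
      Ψ (u 0 ^ 2 + u 1 ^ 2) * F ![x 0, x 1, φ x 0 + u 0, φ x 1 + u 1] := by
  have hmp := measurePreserving_graphShear hφ
  have hFint : Integrable fun y => smoothGraph V φ Ψ y * F y :=
    (integrable_smoothGraph hV hV' hφ h).mul_bdd (c := B) hF (.of_forall hB)
  have hFint' := hmp.integrable_comp_of_integrable hFint
  rw [← hmp.map_eq, integral_map hmp.measurable.aemeasurable (by rw [hmp.map_eq]; exact hFint.1)]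
  refine (integral_prod _ hFint').trans ?_
  rw [← integral_indicator hV]
  congr 1 with x
  simp only [Function.comp_apply, smoothGraph_shear]
  by_cases hx : x ∈ V <;> simp [hx]

lemma integral_smoothGraph_exp (hV : MeasurableSet V) (hV' : volume V < ∞) (hφ : Measurable φ)
    {Ψ Ψh : ℝ → ℂ} (h : IsPlaneFourierPair Ψ Ψh) (η : Fin 4 → ℝ) :
    ∫ y, smoothGraph V φ Ψ y * Complex.exp (-Complex.I * (dot4 y η : ℂ))
      = (∫ x in V, Complex.exp (-Complex.I * (dot4 (graphMap φ x) η : ℂ)))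
        * Ψh (η 2 ^ 2 + η 3 ^ 2) := by
  have hb : ∀ y, ‖Complex.exp (-Complex.I * (dot4 y η : ℂ))‖ ≤ 1 := by
    intro y
    rw [neg_mul, mul_comm, ← neg_mul, ← Complex.ofReal_neg, Complex.norm_exp_ofReal_mul_I]
  rw [integral_smoothGraph_mul hV hV' hφ h (by unfold dot4; fun_prop) hb, ← integral_mul_const]
  congr 1 with x
  rw [← h.2.2, ← integral_const_mul]
  congr 1 with u
  rw [mul_left_comm, ← Complex.exp_add]
  congr 2
  simp [dot4, graphMap]
  ring

/-- The two endpoint bounds for the smoothed surface measures. -/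
lemma norm_convForm_smoothGraph_le (hV : MeasurableSet V) (hV' : volume V < ∞)
    (hφ : Measurable φ) {Ψ Ψh : ℝ → ℂ} (h : IsPlaneFourierPair Ψ Ψh) {θ C M : ℝ} (hC : 0 ≤ C)
    (hM : 0 ≤ M)
    (hdec : ∀ η : Fin 4 → ℝ, 0 < η 2 ^ 2 + η 3 ^ 2 →
      ‖∫ x in V, Complex.exp (Complex.I * (dot4 (graphMap φ x) η : ℝ))‖
        ≤ C * √(η 2 ^ 2 + η 3 ^ 2) ^ (-θ))
    (hΨh : ∀ q, 0 < q → ‖Ψh q‖ ≤ M * √q ^ θ) (hΨ0 : Ψh 0 = 0)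
    {f g : (Fin 4 → ℝ) → ℂ} (hf : MemLp f 2) (hg : MemLp g 2) :
    ‖convForm (smoothGraph V φ Ψ) f g‖
      ≤ C * M * ((eLpNorm f 2 volume).toReal * (eLpNorm g 2 volume).toReal) := by
  refine norm_convForm_le_of_fourier_pi (integrable_smoothGraph hV hV' hφ h) (fun η => ?_) hf hg
  rw [integral_smoothGraph_exp hV hV' hφ h, norm_mul]
  have hq : 0 ≤ η 2 ^ 2 + η 3 ^ 2 := by positivity
  rcases hq.eq_or_lt with h0 | h0
  · rw [← h0, hΨ0, norm_zero, mul_zero]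
    positivity
  · have hd := hdec (-η) (by simpa using h0)
    have e : ∀ x, Complex.exp (-Complex.I * (dot4 (graphMap φ x) η : ℂ))
        = Complex.exp (Complex.I * (dot4 (graphMap φ x) (-η) : ℝ)) := by
      intro x
      congr 1
      simp [dot4]
      ring
    simp only [e]
    simp only [Pi.neg_apply, neg_sq] at hd
    have hs : 0 < √(η 2 ^ 2 + η 3 ^ 2) := Real.sqrt_pos.2 h0
    calc _ ≤ (C * √(η 2 ^ 2 + η 3 ^ 2) ^ (-θ)) * (M * √(η 2 ^ 2 + η 3 ^ 2) ^ θ) :=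
          mul_le_mul hd (hΨh _ h0) (norm_nonneg _) (by positivity)
      _ = C * M * (√(η 2 ^ 2 + η 3 ^ 2) ^ (-θ) * √(η 2 ^ 2 + η 3 ^ 2) ^ θ) := by ring
      _ = C * M := by rw [← Real.rpow_add hs]; simp

end

lemma memLp_two_of_bound {α : Type*} [MeasureSpace α] {f : α → ℂ} {B : ℝ} (hf : Measurable f)
    (hB : ∀ x, ‖f x‖ ≤ B) (hs : volume {x | f x ≠ 0} < ∞) (p : ℝ≥0∞) : MemLp f p := by
  have hm : MeasurableSet {x | f x ≠ 0} := (hf (measurableSet_singleton 0)).compl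
  have hB0 : ∀ x, 0 ≤ B := fun x => (norm_nonneg _).trans (hB x)
  have h : MemLp ({x | f x ≠ 0}.indicator fun _ => (B : ℂ)) p volume :=
    memLp_indicator_const p hm _ (Or.inr hs.ne)
  refine h.mono hf.aestronglyMeasurable (.of_forall fun x => ?_)
  by_cases hx : f x = 0
  · simp [hx]
  · have : x ∈ {x | f x ≠ 0} := hx
    rw [indicator_of_mem this, Complex.norm_real, Real.norm_of_nonneg (hB0 x)]
    exact hB x

lemma integrable_mul_integral_of_bound {K f g : (Fin 4 → ℝ) → ℂ} (hK : Integrable K)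
    (hf : Measurable f) {B : ℝ} (hB : ∀ x, ‖f x‖ ≤ B) (hg : Integrable g) (hgm : Measurable g) :
    (∀ x, Integrable fun y => f (y - x) * g y) ∧
      Integrable fun x => K x * ∫ y, f (y - x) * g y := by
  have h1 : ∀ x, Integrable fun y => f (y - x) * g y := fun x =>
    hg.bdd_mul (c := B) (hf.comp (measurable_sub_const x)).aestronglyMeasurable
      (.of_forall fun y => hB _)
  refine ⟨h1, hK.mul_bdd (c := B * ∫ y, ‖g y‖) ?_ (.of_forall fun x => ?_)⟩
  · have : StronglyMeasurable fun p : (Fin 4 → ℝ) × (Fin 4 → ℝ) => f (p.2 - p.1) * g p.2 :=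
      ((hf.comp (measurable_snd.sub measurable_fst)).mul
        (hgm.comp measurable_snd)).stronglyMeasurable
    exact this.integral_prod_right.aestronglyMeasurable
  · rw [← integral_const_mul]
    refine norm_integral_le_of_norm_le (hg.norm.const_mul B) (.of_forall fun y => ?_)
    rw [norm_mul]
    gcongr
    exact hB _

lemma convForm_sum_sum_sum {ι κ ν : Type*} (S : Finset ν) (s : Finset ι) (t : Finset κ)
    {K : ν → (Fin 4 → ℝ) → ℂ} {F : ι → (Fin 4 → ℝ) → ℂ} {G : κ → (Fin 4 → ℝ) → ℂ}
    (hK : ∀ l, Integrable (K l)) (hF : ∀ i, Measurable (F i)) {B : ℝ} (hB : ∀ i x, ‖F i x‖ ≤ B)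
    (hG : ∀ j ∈ t, Integrable (G j)) (hGm : ∀ j, Measurable (G j))
    (c : ν → ℂ) (x : ι → ℂ) (y : κ → ℂ) :
    convForm (fun z => ∑ l ∈ S, c l * K l z) (fun z => ∑ i ∈ s, x i * F i z)
        (fun z => ∑ j ∈ t, y j * G j z)
      = ∑ l ∈ S, ∑ i ∈ s, ∑ j ∈ t, c l * x i * y j * convForm (K l) (F i) (G j) := by
  have hFint := fun l i j hj => integrable_mul_integral_of_bound (hK l) (hF i) (hB i) (hG j hj)
    (hGm j)
  have h1 : ∀ w : Fin 4 → ℝ, ∫ z, (∑ i ∈ s, x i * F i (z - w)) * (∑ j ∈ t, y j * G j z)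
      = ∑ i ∈ s, ∑ j ∈ t, x i * y j * ∫ z, F i (z - w) * G j z := by
    intro w
    simp only [Finset.sum_mul_sum]
    have e : ∀ i j z, x i * F i (z - w) * (y j * G j z) = x i * y j * (F i (z - w) * G j z) :=
      fun i j z => by ring
    simp only [e]
    rw [integral_finsetSum]
    · refine Finset.sum_congr rfl fun i _ => ?_
      rw [integral_finsetSum]
      · simp only [integral_const_mul]
      · intro j hj
        by_cases hS : S.Nonempty
        · exact ((hFint hS.choose i j hj).1 w).const_mul _
        · exact ((integrable_mul_integral_of_bound (integrable_zero _ _ _) (hF i) (hB i)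
            (hG j hj) (hGm j)).1 w).const_mul _
    · intro i _
      refine integrable_finsetSum _ fun j hj => ?_
      exact ((integrable_mul_integral_of_bound (integrable_zero _ _ _) (hF i) (hB i)
            (hG j hj) (hGm j)).1 w).const_mul _
  simp only [convForm, h1]
  have e : ∀ w : Fin 4 → ℝ, (∑ l ∈ S, c l * K l w) *
      (∑ i ∈ s, ∑ j ∈ t, x i * y j * ∫ z, F i (z - w) * G j z)
      = ∑ l ∈ S, ∑ i ∈ s, ∑ j ∈ t, c l * x i * y j * (K l w * ∫ z, F i (z - w) * G j z) := by
    intro w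
    rw [Finset.sum_mul]
    refine Finset.sum_congr rfl fun l _ => ?_
    simp only [Finset.mul_sum]
    exact Finset.sum_congr rfl fun i _ => Finset.sum_congr rfl fun j _ => by ring
  simp only [e]
  have hi : ∀ l i j, j ∈ t → Integrable fun w =>
      c l * x i * y j * (K l w * ∫ z, F i (z - w) * G j z) :=
    fun l i j hj => (hFint l i j hj).2.const_mul _
  rw [integral_finsetSum _ fun l _ => integrable_finsetSum _ fun i _ =>
    integrable_finsetSum _ fun j hj => hi l i j hj]
  refine Finset.sum_congr rfl fun l _ => ?_
  rw [integral_finsetSum _ fun i _ => integrable_finsetSum _ fun j hj => hi l i j hj]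
  refine Finset.sum_congr rfl fun i _ => ?_
  rw [integral_finsetSum _ fun j hj => hi l i j hj]
  simp only [integral_const_mul]

/-- The indicator of the fiber of a simple function over `a`. -/
def fiberInd (f : SimpleFunc (Fin 4 → ℝ) ℝ) (a : ℝ) : (Fin 4 → ℝ) → ℂ :=
  (f ⁻¹' {a}).indicator 1

lemma measurable_fiberInd (f : SimpleFunc (Fin 4 → ℝ) ℝ) (a : ℝ) :
    Measurable (fiberInd f a) :=
  measurable_const.indicator (f.measurableSet_fiber a)

lemma norm_fiberInd_le (f : SimpleFunc (Fin 4 → ℝ) ℝ) (a : ℝ) (y) : ‖fiberInd f a y‖ ≤ 1 := by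
  by_cases h : y ∈ f ⁻¹' {a} <;> simp [fiberInd, h]

lemma sum_mul_fiberInd (f : SimpleFunc (Fin 4 → ℝ) ℝ) (x : ℝ → ℂ) (y : Fin 4 → ℝ) :
    ∑ a ∈ f.range.erase 0, x a * fiberInd f a y = if f y = 0 then 0 else x (f y) := by
  have : ∀ a, x a * fiberInd f a y = if f y = a then x a else 0 := by
    intro a
    by_cases h : f y = a <;> simp [fiberInd, h]
  simp only [this, Finset.sum_ite_eq, Finset.mem_erase, SimpleFunc.mem_range_self, and_true]
  by_cases h : f y = 0 <;> simp [h]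

lemma volume_fiber_lt_top {f : SimpleFunc (Fin 4 → ℝ) ℝ} (hf : volume {x | f x ≠ 0} < ∞) {a : ℝ}
    (ha : a ≠ 0) : volume (f ⁻¹' {a}) < ∞ := by
  refine (measure_mono ?_).trans_lt hf
  rintro x hx
  rw [mem_preimage, mem_singleton_iff] at hx
  simpa [hx] using ha

lemma integrable_fiberInd {f : SimpleFunc (Fin 4 → ℝ) ℝ} (hf : volume {x | f x ≠ 0} < ∞) {a : ℝ}
    (ha : a ≠ 0) : Integrable (fiberInd f a) :=
  (integrable_indicator_iff (f.measurableSet_fiber a)).2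
    (integrableOn_const (volume_fiber_lt_top hf ha).ne)

lemma integral_simple_eq {f : SimpleFunc (Fin 4 → ℝ) ℝ} (hf : volume {x | f x ≠ 0} < ∞)
    (w : ℝ → ℝ) : ∫ y, (if f y = 0 then 0 else w (f y))
      = ∑ a ∈ f.range.erase 0, w a * volume.real (f ⁻¹' {a}) := by
  have : ∀ y, (if f y = 0 then 0 else w (f y))
      = ∑ a ∈ f.range.erase 0, (f ⁻¹' {a}).indicator (fun _ => w a) y := by
    intro y
    have : ∀ a, (f ⁻¹' {a}).indicator (fun _ => w a) y = if f y = a then w a else 0 := by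
      intro a
      by_cases h : f y = a <;> simp [h]
    simp only [this, Finset.sum_ite_eq, Finset.mem_erase, SimpleFunc.mem_range_self, and_true]
    by_cases h : f y = 0 <;> simp [h]
  simp only [this]
  rw [integral_finsetSum]
  · refine Finset.sum_congr rfl fun a _ => ?_
    rw [integral_indicator_const _ (f.measurableSet_fiber a), smul_eq_mul, mul_comm]
  · intro a ha
    rw [Finset.mem_erase] at ha
    exact (integrable_indicator_iff (f.measurableSet_fiber a)).2
      (integrableOn_const (volume_fiber_lt_top hf ha.1).ne)

lemma simple_comb_props {f : SimpleFunc (Fin 4 → ℝ) ℝ} (hf : volume {x | f x ≠ 0} < ∞)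
    (x : ℝ → ℂ) :
    (∀ p, MemLp (fun y => ∑ a ∈ f.range.erase 0, x a * fiberInd f a y) p) ∧
    ∫ y, ‖∑ a ∈ f.range.erase 0, x a * fiberInd f a y‖
      = ∑ a ∈ f.range.erase 0, ‖x a‖ * volume.real (f ⁻¹' {a}) ∧
    (eLpNorm (fun y => ∑ a ∈ f.range.erase 0, x a * fiberInd f a y) 2 volume).toReal
      = √(∑ a ∈ f.range.erase 0, ‖x a‖ ^ 2 * volume.real (f ⁻¹' {a})) := by
  have h0 : ∀ p, MemLp (fun y => ∑ a ∈ f.range.erase 0, x a * fiberInd f a y) p := by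
    intro p
    refine memLp_finsetSum _ fun a ha => ?_
    rw [Finset.mem_erase] at ha
    refine MemLp.const_mul ?_ _
    exact memLp_indicator_const (E := ℂ) p (f.measurableSet_fiber a) 1
      (Or.inr (volume_fiber_lt_top hf ha.1).ne)
  refine ⟨h0, ?_, ?_⟩
  · rw [← integral_simple_eq hf fun a => ‖x a‖]
    congr 1 with y
    rw [sum_mul_fiberInd]
    by_cases h : f y = 0 <;> simp [h]
  · rw [(h0 2).eLpNorm_eq_integral_rpow_norm (by norm_num) (by norm_num),
      ENNReal.toReal_ofReal (by positivity), ← integral_simple_eq hf fun a => ‖x a‖ ^ 2,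
      Real.sqrt_eq_rpow]
    norm_num
    congr 1
    congr 1 with y
    rw [sum_mul_fiberInd]
    by_cases h : f y = 0 <;> simp [h]

section
variable {V : Set (Fin 2 → ℝ)} {φ : (Fin 2 → ℝ) → Fin 2 → ℝ}

lemma exists_norm_convForm_simple_le (hV : MeasurableSet V) (hV' : volume V < ∞)
    (hφ : Measurable φ) {θ C : ℝ} (hθ : 0 < θ) (hθ1 : θ ≤ 1) (hC : 0 ≤ C)
    (hdec : ∀ η : Fin 4 → ℝ, 0 < η 2 ^ 2 + η 3 ^ 2 →
      ‖∫ x in V, Complex.exp (Complex.I * (dot4 (graphMap φ x) η : ℝ))‖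
        ≤ C * √(η 2 ^ 2 + η 3 ^ 2) ^ (-θ)) {p : ℝ} (hp : p = (θ + 2) / (θ + 1)) :
    ∃ C' : ℝ, 0 ≤ C' ∧ ∀ (N : ℕ) (f g : SimpleFunc (Fin 4 → ℝ) ℝ), (∀ x, 0 ≤ f x) →
      (∀ x, 0 ≤ g x) → volume {x | f x ≠ 0} < ∞ → volume {x | g x ≠ 0} < ∞ →
      ‖convForm (smoothGraph V φ fun r => (dyadicBump N r : ℂ) - dyadicBump (-N) r)
        (fun y => (f y : ℂ)) (fun y => (g y : ℂ))‖
        ≤ C' * ((∫ y, f y ^ p) ^ (1 / p) * (∫ y, g y ^ p) ^ (1 / p)) := by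
  obtain ⟨A, hA, hAb⟩ := exists_norm_sum_dyadicBump_le
  obtain ⟨B, hB, hBb⟩ := exists_norm_sum_dyadicBumpHat_le hθ hθ1
  refine ⟨max A (C * B), le_max_of_le_left hA.le, fun N f g hf hg hfs hgs => ?_⟩
  obtain ⟨S, hS⟩ := exists_sum_sub_pred_eq N
  set K : ℤ → (Fin 4 → ℝ) → ℂ := fun l =>
    smoothGraph V φ fun r => ((dyadicBump l r - dyadicBump (l - 1) r : ℝ) : ℂ) with hK
  have hpair : ∀ l : ℤ, IsPlaneFourierPair
      (fun r => ((dyadicBump l r - dyadicBump (l - 1) r : ℝ) : ℂ))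
      (fun q => ((dyadicBumpHat l q - dyadicBumpHat (l - 1) q : ℝ) : ℂ)) := by
    intro l
    simpa using isPlaneFourierPair_sum_dyadicBump {l} 1
  have hKint : ∀ l, Integrable (K l) := fun l => integrable_smoothGraph hV hV' hφ (hpair l)
  have hsum : ∀ (c : ℤ → ℂ) (x y : ℝ → ℂ),
      ∑ l ∈ S, ∑ i ∈ f.range.erase 0, ∑ j ∈ g.range.erase 0,
        c l * x i * y j * convForm (K l) (fiberInd f i) (fiberInd g j)
      = convForm (smoothGraph V φ fun r =>
          ∑ l ∈ S, c l * ((dyadicBump l r - dyadicBump (l - 1) r : ℝ) : ℂ))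
        (fun z => ∑ i ∈ f.range.erase 0, x i * fiberInd f i z)
        (fun z => ∑ j ∈ g.range.erase 0, y j * fiberInd g j z) := by
    intro c x y
    rw [← convForm_sum_sum_sum S _ _ hKint (measurable_fiberInd f) (norm_fiberInd_le f)
      (fun j hj => integrable_fiberInd hgs (Finset.ne_of_mem_erase hj)) (measurable_fiberInd g)]
    congr 1
    funext z
    rw [smoothGraph_sum]
  have main := stein_interpolation_finset (s := f.range.erase 0) (t := g.range.erase 0) (S := S)
    (M := fun l i j => convForm (K l) (fiberInd f i) (fiberInd g j))
    (u := fun a => volume.real (f ⁻¹' {a})) (v := fun a => volume.real (g ⁻¹' {a}))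
    (C := max A (C * B)) (x := fun a => max a 0) (y := fun a => max a 0)
    hθ (le_max_of_le_left hA.le) (fun _ => measureReal_nonneg)
    (fun _ => measureReal_nonneg) ?_ ?_ hp (fun _ => le_max_right _ _) fun _ => le_max_right _ _
  · have e1 : ∀ (h : SimpleFunc (Fin 4 → ℝ) ℝ), (∀ x, 0 ≤ h x) → volume {x | h x ≠ 0} < ∞ →
        ∑ a ∈ h.range.erase 0, (max a 0) ^ p * volume.real (h ⁻¹' {a}) = ∫ y, h y ^ p := by
      intro h hh hhs
      rw [← integral_simple_eq hhs fun a => (max a 0) ^ p]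
      congr 1 with y
      have hp0 : p ≠ 0 := by rw [hp]; positivity
      by_cases h0 : h y = 0
      · simp [h0, hp0]
      · simp [h0, hh y]
    have e2 : ∀ (h : SimpleFunc (Fin 4 → ℝ) ℝ), (∀ x, 0 ≤ h x) → ∀ z,
        ∑ a ∈ h.range.erase 0, ((max a 0 : ℝ) : ℂ) * fiberInd h a z = (h z : ℂ) := by
      intro h hh z
      rw [sum_mul_fiberInd h fun a => ((max a 0 : ℝ) : ℂ)]
      by_cases h0 : h z = 0
      · simp [h0]
      · simp only [h0, if_false, max_eq_left (hh z)]
    rw [e1 f hf hfs, e1 g hg hgs] at main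
    have e3 := hsum 1 (fun a => ((max a 0 : ℝ) : ℂ)) fun a => ((max a 0 : ℝ) : ℂ)
    simp only [Pi.one_apply, one_mul, e2 f hf, e2 g hg] at e3
    rw [e3] at main
    have e4 : (fun r => ∑ l ∈ S, ((dyadicBump l r - dyadicBump (l - 1) r : ℝ) : ℂ))
        = fun r => (dyadicBump N r : ℂ) - dyadicBump (-N) r := by
      funext r
      rw [← hS fun l => (dyadicBump l r : ℂ)]
      push_cast
      rfl
    rwa [e4] at main
  · intro c hc x y
    rw [hsum]
    obtain ⟨m1, i1, -⟩ := simple_comb_props hfs x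
    obtain ⟨m2, i2, -⟩ := simple_comb_props hgs y
    rw [← i1, ← i2]
    refine (norm_convForm_le_of_bound (norm_smoothGraph_le (hAb S c hc))
      (memLp_one_iff_integrable.1 (m1 1)) (memLp_one_iff_integrable.1 (m2 1))).trans ?_
    gcongr
    exact le_max_left _ _
  · intro c hc x y
    rw [hsum]
    obtain ⟨m1, -, i1⟩ := simple_comb_props hfs x
    obtain ⟨m2, -, i2⟩ := simple_comb_props hgs y
    rw [← i1, ← i2]
    refine (norm_convForm_smoothGraph_le hV hV' hφ (isPlaneFourierPair_sum_dyadicBump S c)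
      hC hB.le hdec (fun q hq => hBb S c hc q hq.le) ?_ (m1 2) (m2 2)).trans ?_
    · refine Finset.sum_eq_zero fun l _ => ?_
      simp [dyadicBumpHat]
    · gcongr
      exact le_max_right _ _

end

lemma exists_simpleFunc_tendsto {f : (Fin 4 → ℝ) → ℝ} (hf : Measurable f) (h0 : ∀ x, 0 ≤ f x) :
    ∃ F : ℕ → SimpleFunc (Fin 4 → ℝ) ℝ, (∀ n x, 0 ≤ F n x) ∧ (∀ n x, F n x ≤ f x) ∧
      ∀ x, Filter.Tendsto (fun n => F n x) Filter.atTop (nhds (f x)) := by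
  have hm : Measurable fun x => ENNReal.ofReal (f x) := hf.ennreal_ofReal
  refine ⟨fun n => (SimpleFunc.eapprox (fun x => ENNReal.ofReal (f x)) n).map ENNReal.toReal,
    fun n x => ENNReal.toReal_nonneg, fun n x => ?_, fun x => ?_⟩
  · have h : SimpleFunc.eapprox (fun x => ENNReal.ofReal (f x)) n x ≤ ENNReal.ofReal (f x) := by
      conv_rhs => rw [← SimpleFunc.iSup_eapprox_apply hm x]
      exact le_iSup (fun n => SimpleFunc.eapprox (fun x => ENNReal.ofReal (f x)) n x) n
    exact ENNReal.toReal_le_of_le_ofReal (h0 x) h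
  · have h := (ENNReal.tendsto_toReal ENNReal.ofReal_ne_top).comp
      (SimpleFunc.tendsto_eapprox hm x)
    rw [ENNReal.toReal_ofReal (h0 x)] at h
    exact h

lemma tendsto_convForm {K f g : (Fin 4 → ℝ) → ℂ} (hK : Integrable K) {B : ℝ}
    {F G : ℕ → (Fin 4 → ℝ) → ℂ} (hF : ∀ n, Measurable (F n)) (hG : ∀ n, Measurable (G n))
    (hFB : ∀ n x, ‖F n x‖ ≤ B) (hGg : ∀ n x, ‖G n x‖ ≤ ‖g x‖) (hg : Integrable g)
    (hFf : ∀ x, Filter.Tendsto (fun n => F n x) Filter.atTop (nhds (f x)))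
    (hGg' : ∀ x, Filter.Tendsto (fun n => G n x) Filter.atTop (nhds (g x))) :
    Filter.Tendsto (fun n => convForm K (F n) (G n)) Filter.atTop (nhds (convForm K f g)) := by
  have hB : 0 ≤ B := (norm_nonneg _).trans (hFB 0 0)
  have hGi : ∀ n, Integrable (G n) := fun n => hg.mono (hG n).aestronglyMeasurable
    (.of_forall (hGg n))
  have hFint := fun n => integrable_mul_integral_of_bound hK (hF n) (hFB n) (hGi n) (hG n)
  have hb : ∀ n x y, ‖F n (y - x) * G n y‖ ≤ B * ‖g y‖ := by
    intro n x y
    rw [norm_mul]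
    exact mul_le_mul (hFB _ _) (hGg _ _) (norm_nonneg _) hB
  refine tendsto_integral_of_dominated_convergence (fun x => ‖K x‖ * (B * ∫ y, ‖g y‖))
    (fun n => (hFint n).2.1) (hK.norm.mul_const _) (fun n => .of_forall fun x => ?_)
    (.of_forall fun x => ?_)
  · rw [norm_mul, ← integral_const_mul]
    gcongr
    exact norm_integral_le_of_norm_le (hg.norm.const_mul B) (.of_forall fun y => hb n x y)
  · refine Filter.Tendsto.const_mul _ ?_
    exact tendsto_integral_of_dominated_convergence (fun y => B * ‖g y‖)
      (fun n => ((hFint n).1 x).1) (hg.norm.const_mul B) (fun n => .of_forall fun y => hb n x y)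
      (.of_forall fun y => (hFf _).mul (hGg' y))

section
variable {V : Set (Fin 2 → ℝ)} {φ : (Fin 2 → ℝ) → Fin 2 → ℝ}

lemma integrable_rpow_of_bound {f : (Fin 4 → ℝ) → ℝ} {B p : ℝ} (hp : 0 < p) (hf : Measurable f)
    (h0 : ∀ x, 0 ≤ f x) (hB : ∀ x, f x ≤ B) (hs : volume {x | f x ≠ 0} < ∞) :
    Integrable fun x => f x ^ p := by
  have hm : MeasurableSet {x | f x ≠ 0} := (hf (measurableSet_singleton 0)).compl
  have h : Integrable ({x | f x ≠ 0}.indicator fun _ => B ^ p) :=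
    (integrable_indicator_iff hm).2 (integrableOn_const hs.ne)
  refine h.mono (hf.pow_const p).aestronglyMeasurable (.of_forall fun x => ?_)
  by_cases hx : f x = 0
  · simp [hx, hp.ne']
  · have : x ∈ {x | f x ≠ 0} := hx
    rw [indicator_of_mem this, Real.norm_of_nonneg (Real.rpow_nonneg (h0 x) p),
      Real.norm_of_nonneg (Real.rpow_nonneg ((h0 x).trans (hB x)) p)]
    exact Real.rpow_le_rpow (h0 x) (hB x) hp.le

lemma exists_norm_convForm_bounded_le (hV : MeasurableSet V) (hV' : volume V < ∞)
    (hφ : Measurable φ) {θ C : ℝ} (hθ : 0 < θ) (hθ1 : θ ≤ 1) (hC : 0 ≤ C)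
    (hdec : ∀ η : Fin 4 → ℝ, 0 < η 2 ^ 2 + η 3 ^ 2 →
      ‖∫ x in V, Complex.exp (Complex.I * (dot4 (graphMap φ x) η : ℝ))‖
        ≤ C * √(η 2 ^ 2 + η 3 ^ 2) ^ (-θ)) {p : ℝ} (hp : p = (θ + 2) / (θ + 1)) :
    ∃ C' : ℝ, 0 ≤ C' ∧ ∀ (N : ℕ) (f g : (Fin 4 → ℝ) → ℝ) (B : ℝ), Measurable f → Measurable g →
      (∀ x, 0 ≤ f x) → (∀ x, 0 ≤ g x) → (∀ x, f x ≤ B) → (∀ x, g x ≤ B) →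
      volume {x | f x ≠ 0} < ∞ → volume {x | g x ≠ 0} < ∞ →
      ‖convForm (smoothGraph V φ fun r => (dyadicBump N r : ℂ) - dyadicBump (-N) r)
        (fun y => (f y : ℂ)) (fun y => (g y : ℂ))‖
        ≤ C' * ((∫ y, f y ^ p) ^ (1 / p) * (∫ y, g y ^ p) ^ (1 / p)) := by
  obtain ⟨C', hC', h⟩ := exists_norm_convForm_simple_le hV hV' hφ hθ hθ1 hC hdec hp
  refine ⟨C', hC', fun N f g B hf hg f0 g0 fB gB fs gs => ?_⟩
  have hp0 : 0 < p := by rw [hp]; positivity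
  obtain ⟨F, F0, Ff, Ft⟩ := exists_simpleFunc_tendsto hf f0
  obtain ⟨G, G0, Gg, Gt⟩ := exists_simpleFunc_tendsto hg g0
  have hsupp : ∀ {k : (Fin 4 → ℝ) → ℝ} {k' : SimpleFunc (Fin 4 → ℝ) ℝ},
      (∀ x, 0 ≤ k' x) → (∀ x, k' x ≤ k x) → volume {x | k x ≠ 0} < ∞ →
      volume {x | k' x ≠ 0} < ∞ := by
    intro k k' h1 h2 h3
    refine (measure_mono fun x hx => ?_).trans_lt h3
    have : 0 < k' x := lt_of_le_of_ne (h1 x) (Ne.symm hx)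
    exact (this.trans_le (h2 x)).ne'
  have hpair : IsPlaneFourierPair (fun r => (dyadicBump N r : ℂ) - dyadicBump (-N) r)
      (fun q => (dyadicBumpHat N q : ℂ) - dyadicBumpHat (-N) q) := by
    convert! (isPlaneFourierPair_dyadicBump N).add
      ((isPlaneFourierPair_dyadicBump (-N)).const_mul (-1)) using 2 <;> ring
  have hK := integrable_smoothGraph hV hV' hφ hpair
  have hgi : Integrable fun y => (g y : ℂ) := by
    refine memLp_one_iff_integrable.1 (memLp_two_of_bound (B := B)
      (Complex.measurable_ofReal.comp hg) (fun x => ?_) (by simpa using gs) 1)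
    rw [Function.comp_apply, Complex.norm_real, Real.norm_of_nonneg (g0 x)]
    exact gB x
  have hlim := tendsto_convForm (B := B) hK (f := fun y => (f y : ℂ)) (g := fun y => (g y : ℂ))
    (F := fun n y => (F n y : ℂ)) (G := fun n y => (G n y : ℂ))
    (fun n => Complex.measurable_ofReal.comp (F n).measurable)
    (fun n => Complex.measurable_ofReal.comp (G n).measurable)
    (fun n x => by
      rw [Complex.norm_real, Real.norm_of_nonneg (F0 n x)]
      exact (Ff n x).trans (fB x))
    (fun n x => by
      rw [Complex.norm_real, Complex.norm_real, Real.norm_of_nonneg (G0 n x),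
        Real.norm_of_nonneg (g0 x)]
      exact Gg n x) hgi
    (fun x => (Complex.continuous_ofReal.tendsto _).comp (Ft x))
    (fun x => (Complex.continuous_ofReal.tendsto _).comp (Gt x))
  refine le_of_tendsto hlim.norm (.of_forall fun n => ?_)
  refine (h N (F n) (G n) (F0 n) (G0 n) (hsupp (F0 n) (Ff n) fs)
    (hsupp (G0 n) (Gg n) gs)).trans ?_
  have hmono : ∀ {k k' : (Fin 4 → ℝ) → ℝ}, Measurable k → Measurable k' → (∀ x, 0 ≤ k' x) →
      (∀ x, k' x ≤ k x) →
      (∀ x, k x ≤ B) → volume {x | k x ≠ 0} < ∞ →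
      (∫ y, k' y ^ p) ^ (1 / p) ≤ (∫ y, k y ^ p) ^ (1 / p) := by
    intro k k' hk hk' h1 h2 h3 h4
    have k0 : ∀ x, 0 ≤ k x := fun x => (h1 x).trans (h2 x)
    refine Real.rpow_le_rpow (integral_nonneg fun x => Real.rpow_nonneg (h1 x) p) ?_
      (by positivity)
    refine integral_mono_of_nonneg (.of_forall fun x => Real.rpow_nonneg (h1 x) p)
      (integrable_rpow_of_bound hp0 hk k0 h3 h4)
      (.of_forall fun x => Real.rpow_le_rpow (h1 x) (h2 x) hp0.le)
  refine mul_le_mul_of_nonneg_left (mul_le_mul (hmono hf (F n).measurable (F0 n) (Ff n) fB fs)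
    (hmono hg (G n).measurable (G0 n) (Gg n) gB gs) (Real.rpow_nonneg (integral_nonneg fun x =>
      Real.rpow_nonneg (G0 n x) p) _) (Real.rpow_nonneg (integral_nonneg fun x =>
      Real.rpow_nonneg (f0 x) p) _)) hC'

/-- The bumps `dyadicBump N` form an approximate identity. -/
lemma tendsto_integral_smoothGraph_dyadicBump (hV : MeasurableSet V) (hV' : volume V < ∞)
    (hφ : Measurable φ) {c : (Fin 4 → ℝ) → ℂ} (hc : Continuous c) {B : ℝ}
    (hB : ∀ x, ‖c x‖ ≤ B) :
    Filter.Tendsto (fun N : ℕ => ∫ y, smoothGraph V φ (fun r => (dyadicBump N r : ℂ)) y * c y)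
      Filter.atTop (nhds (∫ x in V, c (graphMap φ x))) := by
  set D : (Fin 2 → ℝ) → ℂ := fun w => (dyadicBump 0 (w 0 ^ 2 + w 1 ^ 2) : ℂ) with hD
  have hpair := isPlaneFourierPair_dyadicBump 0
  have hDi : Integrable D := hpair.2.1
  have hDm : Measurable D := by
    have : Measurable fun w : Fin 2 → ℝ => w 0 ^ 2 + w 1 ^ 2 := by fun_prop
    exact hpair.1.comp this
  have hD1 : ∫ w, D w = 1 := by
    have h := hpair.2.2 0 0
    simp only [mul_zero, add_zero, Complex.ofReal_zero, Complex.exp_zero, mul_one] at h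
    rw [hD, h]
    norm_num [dyadicBumpHat]
  have hB0 : 0 ≤ B := (norm_nonneg _).trans (hB 0)
  set P : ℕ → (Fin 2 → ℝ) → (Fin 2 → ℝ) → Fin 4 → ℝ := fun N x w =>
    ![x 0, x 1, φ x 0 + (2 ^ N)⁻¹ * w 0, φ x 1 + (2 ^ N)⁻¹ * w 1] with hP
  have hrw : ∀ N : ℕ, ∫ y, smoothGraph V φ (fun r => (dyadicBump N r : ℂ)) y * c y
      = ∫ x in V, ∫ w, D w * c (P N x w) := by
    intro N
    rw [integral_smoothGraph_mul hV hV' hφ (isPlaneFourierPair_dyadicBump N)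
      hc.aestronglyMeasurable hB]
    congr 1 with x
    have h2 : (2 : ℝ) ^ N ≠ 0 := by positivity
    have h4 : (4 : ℝ) ^ (N : ℤ) = (2 ^ N) ^ 2 := by
      rw [zpow_natCast, ← pow_mul, mul_comm, pow_mul]; norm_num
    have e : ∀ u : Fin 2 → ℝ, (dyadicBump N (u 0 ^ 2 + u 1 ^ 2) : ℂ)
        * c ![x 0, x 1, φ x 0 + u 0, φ x 1 + u 1]
        = ((2 ^ N) ^ 2 : ℝ) • (fun w => D w * c (P N x w)) ((2 ^ N : ℝ) • u) := by
      intro u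
      have e1 : dyadicBump N (u 0 ^ 2 + u 1 ^ 2) = (2 ^ N) ^ 2 *
          dyadicBump 0 ((2 ^ N * u 0) ^ 2 + (2 ^ N * u 1) ^ 2) := by
        simp only [dyadicBump, planeGauss, h4, zpow_zero]
        ring_nf
      have e2 : P N x ((2 ^ N : ℝ) • u) = ![x 0, x 1, φ x 0 + u 0, φ x 1 + u 1] := by
        simp only [hP, Pi.smul_apply, smul_eq_mul, inv_mul_cancel_left₀ h2]
      simp only [e2, hD, Pi.smul_apply, smul_eq_mul, Complex.real_smul]
      rw [e1]
      push_cast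
      ring
    simp only [e]
    rw [integral_smul, Measure.integral_comp_smul volume (fun w => D w * c (P N x w)), smul_smul]
    simp only [Module.finrank_fin_fun]
    rw [abs_of_pos (by positivity), mul_inv_cancel₀ (by positivity), one_smul]
  simp only [hrw]
  have hPm : ∀ N, Measurable (Function.uncurry (P N)) := by
    intro N
    have hφ0 : Measurable fun x => φ x 0 := (measurable_pi_apply 0).comp hφ
    have hφ1 : Measurable fun x => φ x 1 := (measurable_pi_apply 1).comp hφ
    refine measurable_pi_lambda _ fun i => ?_
    fin_cases i
    · exact Measurable.comp (g := fun x : Fin 2 → ℝ => x 0) (measurable_pi_apply 0) measurable_fst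
    · exact Measurable.comp (g := fun x : Fin 2 → ℝ => x 1) (measurable_pi_apply 1) measurable_fst
    · exact (hφ0.comp measurable_fst).add
        (((measurable_pi_apply 0).comp measurable_snd).const_mul _)
    · exact (hφ1.comp measurable_fst).add
        (((measurable_pi_apply 1).comp measurable_snd).const_mul _)
  have hb : ∀ N x w, ‖D w * c (P N x w)‖ ≤ ‖D w‖ * B := by
    intro N x w
    rw [norm_mul]
    gcongr
    exact hB _
  refine tendsto_integral_of_dominated_convergence (fun _ => (∫ w, ‖D w‖) * B) (fun N => ?_)
    (integrableOn_const hV'.ne) (fun N => .of_forall fun x => ?_) (.of_forall fun x => ?_)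
  · have : StronglyMeasurable fun q : (Fin 2 → ℝ) × (Fin 2 → ℝ) =>
        D q.2 * c (Function.uncurry (P N) q) :=
      ((hDm.comp measurable_snd).mul (hc.measurable.comp (hPm N))).stronglyMeasurable
    exact this.integral_prod_right.aestronglyMeasurable
  · rw [← integral_mul_const]
    exact norm_integral_le_of_norm_le (hDi.norm.mul_const B) (.of_forall fun w => hb N x w)
  · have hgoal : c (graphMap φ x) = ∫ w, D w * c (graphMap φ x) := by
      rw [integral_mul_const, hD1, one_mul]
    rw [hgoal]
    refine tendsto_integral_of_dominated_convergence (fun w => ‖D w‖ * B) (fun N => ?_)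
      (hDi.norm.mul_const B) (fun N => .of_forall fun w => hb N x w) (.of_forall fun w => ?_)
    · have hm : Measurable fun w => P N x w := (hPm N).comp (measurable_const.prodMk measurable_id)
      exact (hDm.mul (hc.measurable.comp hm)).aestronglyMeasurable
    · refine Filter.Tendsto.const_mul _ ((hc.tendsto _).comp ?_)
      have h2 : Filter.Tendsto (fun N : ℕ => ((2 : ℝ) ^ N)⁻¹) Filter.atTop (nhds 0) :=
        (tendsto_pow_atTop_atTop_of_one_lt (by norm_num)).inv_tendsto_atTop
      refine tendsto_pi_nhds.2 fun i => ?_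
      fin_cases i
      · exact tendsto_const_nhds
      · exact tendsto_const_nhds
      · simpa [hP, graphMap] using! (h2.mul_const (w 0)).const_add (φ x 0)
      · simpa [hP, graphMap] using! (h2.mul_const (w 1)).const_add (φ x 1)

/-- The restricted dual estimate for the surface measure. -/
lemma exists_integral_graph_mul_le (hV : MeasurableSet V) (hV' : volume V < ∞)
    (hφ : Measurable φ) {θ C : ℝ} (hθ : 0 < θ) (hθ1 : θ ≤ 1) (hC : 0 ≤ C)
    (hdec : ∀ η : Fin 4 → ℝ, 0 < η 2 ^ 2 + η 3 ^ 2 →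
      ‖∫ x in V, Complex.exp (Complex.I * (dot4 (graphMap φ x) η : ℝ))‖
        ≤ C * √(η 2 ^ 2 + η 3 ^ 2) ^ (-θ)) {p : ℝ} (hp : p = (θ + 2) / (θ + 1)) :
    ∃ C' : ℝ, 0 ≤ C' ∧ ∀ (f g : (Fin 4 → ℝ) → ℝ) (B : ℝ), Continuous f → HasCompactSupport f →
      Measurable g → (∀ x, 0 ≤ f x) → (∀ x, 0 ≤ g x) → (∀ x, g x ≤ B) →
      volume {x | g x ≠ 0} < ∞ →
      ∫ x in V, ∫ y, f (y - graphMap φ x) * g y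
        ≤ C' * ((∫ y, f y ^ p) ^ (1 / p) * (∫ y, g y ^ p) ^ (1 / p)) := by
  obtain ⟨C', hC', h⟩ := exists_norm_convForm_bounded_le hV hV' hφ hθ hθ1 hC hdec hp
  refine ⟨C', hC', fun f g B hf hfs hg f0 g0 gB gs => ?_⟩
  obtain ⟨B', hB'⟩ := hf.bounded_above_of_compact_support hfs
  have hfB : ∀ x, f x ≤ B' := fun x => (le_abs_self _).trans (hB' x)
  have hB0 : 0 ≤ B' := (f0 0).trans (hfB 0)
  have fs : volume {x | f x ≠ 0} < ∞ :=
    (measure_mono (subset_tsupport f)).trans_lt hfs.isCompact.measure_lt_top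
  have mg := memLp_two_of_bound (B := B) (f := fun y => (g y : ℂ))
      (Complex.measurable_ofReal.comp hg) (fun x => by
        rw [Complex.norm_real, Real.norm_of_nonneg (g0 x)]
        exact gB x) (by simpa using gs)
  have gi : Integrable fun y => (g y : ℂ) := memLp_one_iff_integrable.1 (mg 1)
  have fi : Integrable fun y => (f y : ℂ) := (hf.integrable_of_hasCompactSupport hfs).ofReal
  set c : (Fin 4 → ℝ) → ℂ := fun z => ∫ y, (f (y - z) : ℂ) * g y with hc
  have hbd : ∀ z y, ‖(f (y - z) : ℂ) * g y‖ ≤ B' * ‖(g y : ℂ)‖ := by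
    intro z y
    rw [norm_mul, Complex.norm_real]
    gcongr
    exact hB' _
  have hcc : Continuous c := by
    refine continuous_of_dominated (fun z => ?_) (fun z => .of_forall fun y => hbd z y)
      (gi.norm.const_mul B') (.of_forall fun y => ?_)
    · exact ((Complex.measurable_ofReal.comp (hf.measurable.comp (measurable_sub_const z))).mul
        (Complex.measurable_ofReal.comp hg)).aestronglyMeasurable
    · exact (Complex.continuous_ofReal.comp (hf.comp (by fun_prop))).mul continuous_const
  have hcB : ∀ z, ‖c z‖ ≤ B' * ∫ y, ‖(g y : ℂ)‖ := by
    intro z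
    rw [← integral_const_mul]
    exact norm_integral_le_of_norm_le (gi.norm.const_mul B') (.of_forall fun y => hbd z y)
  have hlim := tendsto_integral_smoothGraph_dyadicBump hV hV' hφ hcc hcB
  set X := C' * ((∫ y, f y ^ p) ^ (1 / p) * (∫ y, g y ^ p) ^ (1 / p)) with hX
  have hbound : ∀ N : ℕ, ‖∫ y, smoothGraph V φ (fun r => (dyadicBump N r : ℂ)) y * c y‖
      ≤ X + 4 ^ (-N : ℤ) * ((∫ y, ‖(f y : ℂ)‖) * ∫ y, ‖(g y : ℂ)‖) := by
    intro N
    have i1 := (integrable_smoothGraph hV hV' hφ (isPlaneFourierPair_dyadicBump N)).mul_bdd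
      hcc.aestronglyMeasurable (.of_forall hcB)
    have i2 := (integrable_smoothGraph hV hV' hφ (isPlaneFourierPair_dyadicBump (-N))).mul_bdd
      hcc.aestronglyMeasurable (.of_forall hcB)
    have e : ∫ y, smoothGraph V φ (fun r => (dyadicBump N r : ℂ)) y * c y
        = convForm (smoothGraph V φ fun r => (dyadicBump N r : ℂ) - dyadicBump (-N) r)
            (fun y => (f y : ℂ)) (fun y => (g y : ℂ))
          + convForm (smoothGraph V φ fun r => (dyadicBump (-N) r : ℂ))
            (fun y => (f y : ℂ)) (fun y => (g y : ℂ)) := by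
      have e1 : ∀ y, smoothGraph V φ (fun r => (dyadicBump N r : ℂ) - dyadicBump (-N) r) y
          = smoothGraph V φ (fun r => (dyadicBump N r : ℂ)) y
            - smoothGraph V φ (fun r => (dyadicBump (-N) r : ℂ)) y := by
        intro y
        by_cases hx : ![y 0, y 1] ∈ V <;> simp [smoothGraph, hx]
      simp only [convForm, e1, sub_mul]
      rw [integral_sub i1 i2]
      simp only [hc, sub_add_cancel]
    rw [e]
    refine (norm_add_le _ _).trans (add_le_add ?_ ?_)
    · exact h N f g (max B B') hf.measurable hg f0 g0 (fun x => (hfB x).trans (le_max_right _ _))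
        (fun x => (gB x).trans (le_max_left _ _)) fs gs
    · refine norm_convForm_le_of_bound (norm_smoothGraph_le fun r hr => ?_) fi gi
      rw [Complex.norm_real]
      exact abs_dyadicBump_le_zpow _ hr
  have hz : Filter.Tendsto (fun N : ℕ => X + (4 : ℝ) ^ (-N : ℤ) *
      ((∫ y, ‖(f y : ℂ)‖) * ∫ y, ‖(g y : ℂ)‖)) Filter.atTop (nhds X) := by
    have h2 : Filter.Tendsto (fun N : ℕ => ((4 : ℝ) ^ (-N : ℤ))) Filter.atTop (nhds 0) := by
      simp only [zpow_neg, zpow_natCast]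
      exact (tendsto_pow_atTop_atTop_of_one_lt (by norm_num : (1 : ℝ) < 4)).inv_tendsto_atTop
    simpa using (h2.mul_const _).const_add X
  have hfin := le_of_tendsto_of_tendsto' hlim.norm hz hbound
  refine (le_abs_self _).trans (le_of_eq_of_le ?_ hfin)
  rw [← Real.norm_eq_abs, ← Complex.norm_real]
  congr 1
  rw [← integral_complex_ofReal]
  congr 1 with x
  rw [← integral_complex_ofReal]
  simp only [hc, Complex.ofReal_mul]

end

section

variable {V : Set (Fin 2 → ℝ)} {φ : (Fin 2 → ℝ) → Fin 2 → ℝ}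

lemma measurable_sub_graphMap (hφ : Measurable φ) :
    Measurable fun q : (Fin 4 → ℝ) × (Fin 2 → ℝ) => q.1 - graphMap φ q.2 := by
  have h0 : Measurable fun x => φ x 0 := (measurable_pi_apply 0).comp hφ
  have h1 : Measurable fun x => φ x 1 := (measurable_pi_apply 1).comp hφ
  have hΓ : Measurable (graphMap φ) := by
    refine measurable_pi_lambda _ fun i => ?_
    fin_cases i
    · exact measurable_pi_apply 0
    · exact measurable_pi_apply 1
    · exact h0
    · exact h1
  exact measurable_fst.sub (hΓ.comp measurable_snd)

lemma lintegral_average_closedBall_le (hV' : volume V < ∞)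
    (hφ : Measurable φ) {θ C' p : ℝ} (hθ : 0 < θ) (hp : p = (θ + 2) / (θ + 1)) (hC' : 0 ≤ C')
    {f : (Fin 4 → ℝ) → ℝ} (hf : Continuous f) (hfs : HasCompactSupport f) (f0 : ∀ x, 0 ≤ f x)
    (h : ∀ (g : (Fin 4 → ℝ) → ℝ) (B : ℝ), Measurable g → (∀ x, 0 ≤ g x) → (∀ x, g x ≤ B) →
      volume {x | g x ≠ 0} < ∞ → ∫ x in V, ∫ y, f (y - graphMap φ x) * g y
        ≤ C' * ((∫ y, f y ^ p) ^ (1 / p) * (∫ y, g y ^ p) ^ (1 / p))) (n : ℕ) :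
    ∫⁻ y in Metric.closedBall 0 n,
        (∫⁻ x in V, ENNReal.ofReal (f (y - graphMap φ x))) ^ (θ + 2)
      ≤ (ENNReal.ofReal C' * (∫⁻ y, ENNReal.ofReal (f y) ^ p) ^ (1 / p)) ^ (θ + 2) := by
  have hp0 : 0 < p := by rw [hp]; positivity
  have : Fact (volume V < ∞) := ⟨hV'⟩
  obtain ⟨B', hB'⟩ := hf.bounded_above_of_compact_support hfs
  have hB0 : 0 ≤ B' := (norm_nonneg _).trans (hB' 0)
  have hfm : Measurable fun q : (Fin 4 → ℝ) × (Fin 2 → ℝ) => f (q.1 - graphMap φ q.2) :=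
    hf.measurable.comp (measurable_sub_graphMap hφ)
  have hfi : ∀ y, Integrable (fun x => f (y - graphMap φ x)) (volume.restrict V) := fun y =>
    Integrable.of_bound (hfm.comp (measurable_const.prodMk measurable_id)).aestronglyMeasurable B'
      (.of_forall fun x => hB' _)
  set u : (Fin 4 → ℝ) → ℝ := fun y => ∫ x in V, f (y - graphMap φ x) with hu
  have um : Measurable u :=
    (StronglyMeasurable.integral_prod_right (ν := volume.restrict V) hfm.stronglyMeasurable
      ).measurable
  have u0 : ∀ y, 0 ≤ u y := fun y => integral_nonneg fun x => f0 _
  have uB : ∀ y, u y ≤ B' * volume.real V := by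
    intro y
    refine (le_abs_self _).trans ?_
    exact norm_setIntegral_le_of_norm_le_const hV' fun x _ => hB' _
  have hTu : ∀ y, ∫⁻ x in V, ENNReal.ofReal (f (y - graphMap φ x)) = ENNReal.ofReal (u y) :=
    fun y => (ofReal_integral_eq_lintegral_ofReal (hfi y) (.of_forall fun x => f0 _)).symm
  set S : Set (Fin 4 → ℝ) := Metric.closedBall 0 n with hS
  have hSm : MeasurableSet S := Metric.isClosed_closedBall.measurableSet
  have hSv : volume S < ∞ := (isCompact_closedBall 0 (n : ℝ)).measure_lt_top
  set g : (Fin 4 → ℝ) → ℝ := S.indicator fun y => u y ^ (θ + 1) with hg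
  have gm : Measurable g := (um.pow_const _).indicator hSm
  have g0 : ∀ y, 0 ≤ g y := fun y => indicator_nonneg (fun y _ => Real.rpow_nonneg (u0 y) _) y
  have gB : ∀ y, g y ≤ (B' * volume.real V) ^ (θ + 1) := by
    intro y
    by_cases hy : y ∈ S
    · simp only [hg, indicator_of_mem hy]
      exact Real.rpow_le_rpow (u0 y) (uB y) (by positivity)
    · simp only [hg, indicator_of_notMem hy]
      positivity
  have gs : volume {y | g y ≠ 0} < ∞ :=
    (measure_mono (s := {y | g y ≠ 0}) fun y hy =>
      by_contra fun h => hy (indicator_of_notMem h _)).trans_lt hSv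
  have key := h g _ gm g0 gB gs
  have gi : Integrable g := by
    rw [hg, integrable_indicator_iff hSm]
    exact Measure.integrableOn_of_bounded (M := (B' * volume.real V) ^ (θ + 1)) hSv.ne
      (um.pow_const _).aestronglyMeasurable (.of_forall fun y => by
        rw [Real.norm_of_nonneg (Real.rpow_nonneg (u0 y) _)]
        exact Real.rpow_le_rpow (u0 y) (uB y) (by positivity))
  set I : ℝ := ∫ y in S, u y ^ (θ + 2) with hI
  have I0 : 0 ≤ I := integral_nonneg fun y => Real.rpow_nonneg (u0 y) _
  have e1 : ∫ x in V, ∫ y, f (y - graphMap φ x) * g y = I := by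
    have hFint : Integrable (Function.uncurry fun (x : Fin 2 → ℝ) (y : Fin 4 → ℝ) =>
        f (y - graphMap φ x) * g y) ((volume.restrict V).prod volume) := by
      have h1 : Integrable (fun q : (Fin 2 → ℝ) × (Fin 4 → ℝ) => g q.2)
          ((volume.restrict V).prod volume) := gi.comp_snd _
      refine h1.bdd_mul (c := B') (hfm.comp measurable_swap).aestronglyMeasurable
        (.of_forall fun q => hB' _)
    rw [integral_integral_swap hFint, hI, ← integral_indicator hSm]
    congr 1 with y
    rw [integral_mul_const]
    by_cases hy : y ∈ S
    · simp only [hg, indicator_of_mem hy]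
      rw [show θ + 2 = 1 + (θ + 1) by ring, Real.rpow_add_of_nonneg (u0 y) zero_le_one
        (by positivity : 0 ≤ θ + 1), Real.rpow_one]
    · simp only [hg, indicator_of_notMem hy, mul_zero]
  have e2 : ∫ y, g y ^ p = I := by
    rw [hI, ← integral_indicator hSm]
    congr 1 with y
    by_cases hy : y ∈ S
    · simp only [hg, indicator_of_mem hy]
      rw [← Real.rpow_mul (u0 y), hp]
      congr 1
      field_simp
    · simp only [hg, indicator_of_notMem hy]
      exact Real.zero_rpow hp0.ne'
  rw [e1, e2] at key
  set F := (∫ y, f y ^ p) ^ (1 / p) with hF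
  have F0 : 0 ≤ F := by
    rw [hF]
    exact Real.rpow_nonneg (integral_nonneg fun y => Real.rpow_nonneg (f0 y) _) _
  have hIb : I ≤ (C' * F) ^ (θ + 2) := by
    rcases I0.eq_or_lt with h0 | h0
    · rw [← h0]; positivity
    have h1 : I = I ^ (1 / (θ + 2)) * I ^ (1 / p) := by
      rw [← Real.rpow_add h0, hp]
      have : 1 / (θ + 2) + 1 / ((θ + 2) / (θ + 1)) = 1 := by field_simp; ring
      rw [this, Real.rpow_one]
    have h2 : I ^ (1 / (θ + 2)) ≤ C' * F := by
      refine le_of_mul_le_mul_right (a := I ^ (1 / p)) ?_ (Real.rpow_pos_of_pos h0 _)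
      rw [← h1]
      linarith
    calc I = (I ^ (1 / (θ + 2))) ^ (θ + 2) := by
          rw [← Real.rpow_mul I0, one_div_mul_cancel (by positivity), Real.rpow_one]
      _ ≤ _ := Real.rpow_le_rpow (Real.rpow_nonneg I0 _) h2 (by positivity)
  have e3 : ∫⁻ y in S, (∫⁻ x in V, ENNReal.ofReal (f (y - graphMap φ x))) ^ (θ + 2)
      = ENNReal.ofReal I := by
    rw [hI, ofReal_integral_eq_lintegral_ofReal]
    · refine lintegral_congr fun y => ?_
      rw [hTu, ENNReal.ofReal_rpow_of_nonneg (u0 y) (by positivity)]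
    · exact Measure.integrableOn_of_bounded (M := (B' * volume.real V) ^ (θ + 2)) hSv.ne
        (um.pow_const _).aestronglyMeasurable (.of_forall fun y => by
          rw [Real.norm_of_nonneg (Real.rpow_nonneg (u0 y) _)]
          exact Real.rpow_le_rpow (u0 y) (uB y) (by positivity))
    · exact .of_forall fun y => Real.rpow_nonneg (u0 y) _
  have e4 : ENNReal.ofReal F = (∫⁻ y, ENNReal.ofReal (f y) ^ p) ^ (1 / p) := by
    rw [hF, ← ENNReal.ofReal_rpow_of_nonneg (integral_nonneg fun y => Real.rpow_nonneg (f0 y) _)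
      (by positivity), ofReal_integral_eq_lintegral_ofReal]
    · congr 1
      refine lintegral_congr fun y => ?_
      rw [ENNReal.ofReal_rpow_of_nonneg (f0 y) hp0.le]
    · refine Continuous.integrable_of_hasCompactSupport (hf.rpow_const fun _ => .inr hp0.le) ?_
      exact hfs.comp_left (g := fun t : ℝ => t ^ p) (Real.zero_rpow hp0.ne')
    · exact .of_forall fun y => Real.rpow_nonneg (f0 y) _
  rw [e3, ← e4, ← ENNReal.ofReal_mul hC', ENNReal.ofReal_rpow_of_nonneg (by positivity)
    (by positivity)]
  exact ENNReal.ofReal_le_ofReal hIb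

/-- Convolution with the surface measure maps `L^p` into its dual, `p = (θ + 2) / (θ + 1)`, if the
Fourier transform of the measure decays like `|(η₃, η₄)| ^ (-θ)`. -/
lemma exists_lintegral_average_le (hV : MeasurableSet V) (hV' : volume V < ∞)
    (hφ : Measurable φ) {θ C : ℝ} (hθ : 0 < θ) (hθ1 : θ ≤ 1) (hC : 0 ≤ C)
    (hdec : ∀ η : Fin 4 → ℝ, 0 < η 2 ^ 2 + η 3 ^ 2 →
      ‖∫ x in V, Complex.exp (Complex.I * (dot4 (graphMap φ x) η : ℝ))‖
        ≤ C * √(η 2 ^ 2 + η 3 ^ 2) ^ (-θ)) {p : ℝ} (hp : p = (θ + 2) / (θ + 1)) :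
    ∃ C' : ℝ, 0 ≤ C' ∧ ∀ f : (Fin 4 → ℝ) → ℝ, Continuous f → (∀ x, 0 ≤ f x) →
      ∫⁻ y, (∫⁻ x in V, ENNReal.ofReal (f (y - graphMap φ x))) ^ (θ + 2)
        ≤ (ENNReal.ofReal C' * (∫⁻ y, ENNReal.ofReal (f y) ^ p) ^ (1 / p)) ^ (θ + 2) := by
  obtain ⟨C', hC', h⟩ := exists_integral_graph_mul_le hV hV' hφ hθ hθ1 hC hdec hp
  have hp0 : 0 < p := by rw [hp]; positivity
  refine ⟨C', hC', fun f hf f0 => ?_⟩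
  set χ : ℕ → (Fin 4 → ℝ) → ℝ := fun n x => max 0 (min 1 (n - ‖x‖)) with hχ
  have χ0 : ∀ n x, 0 ≤ χ n x := fun n x => le_max_left _ _
  have χ1 : ∀ n x, χ n x ≤ 1 := fun n x => max_le zero_le_one (min_le_left _ _)
  have χmono : ∀ x, Monotone fun n => χ n x := by
    intro x n k hnk
    have : (n : ℝ) ≤ k := by exact_mod_cast hnk
    simp only [hχ]
    gcongr
  have χt : ∀ x, Filter.Tendsto (fun n => χ n x) Filter.atTop (nhds 1) := by
    intro x
    obtain ⟨N, hN⟩ := exists_nat_ge (1 + ‖x‖)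
    refine tendsto_const_nhds.congr' ?_
    filter_upwards [Filter.eventually_ge_atTop N] with n hn
    have : (N : ℝ) ≤ n := by exact_mod_cast hn
    simp only [hχ]
    rw [min_eq_left (by linarith), max_eq_right zero_le_one]
  have χc : ∀ n, Continuous (χ n) := fun n => by fun_prop
  have χs : ∀ n, HasCompactSupport (χ n) := by
    intro n
    refine HasCompactSupport.of_support_subset_isCompact (isCompact_closedBall 0 (n : ℝ)) ?_
    intro x hx
    rw [mem_closedBall_zero_iff]
    by_contra hlt
    push Not at hlt
    refine hx ?_
    simp only [hχ]
    exact max_eq_left ((min_le_right _ _).trans (by linarith))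
  set k : ℕ → (Fin 4 → ℝ) → ℝ := fun n x => f x * χ n x with hk
  have kc : ∀ n, Continuous (k n) := fun n => hf.mul (χc n)
  have k0 : ∀ n x, 0 ≤ k n x := fun n x => mul_nonneg (f0 x) (χ0 n x)
  have kmono : ∀ x, Monotone fun n => k n x := fun x n l hnl =>
    mul_le_mul_of_nonneg_left (χmono x hnl) (f0 x)
  have kt : ∀ x, Filter.Tendsto (fun n => k n x) Filter.atTop (nhds (f x)) := fun x => by
    simpa using (χt x).const_mul (f x)
  have hball : ∀ n : ℕ, ∫⁻ y in Metric.closedBall (0 : Fin 4 → ℝ) n,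
      (∫⁻ x in V, ENNReal.ofReal (k n (y - graphMap φ x))) ^ (θ + 2)
      ≤ (ENNReal.ofReal C' * (∫⁻ y, ENNReal.ofReal (f y) ^ p) ^ (1 / p)) ^ (θ + 2) := by
    intro n
    refine (lintegral_average_closedBall_le hV' hφ hθ hp hC' (kc n) ((χs n).mul_left) (k0 n)
      (fun g B hg g0 gB gs => h (k n) g B (kc n) ((χs n).mul_left) hg (k0 n) g0 gB gs) n).trans ?_
    gcongr with y
    exact mul_le_of_le_one_right (f0 y) (χ1 n y)
  set T : ℕ → (Fin 4 → ℝ) → ℝ≥0∞ := fun n y =>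
    ∫⁻ x in V, ENNReal.ofReal (k n (y - graphMap φ x)) with hT
  have kTm : ∀ n, Measurable fun q : (Fin 4 → ℝ) × (Fin 2 → ℝ) =>
      ENNReal.ofReal (k n (q.1 - graphMap φ q.2)) := fun n =>
    ENNReal.measurable_ofReal.comp ((kc n).measurable.comp (measurable_sub_graphMap hφ))
  have Tm : ∀ n, Measurable (T n) := fun n => (kTm n).lintegral_prod_right'
  have Tmono : ∀ y, Monotone fun n => T n y := fun y n l hnl =>
    lintegral_mono fun x => ENNReal.ofReal_le_ofReal (kmono _ hnl)
  have Tt : ∀ y, Filter.Tendsto (fun n => T n y) Filter.atTop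
      (nhds (∫⁻ x in V, ENNReal.ofReal (f (y - graphMap φ x)))) := by
    intro y
    refine lintegral_tendsto_of_tendsto_of_monotone
      (fun n => ((kTm n).comp (measurable_const.prodMk measurable_id)).aemeasurable)
      (.of_forall fun x n l hnl => ENNReal.ofReal_le_ofReal (kmono _ hnl))
      (.of_forall fun x => (ENNReal.continuous_ofReal.tendsto _).comp (kt _))
  have hlim : Filter.Tendsto (fun n : ℕ => ∫⁻ y, (Metric.closedBall (0 : Fin 4 → ℝ) n).indicator
      (fun y => T n y ^ (θ + 2)) y) Filter.atTop
      (nhds (∫⁻ y, (∫⁻ x in V, ENNReal.ofReal (f (y - graphMap φ x))) ^ (θ + 2))) := by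
    refine lintegral_tendsto_of_tendsto_of_monotone (fun n => (((Tm n).pow_const _).indicator
      Metric.isClosed_closedBall.measurableSet).aemeasurable) (.of_forall fun y n l hnl => ?_)
      (.of_forall fun y => ?_)
    · have hnl' : (n : ℝ) ≤ l := by exact_mod_cast hnl
      refine (indicator_le_indicator_of_subset (Metric.closedBall_subset_closedBall hnl')
        (fun _ => zero_le) y).trans ?_
      refine indicator_le_indicator ?_
      exact ENNReal.rpow_le_rpow (Tmono y hnl) (by positivity)
    · obtain ⟨N, hN⟩ := exists_nat_ge ‖y‖
      refine Filter.Tendsto.congr' (f₁ := fun n => T n y ^ (θ + 2)) ?_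
        (((ENNReal.continuous_rpow_const).tendsto _).comp (Tt y))
      filter_upwards [Filter.eventually_ge_atTop N] with n hn
      have : (N : ℝ) ≤ n := by exact_mod_cast hn
      rw [indicator_of_mem]
      rw [mem_closedBall_zero_iff]
      linarith
  refine le_of_tendsto' hlim fun n => ?_
  rw [lintegral_indicator Metric.isClosed_closedBall.measurableSet]
  exact hball n

end

section

variable {V : Set (Fin 2 → ℝ)} {φ : (Fin 2 → ℝ) → Fin 2 → ℝ}

lemma measurable_graph_comp (hφ : Measurable φ) {F : (Fin 4 → ℝ) → ℝ≥0∞} (hF : Measurable F) :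
    Measurable fun y => ∫⁻ x in V, F (y - graphMap φ x) :=
  (hF.comp (measurable_sub_graphMap hφ)).lintegral_prod_right'

lemma lintegral_lintegral_graph (hφ : Measurable φ) {F : (Fin 4 → ℝ) → ℝ≥0∞}
    (hF : Measurable F) :
    ∫⁻ y, ∫⁻ x in V, F (y - graphMap φ x) = volume V * ∫⁻ y, F y := by
  rw [lintegral_lintegral_swap (f := fun y x => F (y - graphMap φ x))
    (hF.comp (measurable_sub_graphMap hφ)).aemeasurable]
  simp only [lintegral_sub_right_eq_self]
  rw [setLIntegral_const, mul_comm]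

/-- Interpolation of an `L^p → L^q` bound for averages with the trivial `L^1` and `L^∞` bounds. -/
lemma lintegral_average_rpow_le (hφ : Measurable φ) {F : (Fin 4 → ℝ) → ℝ≥0∞} (hF : Measurable F)
    {w₀ w₁ w₂ u₀ v₀ u v : ℝ} (h₀ : 0 ≤ w₀) (h₁ : 0 ≤ w₁) (h₂ : 0 ≤ w₂) (hw : w₀ + w₁ + w₂ = 1)
    (hu₀ : 0 < u₀) (hv₀ : 0 < v₀) (hu : u = w₁ + w₂ * u₀) (hv : v = w₁ + w₂ * v₀) (hu' : 0 < u)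
    {K : ℝ≥0∞}
    (hK : ∫⁻ y, (∫⁻ x in V, F (y - graphMap φ x) ^ (u₀ / u)) ^ v₀⁻¹
      ≤ (K * (∫⁻ y, (F y ^ (u₀ / u)) ^ u₀⁻¹) ^ u₀) ^ v₀⁻¹) :
    (∫⁻ y, (∫⁻ x in V, F (y - graphMap φ x)) ^ v⁻¹) ^ v
      ≤ volume V ^ w₀ * volume V ^ w₁ * K ^ w₂ * (∫⁻ y, F y ^ u⁻¹) ^ u := by
  have hv' : 0 < v := by
    rcases h₁.eq_or_lt with h | h
    · rcases h₂.eq_or_lt with h' | h'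
      · rw [hu, ← h, ← h'] at hu'; simp at hu'
      · rw [hv]; positivity
    · rw [hv]; positivity
  set X := ∫⁻ y, F y ^ u⁻¹ with hX
  set a : (Fin 4 → ℝ) → ℝ≥0∞ := fun y => ∫⁻ x in V, F (y - graphMap φ x) ^ u⁻¹ with ha
  set b : (Fin 4 → ℝ) → ℝ≥0∞ := fun y => ∫⁻ x in V, F (y - graphMap φ x) ^ (u₀ / u) with hb
  have am : Measurable a := measurable_graph_comp hφ (hF.pow_const _)
  have bm : Measurable b := measurable_graph_comp hφ (hF.pow_const _)
  have hm : ∀ y, Measurable fun x => F (y - graphMap φ x) := fun y =>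
    hF.comp ((measurable_sub_graphMap hφ).comp (measurable_const.prodMk measurable_id))
  have hpt : ∀ y, ∫⁻ x in V, F (y - graphMap φ x)
      ≤ volume V ^ w₀ * a y ^ w₁ * b y ^ w₂ := by
    intro y
    have h := ENNReal.lintegral_prod_norm_pow_le (μ := volume.restrict V)
      (Finset.univ : Finset (Fin 3))
      (f := ![fun _ => 1, fun x => F (y - graphMap φ x) ^ u⁻¹,
        fun x => F (y - graphMap φ x) ^ (u₀ / u)]) (p := ![w₀, w₁, w₂]) (fun i _ => by
          fin_cases i
          · exact aemeasurable_const
          · exact ((hm y).pow_const _).aemeasurable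
          · exact ((hm y).pow_const _).aemeasurable)
      (by simpa [Fin.sum_univ_three] using hw) (fun i _ => by fin_cases i <;> assumption)
    simp only [Fin.prod_univ_three, Matrix.cons_val_zero, Matrix.cons_val_one, Matrix.cons_val,
      ENNReal.one_rpow, one_mul, lintegral_const, Measure.restrict_apply_univ] at h
    refine le_of_eq_of_le (lintegral_congr fun x => ?_) h
    rw [← ENNReal.rpow_mul, ← ENNReal.rpow_mul, ← ENNReal.rpow_add_of_nonneg _ _ (by positivity)
      (by positivity)]
    have : u⁻¹ * w₁ + u₀ / u * w₂ = 1 := by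
      rw [hu] at hu' ⊢
      field_simp
    rw [this, ENNReal.rpow_one]
  have hexp : w₁ / v + w₂ * v₀ / v = 1 := by
    rw [← add_div, ← hv, div_self hv'.ne']
  have hFint : ∫⁻ y, (∫⁻ x in V, F (y - graphMap φ x)) ^ v⁻¹
      ≤ volume V ^ (w₀ / v) * ((volume V * X) ^ (w₁ / v) * (K * X ^ u₀) ^ (w₂ / v)) := by
    calc ∫⁻ y, (∫⁻ x in V, F (y - graphMap φ x)) ^ v⁻¹
        ≤ ∫⁻ y, volume V ^ (w₀ / v) * (a y ^ (w₁ / v) * (b y ^ v₀⁻¹) ^ (w₂ * v₀ / v)) := by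
          refine lintegral_mono fun y => ?_
          refine (ENNReal.rpow_le_rpow (hpt y) (by positivity)).trans_eq ?_
          rw [ENNReal.mul_rpow_of_nonneg _ _ (by positivity),
            ENNReal.mul_rpow_of_nonneg _ _ (by positivity), ← ENNReal.rpow_mul,
            ← ENNReal.rpow_mul, ← ENNReal.rpow_mul, ← ENNReal.rpow_mul, mul_assoc]
          congr 3
          field_simp
      _ = volume V ^ (w₀ / v) * ∫⁻ y, a y ^ (w₁ / v) * (b y ^ v₀⁻¹) ^ (w₂ * v₀ / v) :=
          lintegral_const_mul _ ((am.pow_const _).mul ((bm.pow_const _).pow_const _))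
      _ ≤ volume V ^ (w₀ / v) * ((∫⁻ y, a y) ^ (w₁ / v)
            * (∫⁻ y, b y ^ v₀⁻¹) ^ (w₂ * v₀ / v)) := by
          gcongr
          exact ENNReal.lintegral_mul_norm_pow_le am.aemeasurable (bm.pow_const _).aemeasurable
            (by positivity) (by positivity) hexp
      _ ≤ _ := by
          have e1 : ∫⁻ y, a y = volume V * X :=
            lintegral_lintegral_graph hφ (hF.pow_const u⁻¹)
          have e2 : ∫⁻ y, (F y ^ (u₀ / u)) ^ u₀⁻¹ = X := by
            refine lintegral_congr fun y => ?_
            rw [← ENNReal.rpow_mul]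
            congr 1
            field_simp
          rw [e2] at hK
          rw [e1]
          gcongr
          refine (ENNReal.rpow_le_rpow hK (by positivity)).trans_eq ?_
          rw [← ENNReal.rpow_mul]
          congr 1
          field_simp
  refine (ENNReal.rpow_le_rpow hFint hv'.le).trans_eq ?_
  rw [ENNReal.mul_rpow_of_nonneg _ _ hv'.le, ENNReal.mul_rpow_of_nonneg _ _ hv'.le,
    ← ENNReal.rpow_mul, ← ENNReal.rpow_mul, ← ENNReal.rpow_mul, div_mul_cancel₀ _ hv'.ne',
    div_mul_cancel₀ _ hv'.ne', div_mul_cancel₀ _ hv'.ne', ENNReal.mul_rpow_of_nonneg _ _ h₁,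
    ENNReal.mul_rpow_of_nonneg _ _ h₂, ← ENNReal.rpow_mul, hu,
    ENNReal.rpow_add_of_nonneg _ _ h₁ (by positivity), mul_comm u₀ w₂]
  ring

end

/-- `L^p`-improving of the surface measure in the closed triangle. -/
lemma exists_eLpNorm_muConv_le {α₁ α₂ c d : ℝ} {φ : (Fin 2 → ℝ) → Fin 2 → ℝ} (hα₁ : 0 < α₁)
    (hα₂ : 0 < α₂) (hφ : ContinuousOn φ (V1 α₁ α₂ c d)) {θ C : ℝ} (hθ : 0 < θ) (hθ1 : θ ≤ 1)
    (hC : 0 ≤ C)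
    (hdec : ∀ η : Fin 4 → ℝ, 0 < η 2 ^ 2 + η 3 ^ 2 →
      ‖∫ x in V1 α₁ α₂ c d, Complex.exp (Complex.I * (dot4 (graphMap φ x) η : ℝ))‖
        ≤ C * √(η 2 ^ 2 + η 3 ^ 2) ^ (-θ))
    {w₀ w₁ w₂ u v : ℝ} (h₀ : 0 ≤ w₀) (h₁ : 0 ≤ w₁) (h₂ : 0 ≤ w₂) (hw : w₀ + w₁ + w₂ = 1)
    (hu : u = w₁ + w₂ * ((θ + 1) / (θ + 2))) (hv : v = w₁ + w₂ * (1 / (θ + 2))) :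
    ∃ C : ℝ, 0 < C ∧ ∀ f : SchwartzMap (Fin 4 → ℝ) ℂ,
      eLpNorm (muConv α₁ α₂ c d φ f) (ENNReal.ofReal v)⁻¹ volume
        ≤ ENNReal.ofReal C * eLpNorm f (ENNReal.ofReal u)⁻¹ volume := by
  set V := V1 α₁ α₂ c d with hVdef
  have hV : MeasurableSet V := (isOpen_V1 hα₁ hα₂).measurableSet
  have hV' : volume V < ∞ := volume_V1_lt_top hα₁ hα₂
  classical
  set Φ : (Fin 2 → ℝ) → Fin 2 → ℝ := V.indicator φ with hΦ
  have hΦV : ∀ x ∈ V, graphMap Φ x = graphMap φ x := fun x hx => by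
    simp only [graphMap, hΦ, indicator_of_mem hx]
  have hΦm : Measurable Φ := by
    rw [hΦ, ← piecewise_eq_indicator]
    exact hφ.measurable_piecewise continuousOn_const hV
  have hdec' : ∀ η : Fin 4 → ℝ, 0 < η 2 ^ 2 + η 3 ^ 2 →
      ‖∫ x in V, Complex.exp (Complex.I * (dot4 (graphMap Φ x) η : ℝ))‖
        ≤ C * √(η 2 ^ 2 + η 3 ^ 2) ^ (-θ) := by
    intro η hη
    rw [setIntegral_congr_fun hV (g := fun x =>
      Complex.exp (Complex.I * (dot4 (graphMap φ x) η : ℝ))) fun x hx => by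
        simp only [hΦV x hx]]
    exact hdec η hη
  have hmu : ∀ (f : SchwartzMap (Fin 4 → ℝ) ℂ) y,
      ‖muConv α₁ α₂ c d φ f y‖ₑ ≤ ∫⁻ x in V, ‖f (y - graphMap Φ x)‖ₑ := by
    intro f y
    refine (enorm_integral_le_lintegral_enorm _).trans_eq ?_
    exact setLIntegral_congr_fun hV fun x hx => by simp only [hΦV x hx]
  obtain ⟨K, hK, h⟩ := exists_lintegral_average_le hV hV' hΦm hθ hθ1 hC hdec' rfl
  have hu0 : 0 < (θ + 1) / (θ + 2) := by positivity
  have hv0 : 0 < 1 / (θ + 2) := by positivity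
  have hunn : 0 ≤ u := by rw [hu]; positivity
  rcases hunn.eq_or_lt with hu' | hu'
  · have hw1 : w₁ = 0 := by nlinarith [mul_nonneg h₂ hu0.le]
    have hw2 : w₂ = 0 := by
      have : w₂ * ((θ + 1) / (θ + 2)) = 0 := by linarith
      exact (mul_eq_zero.1 this).resolve_right hu0.ne'
    have hv' : v = 0 := by rw [hv, hw1, hw2]; ring
    refine ⟨(volume V).toReal + 1, by positivity, fun f => ?_⟩
    rw [← hu', hv', ENNReal.ofReal_zero, ENNReal.inv_zero, eLpNorm_exponent_top,
      eLpNorm_exponent_top]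
    have hS : ∀ y, ‖f y‖ₑ ≤ eLpNormEssSup f volume := by
      have ho : IsOpen {y | eLpNormEssSup f volume < ‖f y‖ₑ} :=
        isOpen_lt continuous_const f.continuous.enorm
      have h0 := (ho.measure_eq_zero_iff (μ := volume)).1 (by
        simpa [ae_iff] using (ae_le_eLpNormEssSup (f := f) (μ := volume)))
      intro y
      by_contra hlt
      exact (h0 ▸ (show y ∈ {y | eLpNormEssSup f volume < ‖f y‖ₑ} from not_le.1 hlt) : y ∈ ∅)
    refine essSup_le_of_ae_le _ (.of_forall fun y => (hmu f y).trans ?_)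
    calc ∫⁻ x in V, ‖f (y - graphMap Φ x)‖ₑ ≤ ∫⁻ x in V, eLpNormEssSup f volume :=
          lintegral_mono fun x => hS _
      _ = volume V * eLpNormEssSup f volume := by rw [setLIntegral_const, mul_comm]
      _ ≤ ENNReal.ofReal ((volume V).toReal + 1) * eLpNormEssSup f volume := by
          gcongr
          rw [← ENNReal.ofReal_toReal hV'.ne]
          exact ENNReal.ofReal_le_ofReal (by simp)
  · have hv' : 0 < v := by
      rcases h₁.eq_or_lt with h | h
      · rcases h₂.eq_or_lt with h' | h'
        · rw [hu, ← h, ← h'] at hu'; simp at hu'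
        · rw [hv]; positivity
      · rw [hv]; positivity
    set L := volume V ^ w₀ * volume V ^ w₁ * ENNReal.ofReal K ^ w₂ with hL
    have hLt : L ≠ ∞ := ENNReal.mul_ne_top (ENNReal.mul_ne_top
      (ENNReal.rpow_ne_top_of_nonneg h₀ hV'.ne) (ENNReal.rpow_ne_top_of_nonneg h₁ hV'.ne))
      (ENNReal.rpow_ne_top_of_nonneg h₂ ENNReal.ofReal_ne_top)
    refine ⟨L.toReal + 1, by positivity, fun f => ?_⟩
    have hen : ∀ {r : ℝ}, 0 < r → ∀ g : (Fin 4 → ℝ) → ℂ,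
        eLpNorm g (ENNReal.ofReal r)⁻¹ volume = (∫⁻ y, ‖g y‖ₑ ^ r⁻¹) ^ r := by
      intro r hr g
      rw [← ENNReal.ofReal_inv_of_pos hr, eLpNorm_eq_lintegral_rpow_enorm_toReal
        (by simpa using hr) ENNReal.ofReal_ne_top, ENNReal.toReal_ofReal (by positivity)]
      simp
    rw [hen hv', hen hu']
    have hF : Measurable fun y => ‖f y‖ₑ := f.continuous.enorm.measurable
    have hconv : ∀ y, ENNReal.ofReal (‖f y‖ ^ ((θ + 1) / (θ + 2) / u))
        = ‖f y‖ₑ ^ ((θ + 1) / (θ + 2) / u) := by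
      intro y
      rw [← ENNReal.ofReal_rpow_of_nonneg (norm_nonneg _) (by positivity), ofReal_norm]
    have hstrong := h (fun y => ‖f y‖ ^ ((θ + 1) / (θ + 2) / u))
      (f.continuous.norm.rpow_const fun _ => .inr (by positivity))
      (fun y => Real.rpow_nonneg (norm_nonneg _) _)
    simp only [hconv, one_div_div] at hstrong
    have := lintegral_average_rpow_le (V := V) hΦm hF h₀ h₁ h₂ hw hu0 hv0 hu hv hu'
      (K := ENNReal.ofReal K) (by simpa [inv_div] using hstrong)
    calc _ ≤ (∫⁻ y, (∫⁻ x in V, ‖f (y - graphMap Φ x)‖ₑ) ^ v⁻¹) ^ v := by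
          gcongr with y
          exact hmu f y
      _ ≤ L * (∫⁻ y, ‖f y‖ₑ ^ u⁻¹) ^ u := this
      _ ≤ _ := by
          gcongr
          rw [← ENNReal.ofReal_toReal hLt]
          exact ENNReal.ofReal_le_ofReal (by simp)

lemma exists_schwartz_box {ι : Type*} [Fintype ι] {s : ι → ℝ} (hs : ∀ i, 0 < s i) :
    ∃ (f : SchwartzMap (ι → ℝ) ℂ) (g : (ι → ℝ) → ℝ), (∀ y, f y = g y) ∧ Continuous g ∧
      (∀ y, 0 ≤ g y) ∧ (∀ y, g y ≤ 1) ∧ (∀ y, (∀ i, |y i| ≤ s i) → g y = 1) ∧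
      ∀ y, g y ≠ 0 → ∀ i, |y i| ≤ 2 * s i := by
  let χ : ContDiffBump (0 : ℝ) := ⟨1, 2, one_pos, one_lt_two⟩
  set g : (ι → ℝ) → ℝ := fun y => ∏ i, χ (y i / s i) with hg
  have gsm : ContDiff ℝ ((⊤ : ℕ∞) : WithTop ℕ∞) g := by
    refine contDiff_prod fun i _ => ?_
    exact χ.contDiff.comp ((contDiff_apply ℝ ℝ i).div_const _)
  have gsupp : ∀ y, g y ≠ 0 → ∀ i, |y i| ≤ 2 * s i := by
    intro y hy i
    have h1 : χ (y i / s i) ≠ 0 := fun h => hy (Finset.prod_eq_zero (Finset.mem_univ i) h)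
    have h2 : y i / s i ∈ Metric.ball (0 : ℝ) 2 := by
      have := χ.support_eq
      exact this ▸ (Function.mem_support.2 h1)
    rw [mem_ball_zero_iff, Real.norm_eq_abs, abs_div, abs_of_pos (hs i), div_lt_iff₀ (hs i)] at h2
    exact h2.le
  have gcs : HasCompactSupport g := by
    refine HasCompactSupport.of_support_subset_isCompact
      (K := Icc (fun i => -(2 * s i)) (fun i => 2 * s i)) isCompact_Icc ?_
    intro y hy
    exact ⟨fun i => (abs_le.1 (gsupp y hy i)).1, fun i => (abs_le.1 (gsupp y hy i)).2⟩
  have fcs : HasCompactSupport fun y => (g y : ℂ) :=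
    gcs.comp_left (g := fun t : ℝ => (t : ℂ)) Complex.ofReal_zero
  have fsm : ContDiff ℝ ((⊤ : ℕ∞) : WithTop ℕ∞) fun y => (g y : ℂ) :=
    Complex.ofRealCLM.contDiff.comp gsm
  refine ⟨fcs.toSchwartzMap fsm, g, fun y => rfl, gsm.continuous,
    fun y => Finset.prod_nonneg fun i _ => χ.nonneg,
    fun y => Finset.prod_le_one (fun i _ => χ.nonneg) fun i _ => χ.le_one, fun y hy => ?_, gsupp⟩
  refine Finset.prod_eq_one fun i _ => χ.one_of_mem_closedBall ?_
  rw [mem_closedBall_zero_iff, Real.norm_eq_abs, abs_div, abs_of_pos (hs i)]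
  exact (div_le_one (hs i)).2 (hy i)

lemma volume_dil_image {α₁ α₂ t : ℝ} (ht : 0 < t) (S : Set (Fin 2 → ℝ)) :
    volume (dil α₁ α₂ t '' S) = ENNReal.ofReal (t ^ (α₁ + α₂)) * volume S := by
  have h : dil α₁ α₂ t = Matrix.toLin' (Matrix.diagonal ![t ^ α₁, t ^ α₂]) := by
    funext x
    ext i
    fin_cases i <;> simp [dil, Matrix.mulVec_diagonal]
  rw [h, Measure.addHaar_image_linearMap, LinearMap.det_toLin', Matrix.det_diagonal,
    Fin.prod_univ_two]
  simp only [Matrix.cons_val_zero, Matrix.cons_val_one]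
  rw [← Real.rpow_add ht, abs_of_pos (Real.rpow_pos_of_pos ht _)]

lemma dil_mem_V1 {α₁ α₂ c d t : ℝ} (ht : 0 < t) (ht1 : t ≤ 1) {x : Fin 2 → ℝ}
    (hx : x ∈ V1 α₁ α₂ c d) : dil α₁ α₂ t x ∈ V1 α₁ α₂ c d := by
  obtain ⟨s, r, hc, hd, hr, hr1, rfl⟩ := hx
  refine ⟨s, t * r, hc, hd, by positivity, by nlinarith, ?_⟩
  ext i
  fin_cases i <;> simp [dil, Real.mul_rpow ht.le hr.le, mul_assoc]

lemma exists_abs_graphMap_le {α₁ α₂ a b c d m : ℝ} {φ : (Fin 2 → ℝ) → Fin 2 → ℝ}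
    (hα₁ : 0 < α₁) (hα₂ : 0 < α₂) (hm : 0 ≤ m) (H1 : ContinuousOn φ (Vab α₁ α₂ a b))
    (H2 : ∀ x ∈ Vab α₁ α₂ a b, ∀ t : ℝ, 0 < t → φ (dil α₁ α₂ t x) = t ^ m • φ x)
    (hac : a < c) (hdb : d < b) :
    ∃ M : ℝ, 0 < M ∧ ∀ x ∈ V1 α₁ α₂ c d, ∀ i, |graphMap φ x i| ≤ M := by
  have hline : ContinuousOn (fun s : ℝ => φ ![1, s]) (Icc c d) := by
    refine H1.comp (by fun_prop) fun s hs => one_mem_Vab (hac.trans_le hs.1) (hs.2.trans_lt hdb)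
  obtain ⟨M, hM⟩ := isCompact_Icc.exists_bound_of_continuousOn hline
  refine ⟨1 + |c| + |d| + |M|, by positivity, ?_⟩
  rintro x ⟨s, t, hc, hd, ht, ht1, rfl⟩ i
  have hpow : ∀ {r : ℝ}, 0 ≤ r → |t ^ r| ≤ 1 := fun hr => by
    rw [abs_of_pos (Real.rpow_pos_of_pos ht _)]
    exact Real.rpow_le_one ht.le ht1.le hr
  have hs : |s| ≤ |c| + |d| := by
    rw [abs_le]
    constructor
    · linarith [neg_abs_le c, abs_nonneg d]
    · linarith [le_abs_self d, abs_nonneg c]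
  have hφ : ∀ j, |φ (dil α₁ α₂ t ![1, s]) j| ≤ |M| := by
    intro j
    rw [H2 _ (one_mem_Vab (hac.trans hc) (hd.trans hdb)) t ht, Pi.smul_apply, smul_eq_mul, abs_mul]
    refine (mul_le_of_le_one_left (abs_nonneg _) (hpow hm)).trans ?_
    exact (norm_le_pi_norm _ j).trans ((hM s ⟨hc.le, hd.le⟩).trans (le_abs_self M))
  have hM0 := abs_nonneg M
  have hc0 := abs_nonneg c
  have hd0 := abs_nonneg d
  fin_cases i
  · have := hpow hα₁.le
    simp only [graphMap, dil, Matrix.cons_val_zero, mul_one, Fin.zero_eta]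
    linarith
  · have : |t ^ α₂ * s| ≤ |s| := by
      rw [abs_mul]; exact mul_le_of_le_one_left (abs_nonneg _) (hpow hα₂.le)
    simp only [graphMap, dil, Matrix.cons_val_zero, Matrix.cons_val_one, Fin.mk_one]
    linarith
  · have := hφ 0
    simp only [graphMap, Fin.reduceFinMk, Matrix.cons_val]
    linarith
  · have := hφ 1
    simp only [graphMap, Fin.reduceFinMk, Matrix.cons_val]
    linarith

/-- The scaling condition necessary for `L^p`-improving. -/
lemma sub_le_of_eLpNorm_muConv_le {α₁ α₂ a b c d m : ℝ} {φ : (Fin 2 → ℝ) → Fin 2 → ℝ}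
    (hα₁ : 0 < α₁) (hα₂ : 0 < α₂) (hm : 0 < m) (H1 : ContinuousOn φ (Vab α₁ α₂ a b))
    (H2 : ∀ x ∈ Vab α₁ α₂ a b, ∀ t : ℝ, 0 < t → φ (dil α₁ α₂ t x) = t ^ m • φ x)
    (hac : a < c) (hcd : c < d) (hdb : d < b) {u v C : ℝ} (hu : 0 < u) (hv : 0 < v) (hC : 0 < C)
    (h : ∀ f : SchwartzMap (Fin 4 → ℝ) ℂ,
      eLpNorm (muConv α₁ α₂ c d φ f) (ENNReal.ofReal v)⁻¹ volume
        ≤ ENNReal.ofReal C * eLpNorm f (ENNReal.ofReal u)⁻¹ volume) :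
    (α₁ + α₂ + 2 * m) * u ≤ α₁ + α₂ + (α₁ + α₂ + 2 * m) * v := by
  obtain ⟨M, hM, hΓ⟩ := exists_abs_graphMap_le hα₁ hα₂ hm.le H1 H2 hac hdb
  set V := V1 α₁ α₂ c d with hVdef
  have hVo : IsOpen V := isOpen_V1 hα₁ hα₂
  have hV : MeasurableSet V := hVo.measurableSet
  have hVt : volume V < ∞ := volume_V1_lt_top hα₁ hα₂
  have hVsub : V ⊆ Vab α₁ α₂ a b := V1_subset_Vab.trans (Vab_mono hac.le hdb.le)
  have hVne : V.Nonempty := ⟨dil α₁ α₂ (1 / 2) ![1, (c + d) / 2], _, _, by linarith, by linarith,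
    by norm_num, by norm_num, rfl⟩
  set ω := volume.real V with hω
  have hω0 : 0 < ω := ENNReal.toReal_pos (hVo.measure_pos volume hVne).ne' hVt.ne
  set A := α₁ + α₂ with hA
  set e : Fin 4 → ℝ := ![α₁, α₂, m, m] with he
  have hprod : ∀ {t k : ℝ}, 0 < t → ∏ i, (k * t ^ e i) = k ^ 4 * t ^ (A + 2 * m) := by
    intro t k ht
    have : t ^ (A + 2 * m) = t ^ α₁ * t ^ α₂ * t ^ m * t ^ m := by
      rw [← Real.rpow_add ht, ← Real.rpow_add ht, ← Real.rpow_add ht, hA]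
      ring_nf
    rw [this]
    simp only [Fin.prod_univ_four, he, Matrix.cons_val]
    ring
  have hbox : ∀ {t k : ℝ}, 0 < t → 0 < k →
      volume (Icc (fun i => -(k * t ^ e i)) fun i => k * t ^ e i)
        = ENNReal.ofReal ((2 * k) ^ 4 * t ^ (A + 2 * m)) := by
    intro t k ht hk
    rw [Real.volume_Icc_pi, ← ENNReal.ofReal_prod_of_nonneg, ← hprod ht]
    · congr 1
      refine Finset.prod_congr rfl fun i _ => ?_
      ring
    · intro i _
      have : 0 < k * t ^ e i := mul_pos hk (Real.rpow_pos_of_pos ht _)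
      linarith
  have hscale : ∀ t : ℝ, 0 < t → t ≤ 1 → ∀ x ∈ V, ∀ i,
      |graphMap φ (dil α₁ α₂ t x) i| ≤ M * t ^ e i := by
    intro t ht ht1 x hx i
    have e1 : graphMap φ (dil α₁ α₂ t x) i = t ^ e i * graphMap φ x i := by
      have h2 := H2 x (hVsub hx) t ht
      fin_cases i
      · simp [graphMap, he, dil]
      · simp [graphMap, he, dil]
      · simp [graphMap, he, h2]
      · simp [graphMap, he, h2]
    rw [e1, abs_mul, abs_of_pos (Real.rpow_pos_of_pos ht _), mul_comm]
    exact mul_le_mul_of_nonneg_right (hΓ x hx i) (Real.rpow_nonneg ht.le _)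
  have hen : ∀ {r : ℝ}, 0 < r → ∀ (S : Set (Fin 4 → ℝ)) (c : ℝ), MeasurableSet S →
      eLpNorm (S.indicator fun _ => c) (ENNReal.ofReal r)⁻¹ volume = ‖c‖ₑ * volume S ^ r := by
    intro r hr S c hS
    rw [← ENNReal.ofReal_inv_of_pos hr, eLpNorm_indicator_const hS (by simpa using hr)
      ENNReal.ofReal_ne_top, ENNReal.toReal_ofReal (by positivity)]
    simp
  have hmain : ∀ t : ℝ, 0 < t → t ≤ 1 →
      t ^ A * ω * ((2 * M) ^ 4 * t ^ (A + 2 * m)) ^ v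
        ≤ C * ((2 * (4 * M)) ^ 4 * t ^ (A + 2 * m)) ^ u := by
    intro t ht ht1
    have htp : ∀ i, 0 < t ^ e i := fun i => Real.rpow_pos_of_pos ht _
    obtain ⟨f, g, hfg, gc, g0, g1, gone, gsupp⟩ :=
      exists_schwartz_box (s := fun i => 2 * M * t ^ e i) fun i => by have := htp i; positivity
    set S := Icc (fun i => -(M * t ^ e i)) fun i => M * t ^ e i with hS
    set S' := Icc (fun i => -(4 * M * t ^ e i)) fun i => 4 * M * t ^ e i with hS'
    have hup : eLpNorm f (ENNReal.ofReal u)⁻¹ volume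
        ≤ ENNReal.ofReal (((2 * (4 * M)) ^ 4 * t ^ (A + 2 * m)) ^ u) := by
      have h1 : eLpNorm f (ENNReal.ofReal u)⁻¹ volume
          ≤ eLpNorm (S'.indicator fun _ => (1 : ℝ)) (ENNReal.ofReal u)⁻¹ volume := by
        refine eLpNorm_mono fun y => ?_
        rw [hfg, Complex.norm_real, Real.norm_of_nonneg (g0 y)]
        by_cases hy : g y = 0
        · rw [hy]; exact norm_nonneg _
        · have hyS : y ∈ S' := by
            have := gsupp y hy
            exact ⟨fun i => by linarith [(abs_le.1 (this i)).1],
              fun i => by linarith [(abs_le.1 (this i)).2]⟩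
          rw [indicator_of_mem hyS]
          simpa using g1 y
      refine h1.trans_eq ?_
      rw [hen hu _ _ measurableSet_Icc, hbox ht (by positivity : 0 < 4 * M),
        ENNReal.ofReal_rpow_of_nonneg (by positivity) hu.le]
      simp
    have hlow : ENNReal.ofReal (t ^ A * ω * ((2 * M) ^ 4 * t ^ (A + 2 * m)) ^ v)
        ≤ eLpNorm (muConv α₁ α₂ c d φ f) (ENNReal.ofReal v)⁻¹ volume := by
      have h1 : eLpNorm (S.indicator fun _ => t ^ A * ω) (ENNReal.ofReal v)⁻¹ volume
          ≤ eLpNorm (muConv α₁ α₂ c d φ f) (ENNReal.ofReal v)⁻¹ volume := by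
        refine eLpNorm_mono fun y => ?_
        by_cases hy : y ∈ S
        swap
        · rw [indicator_of_notMem hy, norm_zero]; exact norm_nonneg _
        rw [indicator_of_mem hy, Real.norm_of_nonneg (by positivity)]
        have e1 : muConv α₁ α₂ c d φ f y = ((∫ x in V, g (y - graphMap φ x) : ℝ) : ℂ) := by
          rw [← integral_complex_ofReal]
          simp only [muConv, hfg, hVdef]
        rw [e1, Complex.norm_real, Real.norm_of_nonneg (integral_nonneg fun x => g0 _)]
        have hgc : ContinuousOn (fun x => g (y - graphMap φ x)) V := by
          refine gc.comp_continuousOn (continuousOn_const.sub ?_)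
          have hφc : ∀ j, ContinuousOn (fun x => φ x j) V := fun j =>
            (continuous_apply j).comp_continuousOn (H1.mono hVsub)
          refine continuousOn_pi.2 fun i => ?_
          fin_cases i
          · exact (continuous_apply 0).continuousOn
          · exact (continuous_apply 1).continuousOn
          · exact hφc 0
          · exact hφc 1
        have hFint : IntegrableOn (fun x => g (y - graphMap φ x)) V :=
          IntegrableOn.of_bound hVt (hgc.aestronglyMeasurable hV) 1 (.of_forall fun x => by
            rw [Real.norm_of_nonneg (g0 _)]; exact g1 _)
        have hsub : dil α₁ α₂ t '' V ⊆ V := by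
          rintro _ ⟨x, hx, rfl⟩
          exact dil_mem_V1 ht ht1 hx
        have hvol : volume.real (dil α₁ α₂ t '' V) = t ^ A * ω := by
          rw [measureReal_def, volume_dil_image ht, ENNReal.toReal_mul,
            ENNReal.toReal_ofReal (by positivity), hω, measureReal_def]
        have hDm : MeasurableSet (dil α₁ α₂ t '' V) := by
          have hinv : dil α₁ α₂ t '' V = dil α₁ α₂ t⁻¹ ⁻¹' V := by
            refine congrFun (image_eq_preimage_of_inverse (fun x => ?_) (fun x => ?_)) V <;>
              ext i <;>
              fin_cases i <;> simp [dil, Real.inv_rpow ht.le, (Real.rpow_pos_of_pos ht _).ne']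
          rw [hinv]
          have : Continuous (dil α₁ α₂ t⁻¹) := by unfold dil; fun_prop
          exact (hVo.preimage this).measurableSet
        calc t ^ A * ω = ∫ x in dil α₁ α₂ t '' V, (1 : ℝ) := by
              rw [setIntegral_const, hvol, smul_eq_mul, mul_one]
          _ = ∫ x in dil α₁ α₂ t '' V, g (y - graphMap φ x) := by
              refine setIntegral_congr_fun hDm ?_
              rintro _ ⟨x, hx, rfl⟩
              refine (gone _ fun i => ?_).symm
              have h2 := abs_le.1 (hscale t ht ht1 x hx i)
              have h3 := hy.1 i
              have h4 := hy.2 i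
              rw [Pi.sub_apply, abs_le]
              constructor <;> linarith
          _ ≤ ∫ x in V, g (y - graphMap φ x) :=
              setIntegral_mono_set hFint (.of_forall fun x => g0 _) hsub.eventuallyLE
      refine le_of_eq_of_le ?_ h1
      rw [hen hv _ _ measurableSet_Icc, hbox ht hM,
        ENNReal.ofReal_rpow_of_nonneg (by positivity) hv.le, Real.enorm_of_nonneg (by positivity),
        ← ENNReal.ofReal_mul (by positivity)]
    have := hlow.trans ((h f).trans (mul_le_mul_right hup _))
    rw [← ENNReal.ofReal_mul hC.le] at this
    exact (ENNReal.ofReal_le_ofReal_iff (by positivity)).1 this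
  by_contra hlt
  push Not at hlt
  set κ := (A + 2 * m) * u - (A + (A + 2 * m) * v) with hκ
  have hκ0 : 0 < κ := by linarith
  set c₁ := ω * ((2 * M) ^ 4) ^ v with hc₁
  set c₂ := C * ((2 * (4 * M)) ^ 4) ^ u with hc₂
  have hc₁0 : 0 < c₁ := by positivity
  have hfin : ∀ t : ℝ, 0 < t → t ≤ 1 → c₁ ≤ c₂ * t ^ κ := by
    intro t ht ht1
    have h1 := hmain t ht ht1
    rw [Real.mul_rpow (by positivity) (by positivity), Real.mul_rpow (by positivity)
      (by positivity), ← Real.rpow_mul ht.le, ← Real.rpow_mul ht.le] at h1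
    have h2 : t ^ ((A + 2 * m) * u) = t ^ κ * (t ^ A * t ^ ((A + 2 * m) * v)) := by
      rw [← Real.rpow_add ht, ← Real.rpow_add ht, hκ]
      ring_nf
    have h3 : 0 < t ^ A * t ^ ((A + 2 * m) * v) := by positivity
    refine le_of_mul_le_mul_right ?_ h3
    rw [h2] at h1
    linarith
  have hlim : Filter.Tendsto (fun t : ℝ => c₂ * t ^ κ) (nhdsWithin 0 (Ioi 0)) (nhds 0) := by
    have : ContinuousAt (fun t : ℝ => c₂ * t ^ κ) 0 :=
      (Real.continuousAt_rpow_const 0 κ (.inr hκ0.le)).const_mul c₂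
    have h0 := this.tendsto
    rw [Real.zero_rpow hκ0.ne', mul_zero] at h0
    exact h0.mono_left nhdsWithin_le_nhds
  have := ge_of_tendsto hlim (by
    filter_upwards [Ioc_mem_nhdsGT (zero_lt_one (α := ℝ))] with t ht
    exact hfin t ht.1 ht.2)
  linarith

lemma exists_weights_of_mem_convexHull_triangle {u₀ v₀ : ℝ} {P : ℝ × ℝ}
    (hP : P ∈ convexHull ℝ ({((0 : ℝ), (0 : ℝ)), ((1 : ℝ), (1 : ℝ)), (u₀, v₀)} : Set (ℝ × ℝ))) :
    ∃ w₀ w₁ w₂ : ℝ, 0 ≤ w₀ ∧ 0 ≤ w₁ ∧ 0 ≤ w₂ ∧ w₀ + w₁ + w₂ = 1 ∧ P.1 = w₁ + w₂ * u₀ ∧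
      P.2 = w₁ + w₂ * v₀ := by
  refine convexHull_min (t := {P : ℝ × ℝ | ∃ w₀ w₁ w₂ : ℝ, 0 ≤ w₀ ∧ 0 ≤ w₁ ∧ 0 ≤ w₂ ∧
    w₀ + w₁ + w₂ = 1 ∧ P.1 = w₁ + w₂ * u₀ ∧ P.2 = w₁ + w₂ * v₀}) ?_ ?_ hP
  · rintro _ (rfl | rfl | rfl)
    · exact ⟨1, 0, 0, by norm_num⟩
    · exact ⟨0, 1, 0, by norm_num⟩
    · exact ⟨0, 0, 1, by norm_num⟩
  · rintro P ⟨w₀, w₁, w₂, h₀, h₁, h₂, hw, hu, hv⟩ Q ⟨z₀, z₁, z₂, k₀, k₁, k₂, kw, ku, kv⟩ s t hs ht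
      hst
    refine ⟨s * w₀ + t * z₀, s * w₁ + t * z₁, s * w₂ + t * z₂, by positivity, by positivity,
      by positivity, by linear_combination s * hw + t * kw + hst, ?_, ?_⟩
    · simp only [Prod.fst_add, Prod.smul_fst, smul_eq_mul, hu, ku]
      ring
    · simp only [Prod.snd_add, Prod.smul_snd, smul_eq_mul, hv, kv]
      ring

/-- `L^p`-improving properties of `μ`: the closed triangle with vertices `(0,0)`,
`(1,1)` and `(1/p₀, 1/p₀′)`, where `p₀ = (α₁+α₂+2m)/(α₁+α₂+m)`, is contained in the
type set `E_μ`, and `(1/p₀, 1/p₀′)` lies on the boundary of `E_μ`. -/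
theorem stmt_18 (α₁ α₂ m a b : ℝ) (φ : (Fin 2 → ℝ) → Fin 2 → ℝ)
    (hα₁ : 0 < α₁) (hα₂ : 0 < α₂) (hαne : α₁ ≠ α₂) (hab : a < b)
    (hm : 3 * (α₁ + α₂) ≤ m)
    (H1 : AnalyticOnNhd ℝ φ (Vab α₁ α₂ a b))
    (H2 : ∀ x ∈ Vab α₁ α₂ a b, ∀ t : ℝ, 0 < t → φ (dil α₁ α₂ t x) = t ^ m • φ x)
    (c d σ : ℝ) (hac : a < c) (hcd : c < d) (hdb : d < b) (hσ : σ ∈ Set.Icc c d)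
    (H3 : {x | x ∈ closure (Vab α₁ α₂ c d) ∧ x ≠ 0 ∧ ¬ Elliptic φ x}
        = {x | ∃ t : ℝ, 0 < t ∧ x = dil α₁ α₂ t ![1, σ]})
    (n₁ n₂ : ℕ) (hn₁ : 0 < n₁) (hn₂ : 0 < n₂)
    (hn : ((max n₁ n₂ : ℕ) : ℝ) < 2 * m / (α₁ + α₂) - 3)
    (D δ : ℝ) (hD : 0 < D) (hδ : 0 < δ)
    (H4a : σ ∈ Set.Ioc c d → ∀ s ∈ Set.Ioo (σ - δ) σ, ∀ t : ℝ, 0 < t →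
      ∀ ζ : Fin 2 → ℝ, onS1 ζ →
        D * t ^ (2 * (m - α₁ - α₂)) * |s - σ| ^ n₁ ≤ |Qform φ (dil α₁ α₂ t ![1, s]) ζ|)
    (H4b : σ ∈ Set.Ico c d → ∀ s ∈ Set.Ioo σ (σ + δ), ∀ t : ℝ, 0 < t →
      ∀ ζ : Fin 2 → ℝ, onS1 ζ →
        D * t ^ (2 * (m - α₁ - α₂)) * |s - σ| ^ n₂ ≤ |Qform φ (dil α₁ α₂ t ![1, s]) ζ|)
    (Eμ : Set (ℝ × ℝ))
    (hEμ : Eμ = {uv : ℝ × ℝ | uv.1 ∈ Set.Icc (0 : ℝ) 1 ∧ uv.2 ∈ Set.Icc (0 : ℝ) 1 ∧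
      ∃ C : ℝ, 0 < C ∧ ∀ f : SchwartzMap (Fin 4 → ℝ) ℂ,
        eLpNorm (muConv α₁ α₂ c d φ (⇑f)) (ENNReal.ofReal uv.2)⁻¹
            (volume : Measure (Fin 4 → ℝ)) ≤
          ENNReal.ofReal C * eLpNorm (⇑f) (ENNReal.ofReal uv.1)⁻¹
            (volume : Measure (Fin 4 → ℝ))}) :
    convexHull ℝ ({((0 : ℝ), (0 : ℝ)), ((1 : ℝ), (1 : ℝ)),
        ((α₁ + α₂ + m) / (α₁ + α₂ + 2 * m), m / (α₁ + α₂ + 2 * m))} : Set (ℝ × ℝ)) ⊆ Eμ ∧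
    ((α₁ + α₂ + m) / (α₁ + α₂ + 2 * m), m / (α₁ + α₂ + 2 * m)) ∈ frontier Eμ := by
  have hA : 0 < α₁ + α₂ := by positivity
  have hm0 : 0 < m := by linarith
  set u₀ := (α₁ + α₂ + m) / (α₁ + α₂ + 2 * m) with hu₀
  set v₀ := m / (α₁ + α₂ + 2 * m) with hv₀
  have hL : 0 < α₁ + α₂ + 2 * m := by positivity
  have hu₀' : (α₁ + α₂ + 2 * m) * u₀ = α₁ + α₂ + m := mul_div_cancel₀ _ hL.ne'
  have hv₀' : (α₁ + α₂ + 2 * m) * v₀ = m := mul_div_cancel₀ _ hL.ne'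
  have hu₀0 : 0 < u₀ := by positivity
  have hv₀0 : 0 < v₀ := by positivity
  have hu₀1 : u₀ ≤ 1 := (div_le_one hL).2 (by linarith)
  have hv₀1 : v₀ ≤ 1 := (div_le_one hL).2 (by linarith)
  have hcont : ContinuousOn φ (Vab α₁ α₂ a b) := H1.continuousOn
  have hsub : convexHull ℝ ({((0 : ℝ), (0 : ℝ)), ((1 : ℝ), (1 : ℝ)), (u₀, v₀)} : Set (ℝ × ℝ))
      ⊆ Eμ := by
    obtain ⟨C, hC, hdec⟩ := exists_norm_integral_graphMap_le hα₁ hα₂ hm H1 H2 hac hcd hdb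
      (order_condition hα₁ hα₂ hm H1 H2 hac hcd hdb hσ H3 hn hD hδ H4a H4b)
    have hθ1 : (α₁ + α₂) / m ≤ 1 := (div_le_one hm0).2 (by linarith)
    intro P hP
    obtain ⟨w₀, w₁, w₂, h₀, h₁, h₂, hw, hu, hv⟩ := exists_weights_of_mem_convexHull_triangle hP
    rw [hEμ]
    refine ⟨⟨by rw [hu]; positivity, ?_⟩, ⟨by rw [hv]; positivity, ?_⟩,
      exists_eLpNorm_muConv_le hα₁ hα₂
        (hcont.mono (V1_subset_Vab.trans (Vab_mono hac.le hdb.le)))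
        (by positivity) hθ1 hC hdec h₀ h₁ h₂ hw (hu.trans ?_) (hv.trans ?_)⟩
    · nlinarith
    · nlinarith
    · rw [hu₀]
      congr 2
      field_simp
    · rw [hv₀]
      congr 2
      field_simp
  have hmem : (u₀, v₀) ∈ Eμ := hsub (subset_convexHull ℝ _ (by simp))
  refine ⟨hsub, subset_closure hmem, fun hFint => ?_⟩
  obtain ⟨ε, hε, hball⟩ := Metric.isOpen_iff.1 isOpen_interior _ hFint
  set r := min (ε / 2) (v₀ / 2) with hr
  have hr0 : 0 < r := by positivity
  have hrε : r < ε := (min_le_left _ _).trans_lt (by linarith)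
  have hrv : r < v₀ := (min_le_right _ _).trans_lt (by linarith)
  have hE : (u₀ + r, v₀ - r) ∈ Eμ := by
    refine interior_subset (hball ?_)
    rw [Metric.mem_ball, Prod.dist_eq, Real.dist_eq, Real.dist_eq]
    simpa [abs_of_pos hr0] using hrε
  rw [hEμ] at hE
  obtain ⟨-, -, C, hC, hbound⟩ := hE
  have := sub_le_of_eLpNorm_muConv_le hα₁ hα₂ hm0 hcont H2 hac hcd hdb
    (by linarith : 0 < u₀ + r) (by linarith : 0 < v₀ - r) hC hbound
  nlinarith [mul_pos hL hr0]

end
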